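/- Under the capillary-gravity stratified water-wave hypotheses, if the Bernoulli function β is Hölder continuous of exponent μ on [p₀,0] and the streamline density ρ is continuously differentiable with ρ' Hölder continuous of exponent μ on [p₀,0], then every streamline of the flow is a real-analytic curve: for each c ∈ [0, −p₀] there exists a real-analytic function f_c : ℝ → ℝ such that {(x,y) ∈ Ω̄ : ψ(x,y) = c} = {(x, f_c(x)) : x ∈ ℝ}; in particular (the case c = 0) the free-surface profile η is real analytic on ℝ. -/

import Mathlib

open Set

noncomputable section

/-- The mixed partial derivative `∂_x^a ∂_y^b f` of `f : ℝ² → ℝ` within the set `S`,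
realized as the iterated Fréchet derivative within `S` applied to the corresponding
coordinate directions. -/
def mpw (S : Set (ℝ × ℝ)) (a b : ℕ) (f : ℝ × ℝ → ℝ) (z : ℝ × ℝ) : ℝ :=
  iteratedFDerivWithin ℝ (a + b) f S z
    (fun i => if (i : ℕ) < a then ((1 : ℝ), (0 : ℝ)) else ((0 : ℝ), (1 : ℝ)))

/-- Euclidean distance on `ℝ²`. -/
def edist2 (z z' : ℝ × ℝ) : ℝ := Real.sqrt ((z.1 - z'.1) ^ 2 + (z.2 - z'.2) ^ 2)

section partW1
abbrev CI := C(↥(Icc (-1:ℝ) 0), ℂ)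
def WA : Type := lp (fun _ : ℤ => CI) 1
instance : NormedAddCommGroup WA := inferInstanceAs (NormedAddCommGroup (lp (fun _ : ℤ => CI) 1))
instance : NormedSpace ℝ WA := inferInstanceAs (NormedSpace ℝ (lp (fun _ : ℤ => CI) 1))
instance : CompleteSpace WA := inferInstanceAs (CompleteSpace (lp (fun _ : ℤ => CI) 1))

namespace WA
def co (a : WA) (k : ℤ) : CI := (show lp (fun _ : ℤ => CI) 1 from a) k

theorem hasSum_co (a : WA) : HasSum (fun k => ‖a.co k‖) ‖a‖ := by
  have := lp.hasSum_norm (p := 1) (by simp) (show lp (fun _ : ℤ => CI) 1 from a)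
  simp only [ENNReal.toReal_one, Real.rpow_one] at this
  exact this

theorem sco (a : WA) : Summable (fun k => ‖a.co k‖) := a.hasSum_co.summable
theorem norm_eq (a : WA) : ‖a‖ = ∑' k, ‖a.co k‖ := a.hasSum_co.tsum_eq.symm

@[ext] theorem ext' {a b : WA} (h : ∀ k, a.co k = b.co k) : a = b := lp.ext (funext h)
@[simp] theorem co_add (a b : WA) (k) : (a + b).co k = a.co k + b.co k := rfl
@[simp] theorem co_sub (a b : WA) (k) : (a - b).co k = a.co k - b.co k := rfl
@[simp] theorem co_neg (a : WA) (k) : (-a).co k = -a.co k := rfl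
@[simp] theorem co_zero (k) : (0 : WA).co k = 0 := rfl
@[simp] theorem co_smul (c : ℝ) (a : WA) (k) : (c • a).co k = c • a.co k := rfl

def mk (f : ℤ → CI) (hf : Summable fun k => ‖f k‖) : WA :=
  (⟨f, memℓp_gen (by simpa using hf)⟩ : lp (fun _ : ℤ => CI) 1)
@[simp] theorem co_mk (f : ℤ → CI) (hf : Summable fun k => ‖f k‖) (k) : (mk f hf).co k = f k := rfl

def ek (k : ℤ) (q : ℝ) : ℂ := Complex.exp (k * q * Complex.I)
theorem norm_ek (k q) : ‖ek k q‖ = 1 := by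
  have := Complex.norm_exp_ofReal_mul_I ((k:ℝ) * q)
  simpa [ek] using this
theorem ek_add (j k q) : ek (j + k) q = ek j q * ek k q := by
  simp [ek, ← Complex.exp_add]; ring_nf
@[simp] theorem ek_zero (q) : ek 0 q = 1 := by simp [ek]
@[fun_prop] theorem cont_ek (k) : Continuous (ek k) := by unfold ek; fun_prop

def ev (q : ℝ) (a : WA) : CI := ∑' k, ek k q • a.co k
theorem sev (q : ℝ) (a : WA) : Summable (fun k => ‖ek k q • a.co k‖) := by
  simpa [norm_smul, norm_ek] using a.sco
theorem hasSum_ev (q : ℝ) (a : WA) : HasSum (fun k => ek k q • a.co k) (ev q a) :=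
  (sev q a).of_norm.hasSum
theorem norm_ev_le (q a) : ‖ev q a‖ ≤ ‖a‖ := by
  refine (norm_tsum_le_tsum_norm (sev q a)).trans ?_
  simp [norm_smul, norm_ek, a.norm_eq]
@[simp] theorem ev_add (q a b) : ev q (a + b) = ev q a + ev q b := by
  refine (hasSum_ev q (a+b)).unique ?_
  convert (hasSum_ev q a).add (hasSum_ev q b) using 2 with k
  ext p; simp [mul_add]
@[simp] theorem ev_sub (q a b) : ev q (a - b) = ev q a - ev q b := by
  refine (hasSum_ev q (a-b)).unique ?_
  simpa [smul_sub] using (hasSum_ev q a).sub (hasSum_ev q b)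
@[simp] theorem ev_neg (q a) : ev q (-a) = - ev q a := by
  refine (hasSum_ev q (-a)).unique ?_
  simpa using (hasSum_ev q a).neg
@[simp] theorem ev_zero (q) : ev q 0 = 0 := by
  have h : ∀ k, ek k q • (0 : CI) = 0 := fun k => by ext p; simp
  simp [ev, h]
@[simp] theorem ev_smul (c : ℝ) (q a) : ev q (c • a) = c • ev q a := by
  refine (hasSum_ev q (c • a)).unique ?_
  convert (hasSum_ev q a).const_smul c using 2 with k
  rw [co_smul, smul_comm]

/-- joint continuity in q -/
theorem cont_ev (a : WA) (p) : Continuous (fun q => ev q a p) := by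
  have h : (fun q => ev q a p) = fun q => ∑' k, ek k q * a.co k p := by
    funext q
    have := ((ContinuousMap.evalCLM ℂ p).hasSum (hasSum_ev q a)).tsum_eq
    simpa using this.symm
  rw [h]
  refine continuous_tsum (fun k => by fun_prop) a.sco (fun k q => ?_)
  simpa [norm_ek] using (a.co k).norm_coe_le_norm p

theorem int_ek (k : ℤ) : ∫ q in (-Real.pi)..Real.pi, ek k q = if k = 0 then (2 * Real.pi : ℂ) else 0 := by
  split_ifs with h
  · subst h; simp; ring
  · have hk : (k : ℂ) * Complex.I ≠ 0 := mul_ne_zero (by exact_mod_cast h) Complex.I_ne_zero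
    have : ∀ q : ℝ, ek k q = Complex.exp (k * Complex.I * q) := fun q => by simp [ek]; ring_nf
    simp_rw [this]
    rw [integral_exp_mul_complex hk]
    have e : Complex.exp (k * Complex.I * (Real.pi:ℝ)) = Complex.exp (k * Complex.I * ((-Real.pi:ℝ):ℂ)) := by
      rw [Complex.exp_eq_exp_iff_exists_int]
      exact ⟨k, by push_cast; ring⟩
    rw [e]; simp

theorem int_ev (a : WA) (k : ℤ) (p) :
    ∫ q in (-Real.pi)..Real.pi, ek (-k) q * ev q a p = 2 * Real.pi * a.co k p := by
  have h := intervalIntegral.hasSum_intervalIntegral_of_summable_norm (a := -Real.pi) (b := Real.pi)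
    (f := fun j : ℤ => (⟨fun q => ek (j - k) q * a.co j p, by fun_prop⟩ : C(ℝ, ℂ))) ?_
  · have h1 : ∀ q, ∑' j : ℤ, ek (j - k) q * a.co j p = ek (-k) q * ev q a p := by
      intro q
      have := (((ContinuousMap.evalCLM ℂ p).hasSum (hasSum_ev q a)).mul_left (ek (-k) q)).tsum_eq
      refine Eq.trans ?_ this
      refine tsum_congr fun j => ?_
      simp [sub_eq_add_neg, ek_add]; ring
    simp only [ContinuousMap.coe_mk, h1] at h
    refine h.unique ?_
    have h2 : ∀ j : ℤ, ∫ q in (-Real.pi)..Real.pi, ek (j - k) q * a.co j p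
        = if j = k then 2 * Real.pi * a.co k p else 0 := by
      intro j
      rw [intervalIntegral.integral_mul_const, int_ek]
      by_cases hj : j = k
      · simp [hj]
      · simp [hj, sub_eq_zero]
    simp only [h2]
    exact hasSum_ite_eq k _
  · refine Summable.of_nonneg_of_le (fun _ => norm_nonneg _) (fun j => ?_) a.sco
    refine (ContinuousMap.norm_le _ (norm_nonneg _)).2 fun q => ?_
    simpa [norm_ek] using (a.co j).norm_coe_le_norm p

theorem ev_inj {a b : WA} (h : ∀ q, ev q a = ev q b) : a = b := by
  ext k p
  have h1 := int_ev a k p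
  simp only [h] at h1
  rw [int_ev b k p] at h1
  have : (2 * Real.pi : ℂ) ≠ 0 := by simp [Real.pi_ne_zero]
  exact (mul_left_cancel₀ this h1).symm

def pe : ℤ × ℤ ≃ ℤ × ℤ where
  toFun x := (x.2, x.1 - x.2)
  invFun y := (y.1 + y.2, y.1)
  left_inv x := by simp
  right_inv y := by simp

theorem smul_aux (a b : WA) : Summable fun x : ℤ × ℤ => ‖a.co x.2‖ * ‖b.co (x.1 - x.2)‖ := by
  have := (a.sco.mul_of_nonneg b.sco (fun _ => norm_nonneg _) (fun _ => norm_nonneg _))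
  exact (pe.summable_iff.2 this)

theorem smul_aux1 (a b : WA) (k : ℤ) : Summable fun j : ℤ => ‖a.co j * b.co (k - j)‖ :=
  Summable.of_nonneg_of_le (fun _ => norm_nonneg _) (fun _ => norm_mul_le _ _)
    ((smul_aux a b).prod_factor k)

theorem smul_aux2 (a b : WA) (k : ℤ) :
    ‖∑' j : ℤ, a.co j * b.co (k - j)‖ ≤ ∑' j : ℤ, ‖a.co j‖ * ‖b.co (k - j)‖ :=
  (norm_tsum_le_tsum_norm (smul_aux1 a b k)).trans
    ((smul_aux1 a b k).tsum_le_tsum (fun _ => norm_mul_le _ _) ((smul_aux a b).prod_factor k))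

theorem smul_aux3 (a b : WA) : Summable fun k : ℤ => ‖∑' j : ℤ, a.co j * b.co (k - j)‖ :=
  Summable.of_nonneg_of_le (fun _ => norm_nonneg _) (smul_aux2 a b) (smul_aux a b).prod

instance : Mul WA := ⟨fun a b => mk (fun k => ∑' j : ℤ, a.co j * b.co (k - j)) (smul_aux3 a b)⟩
theorem co_mul (a b : WA) (k) : (a * b).co k = ∑' j : ℤ, a.co j * b.co (k - j) := rfl

theorem norm_mul_le' (a b : WA) : ‖a * b‖ ≤ ‖a‖ * ‖b‖ := by
  rw [norm_eq (a * b)]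
  refine ((smul_aux3 a b).tsum_le_tsum (smul_aux2 a b) (smul_aux a b).prod).trans ?_
  rw [← (smul_aux a b).tsum_prod, a.norm_eq, b.norm_eq,
    a.sco.tsum_mul_tsum b.sco (a.sco.mul_of_nonneg b.sco (fun _ => norm_nonneg _) (fun _ => norm_nonneg _))]
  exact (pe.tsum_eq (fun x : ℤ × ℤ => ‖a.co x.1‖ * ‖b.co x.2‖)).le

@[simp] theorem ev_mul (q a b) : ev q (a * b) = ev q a * ev q b := by
  have hs := summable_mul_of_summable_norm (sev q a) (sev q b)
  have e : ∀ x : ℤ × ℤ, (fun y : ℤ × ℤ => (ek y.1 q • a.co y.1) * (ek y.2 q • b.co y.2)) (pe x)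
      = ek x.1 q • (a.co x.2 * b.co (x.1 - x.2)) := by
    intro x
    have : ek x.1 q = ek x.2 q * ek (x.1 - x.2) q := by rw [← ek_add]; simp
    simp only [pe, Equiv.coe_fn_mk, this]
    rw [smul_mul_smul_comm]
  have hs2 := pe.summable_iff.2 hs
  simp only [Function.comp_def, e] at hs2
  rw [ev, ev, ev, tsum_mul_tsum_of_summable_norm (sev q a) (sev q b),
    ← pe.tsum_eq]
  simp only [e]
  rw [hs2.tsum_prod]
  refine tsum_congr fun k => ?_
  exact ((smul_aux1 a b k).of_norm.tsum_const_smul (ek k q)).symm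

def const (f : CI) : WA := mk (fun k => if k = 0 then f else 0)
  (summable_of_ne_finset_zero (s := {0}) (fun k hk => by simp at hk; simp [hk]))
@[simp] theorem ev_const (q f) : ev q (const f) = f := by
  have h : ∀ k, ek k q • (0 : CI) = 0 := fun k => by ext p; simp
  rw [ev, tsum_eq_single 0]
  · simp [const]
  · intro k hk; simp [const, hk, h]
theorem norm_const (f : CI) : ‖const f‖ = ‖f‖ := by
  rw [norm_eq, tsum_eq_single 0]
  · simp [const]
  · intro k hk; simp [const, hk]

instance : One WA := ⟨const 1⟩
@[simp] theorem ev_one (q) : ev q 1 = 1 := ev_const q 1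

instance : CommRing WA :=
  { (inferInstance : AddCommGroup WA) with
    mul := (· * ·)
    one := 1
    left_distrib := fun a b c => ev_inj fun q => by simp [mul_add]
    right_distrib := fun a b c => ev_inj fun q => by simp [add_mul]
    zero_mul := fun a => ev_inj fun q => by simp
    mul_zero := fun a => ev_inj fun q => by simp
    mul_assoc := fun a b c => ev_inj fun q => by simp [mul_assoc]
    one_mul := fun a => ev_inj fun q => by simp
    mul_one := fun a => ev_inj fun q => by simp
    mul_comm := fun a b => ev_inj fun q => by simp [mul_comm] }

instance : NormedCommRing WA :=
  { (inferInstance : NormedAddCommGroup WA), (inferInstance : CommRing WA) with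
    norm_mul_le := norm_mul_le' }

instance : Algebra ℝ WA := Algebra.ofModule
  (fun r a b => ev_inj fun q => by simp [smul_mul_assoc]) (fun r a b => ev_inj fun q => by simp [mul_smul_comm])

instance : NormedAlgebra ℝ WA :=
  { (inferInstance : Algebra ℝ WA) with norm_smul_le := fun r a => norm_smul_le r a }

@[simp] theorem ev_pow (q a) (n : ℕ) : ev q (a ^ n) = ev q a ^ n := by
  induction n with
  | zero => simp
  | succ n ih => simp [pow_succ, ih]

theorem ev_inverse (q : ℝ) {a : WA} (h : IsUnit a) (p) : ev q (Ring.inverse a) p = (ev q a p)⁻¹ := by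
  have h1 : ev q (a * Ring.inverse a) p = 1 := by rw [Ring.mul_inverse_cancel _ h]; simp
  simp only [ev_mul, ContinuousMap.mul_apply] at h1
  exact eq_inv_of_mul_eq_one_right h1

example : NormedSpace ℝ WA := inferInstance
example : (NormedAlgebra.toNormedSpace WA : NormedSpace ℝ WA) = instNormedSpaceRealWA := rfl
end WA
end partW1

section partW2
namespace WA

def ex (f : CI) : ℝ → ℂ := IccExtend (by norm_num : (-1:ℝ) ≤ 0) f
@[fun_prop] theorem cont_ex (f : CI) : Continuous (ex f) := f.continuous.Icc_extend'
theorem ex_of_mem (f : CI) {p : ℝ} (hp : p ∈ Icc (-1:ℝ) 0) : ex f p = f ⟨p, hp⟩ := IccExtend_of_mem _ _ hp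
theorem ex_coe (f : CI) (p : Icc (-1:ℝ) 0) : ex f p = f p := IccExtend_val _ _ p
theorem norm_ex_le (f : CI) (p) : ‖ex f p‖ ≤ ‖f‖ := f.norm_coe_le_norm _
@[simp] theorem ex_add (f g : CI) (p) : ex (f + g) p = ex f p + ex g p := rfl
@[simp] theorem ex_sub (f g : CI) (p) : ex (f - g) p = ex f p - ex g p := rfl
@[simp] theorem ex_smul (c : ℝ) (f : CI) (p) : ex (c • f) p = c • ex f p := rfl

def Ki (x0 c : ℝ) (f : CI) (p : ℝ) : ℂ :=
  (Real.exp (c * p) : ℂ) * ∫ t in x0..p, (Real.exp (-(c * t)) : ℂ) * ex f t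

theorem Ki_deriv (x0 c : ℝ) (f : CI) (p : ℝ) :
    HasDerivAt (Ki x0 c f) (c * Ki x0 c f p + ex f p) p := by
  have h1 : HasDerivAt (fun p => ∫ t in x0..p, (Real.exp (-(c * t)) : ℂ) * ex f t)
      ((Real.exp (-(c * p)) : ℂ) * ex f p) p := by
    apply intervalIntegral.integral_hasDerivAt_right
    · apply Continuous.intervalIntegrable; fun_prop
    · exact (by fun_prop : Continuous fun t => (Real.exp (-(c * t)) : ℂ) * ex f t).stronglyMeasurableAtFilter _ _
    · fun_prop
  have h2 : HasDerivAt (fun p : ℝ => (Real.exp (c * p) : ℂ)) ((Real.exp (c * p) * c : ℝ)) p := by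
    apply HasDerivAt.ofReal_comp
    have := ((hasDerivAt_id p).const_mul c).exp
    simpa using this
  refine (h2.mul h1).congr_deriv ?_
  have : (Real.exp (c * p) : ℂ) * Real.exp (-(c * p)) = 1 := by
    rw [← Complex.ofReal_mul, ← Real.exp_add]; simp
  simp only [Ki]
  push_cast at this ⊢
  linear_combination (ex f p) * this

@[fun_prop] theorem cont_Ki (x0 c f) : Continuous (Ki x0 c f) :=
  continuous_iff_continuousAt.2 fun p => (Ki_deriv x0 c f p).continuousAt
@[simp] theorem Ki_self (x0 c f) : Ki x0 c f x0 = 0 := by simp [Ki]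

theorem Ki_unique (x0 c : ℝ) (hx0 : x0 ∈ Icc (-1:ℝ) 0) (f : CI) (y : CI) (y0 : ℂ) (h0 : ex y x0 = y0)
    (h : ∀ p ∈ Ioo (-1:ℝ) 0, HasDerivAt (ex y) (c * ex y p + ex f p) p) :
    ∀ p ∈ Icc (-1:ℝ) 0, ex y p = Real.exp (c * (p - x0)) * y0 + Ki x0 c f p := by
  set z : ℝ → ℂ := fun p => (Real.exp (-(c * p)) : ℂ) * (ex y p - Ki x0 c f p) with hz
  have hc : ContinuousOn z (Icc (-1) 0) := by apply Continuous.continuousOn; fun_prop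
  have hd : ∀ p ∈ Ioo (-1:ℝ) 0, HasDerivAt z 0 p := by
    intro p hp
    have h2 : HasDerivAt (fun p : ℝ => (Real.exp (-(c * p)) : ℂ)) ((Real.exp (-(c * p)) * (-c) : ℝ)) p := by
      apply HasDerivAt.ofReal_comp
      have := ((hasDerivAt_id p).const_mul c).neg.exp
      simpa using this
    refine (h2.mul ((h p hp).sub (Ki_deriv x0 c f p))).congr_deriv ?_
    simp only [Pi.sub_apply]; push_cast; ring
  have key : ∀ p ∈ Icc (-1:ℝ) 0, z p = z (-1) := by
    intro p hp
    have := intervalIntegral.integral_eq_sub_of_hasDerivAt_of_le hp.1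
      (hc.mono (Icc_subset_Icc_right hp.2)) (f' := fun _ => 0)
      (fun x hx => hd x ⟨hx.1, hx.2.trans_le hp.2⟩) (by simp)
    rw [intervalIntegral.integral_zero] at this
    exact (sub_eq_zero.1 this.symm)
  intro p hp
  have h1 := (key p hp).trans (key x0 hx0).symm
  simp only [hz, Ki_self, h0, sub_zero] at h1
  have e1 : (Real.exp (c * p) : ℂ) * Real.exp (-(c * p)) = 1 := by
    rw [← Complex.ofReal_mul, ← Real.exp_add]; simp
  have e2 : (Real.exp (c * p) : ℂ) * Real.exp (-(c * x0)) = Real.exp (c * (p - x0)) := by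
    rw [← Complex.ofReal_mul, ← Real.exp_add]; congr 2; ring
  linear_combination (Real.exp (c * p) : ℂ) * h1 - (ex y p - Ki x0 c f p) * e1 + y0 * e2

def KL (x0 c s : ℝ) : CI →ₗ[ℝ] CI where
  toFun f := ⟨fun p => s * Ki x0 c f p, by fun_prop⟩
  map_add' f g := by
    ext p
    have : Ki x0 c (f + g) p = Ki x0 c f p + Ki x0 c g p := by
      simp only [Ki, ex_add, mul_add]
      rw [intervalIntegral.integral_add, mul_add] <;> apply Continuous.intervalIntegrable <;> fun_prop
    simp [this, mul_add]
  map_smul' r f := by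
    ext p
    have : Ki x0 c (r • f) p = r * Ki x0 c f p := by
      have : ∀ t, (Real.exp (-(c * t)) : ℂ) * ex (r • f) t = r * ((Real.exp (-(c * t)) : ℂ) * ex f t) := by
        intro t; simp; ring
      simp only [Ki, this]
      rw [intervalIntegral.integral_const_mul]; ring
    simp [this]; ring

theorem int_exp_ker (c x0 p : ℝ) (hc : c ≠ 0) :
    ∫ t in x0..p, Real.exp (-(c * t)) = (Real.exp (-(c * x0)) - Real.exp (-(c * p))) / c := by
  have : ∀ t ∈ uIcc x0 p, HasDerivAt (fun t => - Real.exp (-(c * t)) / c) (Real.exp (-(c * t))) t := by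
    intro t _
    have := (((hasDerivAt_id t).const_mul c).neg.exp.neg).div_const c
    refine this.congr_deriv ?_
    simp; field_simp
  rw [intervalIntegral.integral_eq_sub_of_hasDerivAt this (by apply Continuous.intervalIntegrable; fun_prop)]
  ring

/-- bound on Ki -/
theorem norm_Ki_le (x0 c : ℝ) (f : CI) (p : ℝ) :
    ‖Ki x0 c f p‖ ≤ Real.exp (c * p) * |∫ t in x0..p, Real.exp (-(c * t))| * ‖f‖ := by
  have h : ‖∫ t in x0..p, (Real.exp (-(c * t)) : ℂ) * ex f t‖ ≤ |∫ t in x0..p, Real.exp (-(c * t)) * ‖f‖| := by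
    apply intervalIntegral.norm_integral_le_abs_of_norm_le
    · refine Filter.Eventually.of_forall fun t => ?_
      rw [norm_mul, Complex.norm_real, Real.norm_of_nonneg (Real.exp_pos _).le]
      gcongr; exact norm_ex_le f t
    · apply Continuous.intervalIntegrable; fun_prop
  rw [intervalIntegral.integral_mul_const, abs_mul, abs_of_nonneg (norm_nonneg f)] at h
  rw [Ki, norm_mul, Complex.norm_real, Real.norm_of_nonneg (Real.exp_pos _).le, mul_assoc]
  gcongr

theorem KL_bd_m (κ : ℝ) (hκ : 0 ≤ κ) (f : CI) : ‖KL (-1) (-κ) κ f‖ ≤ 1 * ‖f‖ := by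
  refine (ContinuousMap.norm_le _ (by positivity)).2 fun p => ?_
  have h := norm_Ki_le (-1) (-κ) f p
  simp only [KL, LinearMap.coe_mk, AddHom.coe_mk, ContinuousMap.coe_mk, norm_mul, Complex.norm_real, Real.norm_of_nonneg hκ]
  rcases hκ.eq_or_lt with rfl | hk
  · simp
  rw [int_exp_ker _ _ _ (by linarith)] at h
  have hp := p.2.1
  have e1 : Real.exp (-κ) ≤ Real.exp (κ * p) := Real.exp_le_exp.2 (by nlinarith)
  have e2 : Real.exp (-κ * p) * Real.exp (κ * p) = 1 := by rw [← Real.exp_add]; simp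
  refine (mul_le_mul_of_nonneg_left h hκ).trans ?_
  rw [← mul_assoc]
  refine mul_le_mul_of_nonneg_right ?_ (norm_nonneg _)
  have e3 : (Real.exp (-(-κ * -1)) - Real.exp (-(-κ * ↑p))) / -κ = (Real.exp (κ * p) - Real.exp (-κ)) / κ := by
    simp; rw [div_neg, ← neg_div]; simp
  rw [e3, abs_of_nonneg (div_nonneg (by linarith) hκ)]
  have : κ * (Real.exp (-κ * ↑p) * ((Real.exp (κ * ↑p) - Real.exp (-κ)) / κ)) = 1 - Real.exp (-κ * p) * Real.exp (-κ) := by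
    generalize Real.exp (-κ * p) = A at *
    field_simp; linear_combination e2
  rw [this]; have := Real.exp_pos (-κ * p); have := Real.exp_pos (-κ); nlinarith

theorem KL_bd_p (κ : ℝ) (hκ : 0 ≤ κ) (f : CI) : ‖KL 0 κ κ f‖ ≤ 1 * ‖f‖ := by
  refine (ContinuousMap.norm_le _ (by positivity)).2 fun p => ?_
  have h := norm_Ki_le 0 κ f p
  simp only [KL, LinearMap.coe_mk, AddHom.coe_mk, ContinuousMap.coe_mk, norm_mul, Complex.norm_real, Real.norm_of_nonneg hκ]
  rcases hκ.eq_or_lt with rfl | hk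
  · simp
  rw [int_exp_ker _ _ _ (by linarith)] at h
  have hp := p.2.2
  have e1 : 1 ≤ Real.exp (-(κ * p)) := Real.one_le_exp (by have := mul_nonneg hκ (neg_nonneg.2 hp); linarith)
  have e2 : Real.exp (κ * p) * Real.exp (-(κ * p)) = 1 := by rw [← Real.exp_add]; simp
  refine (mul_le_mul_of_nonneg_left h hκ).trans ?_
  rw [← mul_assoc]
  refine mul_le_mul_of_nonneg_right ?_ (norm_nonneg _)
  have e3 : |(Real.exp (-(κ * 0)) - Real.exp (-(κ * ↑p))) / κ| = (Real.exp (-(κ * p)) - 1) / κ := by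
    rw [abs_of_nonpos (div_nonpos_of_nonpos_of_nonneg (by simp only [mul_zero, neg_zero, Real.exp_zero]; linarith) hκ)]; simp; ring
  rw [e3]
  have : κ * (Real.exp (κ * ↑p) * ((Real.exp (-(κ * ↑p)) - 1) / κ)) = 1 - Real.exp (κ * p) := by
    field_simp; linear_combination e2
  rw [this]; have := Real.exp_pos (κ * p); linarith

theorem KL_bd_0 (f : CI) : ‖KL (-1) 0 1 f‖ ≤ 1 * ‖f‖ := by
  refine (ContinuousMap.norm_le _ (by positivity)).2 fun p => ?_
  have h := norm_Ki_le (-1) 0 f p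
  simp only [KL, LinearMap.coe_mk, AddHom.coe_mk, ContinuousMap.coe_mk]
  simp at h ⊢
  refine h.trans (mul_le_of_le_one_left (norm_nonneg _) ?_)
  rw [abs_le]; constructor <;> linarith [p.2.1, p.2.2]

def diag (L : ℤ → CI →ₗ[ℝ] CI) (h : ∀ k f, ‖L k f‖ ≤ 1 * ‖f‖) : WA →L[ℝ] WA :=
  LinearMap.mkContinuous
    { toFun := fun a => mk (fun k => L k (a.co k))
        (Summable.of_nonneg_of_le (fun _ => norm_nonneg _) (fun k => (h k _).trans (by simp)) a.sco)
      map_add' := fun a b => by ext1 k; simp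
      map_smul' := fun r a => by ext1 k; simp } 1 (fun a => by
      rw [norm_eq, norm_eq a, one_mul]
      refine Summable.tsum_le_tsum (fun k => ?_) (sco _) (sco _)
      simpa using h k (a.co k))
@[simp] theorem co_diag (L h) (a : WA) (k) : (diag L h a).co k = L k (a.co k) := rfl

def mulL (z : ℂ) : CI →ₗ[ℝ] CI where
  toFun f := z • f
  map_add' f g := by ext p; simp [mul_add]
  map_smul' r f := by ext p; simp; ring
theorem mulL_bd {z : ℂ} (hz : ‖z‖ ≤ 1) (f) : ‖mulL z f‖ ≤ 1 * ‖f‖ := by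
  refine (norm_smul_le z f).trans ?_
  gcongr

def sg (k : ℤ) : ℂ := Complex.I * (SignType.sign k : ℤ)
theorem sg_sq {k : ℤ} (hk : k ≠ 0) : sg k * sg k = -1 := by
  have : ((SignType.sign k : ℤ) : ℂ) * (SignType.sign k : ℤ) = 1 := by
    rcases lt_or_gt_of_ne hk with h | h <;> simp [h]
  unfold sg
  linear_combination this * Complex.I * Complex.I + Complex.I_mul_I
@[simp] theorem sg_zero : sg 0 = 0 := by simp [sg]
theorem norm_sg (k) : ‖sg k‖ ≤ 1 := by
  rcases lt_trichotomy k 0 with h | h | h <;> simp [sg, h]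
def kap (k : ℤ) : ℝ := |(k:ℝ)|
theorem kap_nonneg (k) : 0 ≤ kap k := abs_nonneg _
@[simp] theorem kap_zero : kap 0 = 0 := by simp [kap]
theorem kap_sg (k : ℤ) : (kap k : ℂ) * sg k = Complex.I * k := by
  have : ((kap k : ℝ) : ℂ) = ((|k| : ℤ) : ℂ) := by rw [kap, ← Int.cast_abs, Complex.ofReal_intCast]
  rw [this, sg]
  have := abs_mul_sign k
  have h2 : ((|k| : ℤ) : ℂ) * (SignType.sign k : ℤ) = (k : ℂ) := by rw [← Int.cast_mul, this]
  linear_combination Complex.I * h2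

def Bm : WA →L[ℝ] WA := diag (fun k => KL (-1) (-kap k) (kap k)) (fun k => KL_bd_m _ (kap_nonneg k))
def Bp : WA →L[ℝ] WA := diag (fun k => KL 0 (kap k) (kap k)) (fun k => KL_bd_p _ (kap_nonneg k))
def prim : WA →L[ℝ] WA := diag (fun _ => KL (-1) 0 1) (fun _ => KL_bd_0)
def Hil : WA →L[ℝ] WA := diag (fun k => mulL (sg k)) (fun k => mulL_bd (norm_sg k))
def Jop : WA →L[ℝ] WA := diag (fun k => mulL (Complex.I * k)⁻¹) (fun k => mulL_bd (by
  rcases eq_or_ne k 0 with rfl | h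
  · simp
  · have : (1:ℝ) ≤ |(k:ℝ)| := by exact_mod_cast Int.one_le_abs h
    simp; exact inv_le_one_of_one_le₀ this))
def Pr0 : WA →L[ℝ] WA := diag (fun k => mulL (if k = 0 then 0 else 1)) (fun k => mulL_bd (by
  split_ifs <;> simp))
def poisL (κ : ℝ) : CI →ₗ[ℝ] CI where
  toFun f := ⟨fun p => Real.exp (κ * p) * ex f 0, by fun_prop⟩
  map_add' f g := by ext p; simp [mul_add]
  map_smul' r f := by ext p; simp; ring
def Pois : WA →L[ℝ] WA := diag (fun k => poisL (kap k)) (fun k f => by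
  refine (ContinuousMap.norm_le _ (by positivity)).2 fun p => ?_
  simp only [poisL, LinearMap.coe_mk, AddHom.coe_mk, ContinuousMap.coe_mk, norm_mul, Complex.norm_real, Real.norm_of_nonneg (Real.exp_pos _).le]
  gcongr
  · exact Real.exp_le_one_iff.2 (mul_nonpos_of_nonneg_of_nonpos (kap_nonneg k) p.2.2)
  · exact norm_ex_le f 0)

/-- The solver -/
def Tu : WA × WA →L[ℝ] WA :=
  Bm.comp ((Hil.comp (ContinuousLinearMap.fst ℝ WA WA)) - ContinuousLinearMap.snd ℝ WA WA)
theorem Tu_apply (F G) : Tu (F, G) = Bm (Hil F - G) := rfl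
def Tq (F G φ : WA) : WA := Pois φ + Hil (Bp (Tu (F, G) + G))
def Tp (F G φ : WA) : WA := G + Tu (F, G) - Hil (Tq F G φ)

theorem co_Hil (a : WA) (k) : (Hil a).co k = sg k • a.co k := rfl

theorem ex_KL (x0 c s : ℝ) (f : CI) {p : ℝ} (hp : p ∈ Icc (-1:ℝ) 0) : ex (KL x0 c s f) p = s * Ki x0 c f p := by
  rw [ex_of_mem _ hp]; rfl
@[simp] theorem ex_csmul (c : ℂ) (f : CI) (p) : ex (c • f) p = c * ex f p := rfl
theorem ext_ex {f g : CI} (h : ∀ p ∈ Icc (-1:ℝ) 0, ex f p = ex g p) : f = g := by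
  ext p; rw [← ex_coe, ← ex_coe, h p p.2]

theorem Ki_smul (x0 c s : ℝ) (f : CI) (p) : Ki x0 c (s • f) p = s * Ki x0 c f p := by
  have : ∀ t, (Real.exp (-(c * t)) : ℂ) * ex (s • f) t = s * ((Real.exp (-(c * t)) : ℂ) * ex f t) := by
    intro t; simp; ring
  simp only [Ki, this]
  rw [intervalIntegral.integral_const_mul]; ring
theorem Ki_csmul (x0 c : ℝ) (s : ℂ) (f : CI) (p) : Ki x0 c (s • f) p = s * Ki x0 c f p := by
  have : ∀ t, (Real.exp (-(c * t)) : ℂ) * ex (s • f) t = s * ((Real.exp (-(c * t)) : ℂ) * ex f t) := by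
    intro t; simp; ring
  simp only [Ki, this]
  rw [intervalIntegral.integral_const_mul]; ring

theorem repr {Vq Vp F G φ : WA}
    (h1 : ∀ k, ∀ p ∈ Ioo (-1:ℝ) 0, HasDerivAt (ex (Vq.co k)) (Complex.I * k * ex (Vp.co k) p) p)
    (h2 : ∀ k, ∀ p ∈ Ioo (-1:ℝ) 0, HasDerivAt (ex ((G - Vp).co k)) (Complex.I * k * ex ((Vq - F).co k) p) p)
    (h3 : ∀ k, ex (Vq.co k) (-1) = 0) (h4 : ∀ k, ex ((G - Vp).co k) (-1) = 0)
    (h5 : ∀ k, ex (Vq.co k) 0 = ex (φ.co k) 0) : Vq = Tq F G φ ∧ Vp = Tp F G φ := by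
  have hu : Hil Vq - (G - Vp) = Tu (F, G) := by
    ext1 k; refine ext_ex fun p hp => ?_
    rw [Tu_apply, Bm, co_diag, ex_KL _ _ _ _ hp, ← Ki_smul]
    have := Ki_unique (-1) (-kap k) (by simp) (kap k • (Hil F - G).co k) ((Hil Vq - (G - Vp)).co k) 0
      (by simp only [co_sub, co_Hil, ex_sub, ex_csmul, h3, mul_zero, zero_sub, neg_eq_zero]; exact h4 k)
      (fun p hp => by
        have := ((h1 k p hp).const_mul (sg k)).sub (h2 k p hp)
        refine HasDerivAt.congr_deriv this ?_
        simp only [co_sub, co_Hil, ex_sub, ex_csmul, ex_smul, Complex.real_smul]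
        rcases eq_or_ne k 0 with rfl | hk
        · simp
        have e := sg_sq hk
        have e2 := kap_sg k
        rw [← e2]; push_cast
        linear_combination (kap k : ℂ) * ex (Vp.co k) p * e) p hp
    simpa using this
  have hq : Vq = Tq F G φ := by
    ext1 k; refine ext_ex fun p hp => ?_
    have := Ki_unique 0 (kap k) (by simp) (sg k • (kap k • (Tu (F,G) + G).co k)) (Vq.co k) _ (h5 k)
      (fun p hp => by
        refine HasDerivAt.congr_deriv (h1 k p hp) ?_
        rw [← hu]
        simp only [co_sub, co_add, co_Hil, ex_sub, ex_add, ex_csmul, ex_smul, Complex.real_smul]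
        rcases eq_or_ne k 0 with rfl | hk
        · simp
        have e := sg_sq hk
        have e2 := kap_sg k
        rw [← e2]
        linear_combination (-(kap k : ℂ)) * ex (Vq.co k) p * e) p hp
    rw [this, Tq, co_add (Pois φ), ex_add, co_Hil, ex_csmul, Bp, co_diag, ex_KL _ _ _ _ hp, Ki_csmul, Ki_smul, Pois, co_diag,
      ex_of_mem (poisL _ _) hp]
    simp [poisL]
  refine ⟨hq, ?_⟩
  rw [Tp, ← hu, ← hq]; abel

end WA
end partW2

section partW3
set_option linter.unusedSectionVars false
open scoped ContDiff Topology

section ift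
variable {E X : Type*} [NormedAddCommGroup E] [NormedSpace ℝ E] [CompleteSpace E]
  [NormedAddCommGroup X] [NormedSpace ℝ X] [CompleteSpace X]

theorem ift_fix (Ψ : (ℝ × E) × X → X) (hΨ : ContDiffAt ℝ ω Ψ 0) (h0 : Ψ 0 = 0)
    (hd : ∀ v : X, HasDerivAt (fun t : ℝ => Ψ (0, t • v)) 0 0) :
    ∃ r > 0, ∀ e : E, ‖e‖ < r → ∀ V : ℝ → X,
      (∀ᶠ l in 𝓝 (0:ℝ), ‖V l‖ < r ∧ V l = Ψ ((l, e), V l)) → AnalyticAt ℝ V 0 := by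
  set f : (ℝ × E) × X → X := fun z => z.2 - Ψ z with hf
  have cf : ContDiffAt ℝ ω f 0 := contDiffAt_snd.sub hΨ
  have hinv : fderiv ℝ f 0 ∘L .inr ℝ (ℝ × E) X = ContinuousLinearMap.id ℝ X := by
    ext v
    have h1 : HasFDerivAt f (fderiv ℝ f 0) ((0 : ℝ × E), (0:ℝ) • v) := by
      rw [zero_smul]; exact (cf.differentiableAt (by simp)).hasFDerivAt
    have h2 : HasDerivAt (fun t : ℝ => ((0 : ℝ × E), t • v)) ((0 : ℝ × E), v) 0 := by
      have := (hasDerivAt_id (0:ℝ)).smul_const v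
      simp only [one_smul] at this
      exact (hasDerivAt_const _ _).prodMk this
    have h3 := HasFDerivAt.comp_hasDerivAt (0:ℝ) h1 h2
    have h4 : HasDerivAt (fun t : ℝ => t • v - Ψ (0, t • v)) (v - 0) 0 := by
      have := (hasDerivAt_id (0:ℝ)).smul_const v
      simp only [one_smul] at this
      exact this.sub (hd v)
    have := h3.unique h4
    simpa using this
  have if2 : (fderiv ℝ f 0 ∘L .inr ℝ (ℝ × E) X).IsInvertible := by
    rw [hinv]; exact ⟨ContinuousLinearEquiv.refl ℝ X, rfl⟩
  have hn : (ω : WithTop ℕ∞) ≠ 0 := by simp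
  have e1 := cf.eventually_apply_eq_iff_implicitFunction hn if2
  have e2 : ∀ᶠ x in 𝓝 (0 : ℝ × E), AnalyticAt ℝ (cf.implicitFunction hn if2) x := by
    have := (cf.contDiffAt_implicitFunction hn if2)
    exact (ContDiffAt.analyticAt this).eventually_analyticAt
  obtain ⟨r1, hr1, b1⟩ := Metric.eventually_nhds_iff_ball.1 e1
  obtain ⟨r2, hr2, b2⟩ := Metric.eventually_nhds_iff_ball.1 e2
  refine ⟨min r1 r2, lt_min hr1 hr2, fun e he V hV => ?_⟩
  have hA : AnalyticAt ℝ (fun l : ℝ => cf.implicitFunction hn if2 (l, e)) 0 := by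
    have h := b2 ((0:ℝ), e) (by simp only [mem_ball_zero_iff, Prod.norm_def, max_lt_iff]; exact ⟨by simpa using hr2, he.trans_le (min_le_right _ _)⟩)
    exact AnalyticAt.comp (g := cf.implicitFunction hn if2) (f := fun l : ℝ => (l, e)) h
      (by fun_prop)
  refine hA.congr ?_
  filter_upwards [hV, Metric.ball_mem_nhds (0:ℝ) (lt_min hr1 hr2)] with l hVl hl
  rw [Metric.mem_ball, Real.dist_eq, sub_zero] at hl
  obtain ⟨hV1, hV2⟩ := hVl
  refine (b1 ((l, e), V l) ?_).1 ?_
  · simp only [mem_ball_zero_iff, Prod.norm_def, max_lt_iff, Real.norm_eq_abs]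
    exact ⟨⟨hl.trans_le (min_le_left _ _), he.trans_le (min_le_left _ _)⟩, hV1.trans_le (min_le_left _ _)⟩
  · simp only [hf, h0, Prod.snd_zero, sub_zero]
    exact sub_eq_zero.2 hV2
end ift

section alg
variable {A : Type*} [NormedCommRing A] [NormedAlgebra ℝ A] [CompleteSpace A]

theorem exists_sq (m : A) (hm : IsUnit m) : ∃ sq : A → A, ContDiffAt ℝ ω sq (m * m) ∧ sq (m * m) = m ∧
    ∀ᶠ X in 𝓝 (m * m), sq X * sq X = X := by
  obtain ⟨u, rfl⟩ := hm
  let f : A → A := fun x => x * x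
  have cf : ContDiffAt ℝ ω f u := contDiffAt_id.mul contDiffAt_id
  let L : A →L[ℝ] A := ContinuousLinearMap.mul ℝ A ((2:A) * u)
  let v : A := (algebraMap ℝ A (1/2)) * ↑u⁻¹
  have hv : 2 * (u : A) * v = 1 := by
    have h1 : (2 : A) * algebraMap ℝ A (1/2) = 1 := by
      have : (2 : A) = algebraMap ℝ A 2 := (map_ofNat (algebraMap ℝ A) 2).symm
      rw [this, ← map_mul]; norm_num
    have h2 : (u : A) * ↑u⁻¹ = 1 := u.mul_inv
    simp only [v]
    linear_combination (u : A) * ↑u⁻¹ * h1 + h2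
  let e : A ≃L[ℝ] A := ContinuousLinearEquiv.equivOfInverse L (ContinuousLinearMap.mul ℝ A v)
    (fun x => by simp only [L, ContinuousLinearMap.mul_apply']; linear_combination x * hv)
    (fun x => by simp only [L, ContinuousLinearMap.mul_apply']; linear_combination x * hv)
  have hf' : HasFDerivAt f (e : A →L[ℝ] A) u := by
    have := (hasFDerivAt_id (𝕜 := ℝ) (u : A)).mul (hasFDerivAt_id (𝕜 := ℝ) (u : A))
    refine this.congr_fderiv ?_
    ext x
    simp [e, L]; ring
  have hn : (ω : WithTop ℕ∞) ≠ 0 := by simp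
  refine ⟨cf.localInverse hf' hn, cf.to_localInverse hf' hn, cf.localInverse_apply_image hf' hn, ?_⟩
  exact (cf.hasStrictFDerivAt' hf' hn).eventually_right_inverse

variable (sq : A → A)
def gD (xq xp yq yp : A) : A := xq * yp - xp * yq
def gF (xq xp yq yp : A) : A := (xq * xp + yq * yp) * Ring.inverse (gD xq xp yq yp)
def gG (xq xp yq yp : A) : A := (xq * xq + yq * yq) * Ring.inverse (gD xq xp yq yp)
def gH (xq xp yq yp : A) : A :=
  (xq * xq + yq * yq) * Ring.inverse (gD xq xp yq yp) * Ring.inverse (gD xq xp yq yp)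
def gS (xq yq : A) : A := yq * Ring.inverse (sq (xq * xq + yq * yq))

/-- parameters: 0 e_q, 1 e_p, 2 c, 3 r2, 4 κ1, 5 c', 6 r' -/
structure PsiData (A : Type*) [NormedCommRing A] [NormedAlgebra ℝ A] where
  (a m ξq ξp : A) (P N J : A →L[ℝ] A) (T : A × A × A →L[ℝ] A × A)

abbrev PZ (A : Type*) := (ℝ × (Fin 7 → A)) × (A × A)
variable (d : PsiData A)
namespace PsiData
def xq (z : PZ A) : A := 1 + z.1.1 • d.ξq
def xp (z : PZ A) : A := - d.a + z.1.1 • d.ξp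
def yq (z : PZ A) : A := d.a + z.1.2 0 + z.2.1
def yp (z : PZ A) : A := 1 + z.1.2 1 + z.2.2
def Fh (z : PZ A) : A := z.2.1 + d.a * z.2.2 - (1 + d.a * d.a) *
  (gF (d.xq z) (d.xp z) (d.yq z) (yp z) - gF 1 (-d.a) (d.a + z.1.2 0) (1 + z.1.2 1))
def Gh (z : PZ A) : A := z.2.2 - d.a * z.2.1 + (1 + d.a * d.a) *
  (gG (d.xq z) (d.xp z) (d.yq z) (yp z) - gG 1 (-d.a) (d.a + z.1.2 0) (1 + z.1.2 1))
  + d.P ((1 + d.a * d.a) * (gD (d.xq z) (d.xp z) (d.yq z) (yp z) * (z.1.2 2 + z.1.2 3 * d.P z.2.2)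
    - gD 1 (-d.a) (d.a + z.1.2 0) (1 + z.1.2 1) * z.1.2 2))
def NB (z : PZ A) : A := z.2.1 - d.m * d.m * d.m * (gS sq (d.xq z) (d.yq z) - gS sq 1 (d.a + z.1.2 0))
def NC (z : PZ A) : A := d.m * d.m * d.m *
  (d.xq z * (z.1.2 4 * gH (d.xq z) (d.xp z) (d.yq z) (yp z) + z.1.2 5 + z.1.2 6 * d.P z.2.2)
    - (z.1.2 4 * gH 1 (-d.a) (d.a + z.1.2 0) (1 + z.1.2 1) + z.1.2 5))
def Psi (z : PZ A) : A × A := d.T (d.Fh z, d.Gh z, d.N (d.NB sq z) + d.J (d.NC z))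

theorem Psi_cd (hm : IsUnit d.m) (hma : d.m * d.m = 1 + d.a * d.a)
    (hs1 : ContDiffAt ℝ ω sq (d.m * d.m)) (hs2 : sq (d.m * d.m) = d.m) : ContDiffAt ℝ ω (d.Psi sq) 0 := by
  obtain ⟨u, hu⟩ := hm
  have hw : ∀ {f : PZ A → A}, ContDiffAt ℝ ω f 0 → f 0 = d.m * d.m →
      ContDiffAt ℝ ω (fun z => Ring.inverse (f z)) 0 := by
    intro f hf h0
    refine ContDiffAt.comp (g := Ring.inverse) (0 : PZ A) ?_ hf
    rw [h0, ← hu, ← Units.val_mul]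
    exact contDiffAt_ringInverse ℝ (u * u)
  have hw2 : ∀ {f : PZ A → A}, ContDiffAt ℝ ω f 0 → f 0 = d.m * d.m →
      ContDiffAt ℝ ω (fun z => Ring.inverse (sq (f z))) 0 := by
    intro f hf h0
    have h1 : ContDiffAt ℝ ω (fun z => sq (f z)) 0 := by
      refine ContDiffAt.comp (g := sq) (0 : PZ A) ?_ hf
      rw [h0]; exact hs1
    refine ContDiffAt.comp (g := Ring.inverse) (0 : PZ A) ?_ h1
    rw [h0, hs2, ← hu]
    exact contDiffAt_ringInverse ℝ u
  have c1 : ContDiffAt ℝ ω d.xq (0 : PZ A) := by unfold xq; fun_prop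
  have c2 : ContDiffAt ℝ ω d.xp (0 : PZ A) := by unfold xp; fun_prop
  have c3 : ContDiffAt ℝ ω d.yq (0 : PZ A) := by unfold yq; fun_prop
  have c4 : ContDiffAt ℝ ω yp (0 : PZ A) := by unfold yp; fun_prop
  have e1 : d.xq (0 : PZ A) = 1 := by simp [xq]
  have e2 : d.xp (0 : PZ A) = -d.a := by simp [xp]
  have e3 : d.yq (0 : PZ A) = d.a := by simp [yq]
  have e4 : yp (0 : PZ A) = 1 := by simp [yp]
  have D1 : ContDiffAt ℝ ω (fun z => Ring.inverse (gD (d.xq z) (d.xp z) (d.yq z) (yp z))) (0 : PZ A) := by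
    apply hw
    · unfold gD; fun_prop
    · simp only [e1, e2, e3, e4, gD, hma]; ring
  have D2 : ContDiffAt ℝ ω (fun z : PZ A => Ring.inverse (gD 1 (-d.a) (d.a + z.1.2 0) (1 + z.1.2 1))) (0 : PZ A) := by
    apply hw
    · unfold gD; fun_prop
    · simp [gD, hma]
  have S1 : ContDiffAt ℝ ω (fun z => Ring.inverse (sq (d.xq z * d.xq z + d.yq z * d.yq z))) (0 : PZ A) := by
    apply hw2
    · fun_prop
    · simp only [e1, e3, hma]; ring
  have S2 : ContDiffAt ℝ ω (fun z : PZ A => Ring.inverse (sq (1 * 1 + (d.a + z.1.2 0) * (d.a + z.1.2 0)))) (0 : PZ A) := by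
    apply hw2
    · fun_prop
    · simp [hma]
  have G1 : ContDiffAt ℝ ω (fun z => gD (d.xq z) (d.xp z) (d.yq z) (yp z)) (0 : PZ A) := by
    unfold gD; fun_prop
  have G2 : ContDiffAt ℝ ω (fun z : PZ A => gD 1 (-d.a) (d.a + z.1.2 0) (1 + z.1.2 1)) (0 : PZ A) := by
    unfold gD; fun_prop
  have F : ContDiffAt ℝ ω d.Fh (0 : PZ A) := by unfold Fh gF; fun_prop
  have G : ContDiffAt ℝ ω d.Gh (0 : PZ A) := by unfold Gh gG; fun_prop
  have B : ContDiffAt ℝ ω (d.NB sq) (0 : PZ A) := by unfold NB gS; fun_prop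
  have C : ContDiffAt ℝ ω d.NC (0 : PZ A) := by unfold NC gH; fun_prop
  unfold Psi; fun_prop

theorem Psi_zero : d.Psi sq 0 = 0 := by
  have e1 : d.xq (0 : PZ A) = 1 := by simp [xq]
  have e2 : d.xp (0 : PZ A) = -d.a := by simp [xp]
  have e3 : d.yq (0 : PZ A) = d.a := by simp [yq]
  have e4 : yp (0 : PZ A) = 1 := by simp [yp]
  have F : d.Fh (0 : PZ A) = 0 := by simp [Fh, e1, e2, e3, e4]
  have G : d.Gh (0 : PZ A) = 0 := by simp [Gh, e1, e2, e3, e4]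
  have B : d.NB sq (0 : PZ A) = 0 := by simp [NB, e1, e3]
  have C : d.NC (0 : PZ A) = 0 := by simp [NC, e1, e2, e3, e4]
  rw [Psi, F, G, B, C, map_zero, map_zero, add_zero]
  exact map_zero d.T

theorem Psi_deriv (hm : IsUnit d.m) (hma : d.m * d.m = 1 + d.a * d.a)
    (hs1 : ContDiffAt ℝ ω sq (d.m * d.m)) (hs2 : sq (d.m * d.m) = d.m)
    (hs3 : ∀ᶠ X in 𝓝 (d.m * d.m), sq X * sq X = X) (v : A × A) : HasDerivAt (fun t : ℝ => d.Psi sq (0, t • v)) 0 0 := by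
  obtain ⟨u, hu⟩ := hm
  set w : A := ↑u⁻¹ with hwd
  have hw : d.m * w = 1 := by rw [← hu]; exact u.mul_inv
  have e1 : ∀ t : ℝ, d.xq ((0, t • v) : PZ A) = 1 := by simp [xq]
  have e2 : ∀ t : ℝ, d.xp ((0, t • v) : PZ A) = -d.a := by simp [xp]
  have e3 : ∀ t : ℝ, d.yq ((0, t • v) : PZ A) = d.a + t • v.1 := by simp [yq]
  have e4 : ∀ t : ℝ, yp ((0, t • v) : PZ A) = 1 + t • v.2 := by simp [yp]
  have l1 : HasDerivAt (fun t : ℝ => t • v.1) v.1 0 := by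
    simpa using (hasDerivAt_id (0:ℝ)).smul_const v.1
  have l2 : HasDerivAt (fun t : ℝ => t • v.2) v.2 0 := by
    simpa using (hasDerivAt_id (0:ℝ)).smul_const v.2
  have hI : ∀ (f : ℝ → A) (f' : A) (n : Aˣ), HasDerivAt f f' 0 → f 0 = n →
      HasDerivAt (fun t => Ring.inverse (f t)) (-(↑n⁻¹ * f' * ↑n⁻¹)) 0 := by
    intro f f' n hf h0
    have h1 : HasFDerivAt Ring.inverse (-ContinuousLinearMap.mulLeftRight ℝ A ↑n⁻¹ ↑n⁻¹) (f 0) := by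
      rw [h0]; exact hasFDerivAt_ringInverse n
    have := h1.comp_hasDerivAt (0:ℝ) hf
    refine HasDerivAt.congr_deriv this ?_
    simp
  have y1 : HasDerivAt (fun t : ℝ => d.a + t • v.1) v.1 0 := l1.const_add _
  have y2 : HasDerivAt (fun t : ℝ => 1 + t • v.2) v.2 0 := l2.const_add _
  have dD : HasDerivAt (fun t : ℝ => gD 1 (-d.a) (d.a + t • v.1) (1 + t • v.2)) (v.2 + d.a * v.1) 0 := by
    refine ((y2.const_mul 1).sub (y1.const_mul (-d.a))).congr_deriv (by ring)
  have huu : ((u * u)⁻¹ : Aˣ) = (w * w : A) := by simp [hwd]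
  have dI : HasDerivAt (fun t : ℝ => Ring.inverse (gD 1 (-d.a) (d.a + t • v.1) (1 + t • v.2)))
      (-(w * w * (v.2 + d.a * v.1) * (w * w))) 0 := by
    have := hI _ _ (u * u) dD (by simp [gD, hu, hma])
    rwa [huu] at this
  have v0 : Ring.inverse (gD 1 (-d.a) d.a 1) = w * w := by
    have : gD 1 (-d.a) d.a 1 = ↑(u * u) := by simp [gD, hu, hma]
    rw [this, Ring.inverse_unit, huu]
  have hma' := hma
  have dX : HasDerivAt (fun t : ℝ => (1:A) * 1 + (d.a + t • v.1) * (d.a + t • v.1)) (2 * d.a * v.1) 0 := by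
    refine ((y1.mul y1).const_add (1*1)).congr_deriv (by simp; ring)
  have x0 : (1:A) * 1 + (d.a + (0:ℝ) • v.1) * (d.a + (0:ℝ) • v.1) = d.m * d.m := by simp [hma]
  have hdq : HasFDerivAt sq (fderiv ℝ sq (d.m * d.m)) ((1:A) * 1 + (d.a + (0:ℝ) • v.1) * (d.a + (0:ℝ) • v.1)) := by
    rw [x0]; exact (hs1.differentiableAt (by simp)).hasFDerivAt
  have dq := hdq.comp_hasDerivAt (0:ℝ) dX
  set s' := fderiv ℝ sq (d.m * d.m) (2 * d.a * v.1)
  have q0 : sq ((1:A) * 1 + (d.a + (0:ℝ) • v.1) * (d.a + (0:ℝ) • v.1)) = d.m := by rw [x0, hs2]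
  have hs' : 2 * d.m * s' = 2 * d.a * v.1 := by
    have h1 := dq.mul dq
    have hev : ∀ᶠ t in 𝓝 (0:ℝ), sq ((1:A) * 1 + (d.a + t • v.1) * (d.a + t • v.1)) *
        sq ((1:A) * 1 + (d.a + t • v.1) * (d.a + t • v.1)) = (1:A) * 1 + (d.a + t • v.1) * (d.a + t • v.1) := by
      have h3 : ∀ᶠ X in 𝓝 ((1:A) * 1 + (d.a + (0:ℝ) • v.1) * (d.a + (0:ℝ) • v.1)), sq X * sq X = X := by
        rw [x0]; exact hs3
      exact dX.continuousAt.eventually h3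
    have h2 := (dX.congr_of_eventuallyEq hev).unique h1
    simp only [Function.comp_apply, q0] at h2
    rw [h2]; ring
  have hs'' : s' = w * d.a * v.1 := by
    have h2 : (2 : A) * algebraMap ℝ A (1/2) = 1 := by
      have : (2 : A) = algebraMap ℝ A 2 := (map_ofNat (algebraMap ℝ A) 2).symm
      rw [this, ← map_mul]; norm_num
    linear_combination algebraMap ℝ A (1/2) * w * hs' - s' * hw + (w * d.a * v.1 - d.m * w * s') * h2
  have dS : HasDerivAt (fun t : ℝ => Ring.inverse (sq ((1:A) * 1 + (d.a + t • v.1) * (d.a + t • v.1))))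
      (-(w * s' * w)) 0 := by
    exact hI _ _ u dq (by rw [hu]; exact q0)
  have S0 : Ring.inverse (sq (1 + d.a * d.a)) = w := by
    rw [← hma, hs2, ← hu, Ring.inverse_unit]
  have F : HasDerivAt (fun t : ℝ => d.Fh ((0, t • v) : PZ A)) 0 0 := by
    simp only [Fh, e1, e2, e3, e4, gF]
    refine ((l1.add (l2.const_mul d.a)).sub
      (((((y1.mul y2).const_add (1 * -d.a)).mul dI).sub_const _).const_mul (1 + d.a * d.a))).congr_deriv ?_
    simp only [Pi.mul_apply, zero_smul, add_zero, mul_one, one_mul, v0]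
    rw [← hma]
    linear_combination (-(v.1 + d.a * v.2)) * (d.m * w + 1) * hw
  have G : HasDerivAt (fun t : ℝ => d.Gh ((0, t • v) : PZ A)) 0 0 := by
    simp only [Gh, e1, e2, e3, e4, gG]
    have h1 := ((l2.sub (l1.const_mul d.a)).add
      (((((y1.mul y1).const_add (1 * 1)).mul dI).sub_const ((1 * 1 + d.a * d.a) * Ring.inverse (gD 1 (-d.a) d.a 1))).const_mul (1 + d.a * d.a)))
    refine (h1.congr_deriv (g' := 0) ?_).congr_of_eventuallyEq (Filter.Eventually.of_forall fun t => ?_)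
    · simp only [Pi.mul_apply, zero_smul, add_zero, mul_one, one_mul, v0]
      rw [← hma]
      linear_combination (2 * d.a * v.1 - (v.2 + d.a * v.1) * (d.m * d.m * w * w + 1)) * (d.m * w + 1) * hw
    · simp
  have B : HasDerivAt (fun t : ℝ => d.NB sq ((0, t • v) : PZ A)) 0 0 := by
    simp only [NB, e1, e3, gS]
    refine (l1.sub (((y1.mul dS).sub_const _).const_mul (d.m * d.m * d.m))).congr_deriv ?_
    simp only [zero_smul, add_zero, mul_one, S0, hs'']
    linear_combination (d.a * d.a * v.1 * (d.m * d.m * w * w + d.m * w + 1) - v.1 * d.m * d.m) * hw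
      - v.1 * hma
  have C : HasDerivAt (fun t : ℝ => d.NC ((0, t • v) : PZ A)) 0 0 := by
    have : (fun t : ℝ => d.NC ((0, t • v) : PZ A)) = fun _ => 0 := by
      funext t; simp [NC, e1]
    rw [this]; exact hasDerivAt_const _ _
  have := d.T.hasFDerivAt.comp_hasDerivAt (0:ℝ) (F.prodMk (G.prodMk
    ((d.N.hasFDerivAt.comp_hasDerivAt (0:ℝ) B).add (d.J.hasFDerivAt.comp_hasDerivAt (0:ℝ) C))))
  refine HasDerivAt.congr_deriv this ?_
  rw [map_zero, map_zero, add_zero]; exact map_zero d.T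

/-- nondegeneracy of the data at `z` -/
def Good (z : PZ A) : Prop :=
  IsUnit (gD (d.xq z) (d.xp z) (d.yq z) (yp z)) ∧ IsUnit (gD 1 (-d.a) (d.a + z.1.2 0) (1 + z.1.2 1)) ∧
  ∀ X : A, X = d.xq z * d.xq z + d.yq z * d.yq z ∨ X = 1 * 1 + (d.a + z.1.2 0) * (d.a + z.1.2 0) →
    IsUnit (sq X) ∧ sq X * sq X = X ∧ ‖sq X - d.m‖ < 1

theorem Good_ev (hm : IsUnit d.m) (hma : d.m * d.m = 1 + d.a * d.a)
    (hs1 : ContDiffAt ℝ ω sq (d.m * d.m)) (hs2 : sq (d.m * d.m) = d.m)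
    (hs3 : ∀ᶠ X in 𝓝 (d.m * d.m), sq X * sq X = X) : ∀ᶠ z in 𝓝 (0 : PZ A), d.Good sq z := by
  have hU : ∀ f : PZ A → A, Continuous f → f 0 = d.m * d.m → ∀ᶠ z in 𝓝 (0 : PZ A), IsUnit (f z) := by
    intro f hf h0
    have : {x : A | IsUnit x} ∈ 𝓝 (f 0) := by
      refine Units.isOpen.mem_nhds ?_
      rw [h0]; exact hm.mul hm
    exact hf.continuousAt.eventually this
  have hV : ∀ f : PZ A → A, Continuous f → f 0 = d.m * d.m → ∀ᶠ z in 𝓝 (0 : PZ A),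
      IsUnit (sq (f z)) ∧ sq (f z) * sq (f z) = f z ∧ ‖sq (f z) - d.m‖ < 1 := by
    intro f hf h0
    have h1 : ∀ᶠ X in 𝓝 (d.m * d.m), IsUnit (sq X) := by
      have : {x : A | IsUnit x} ∈ 𝓝 (sq (d.m * d.m)) := by
        refine Units.isOpen.mem_nhds ?_
        rw [hs2]; exact hm
      exact hs1.continuousAt.eventually this
    have h2 : ∀ᶠ X in 𝓝 (d.m * d.m), ‖sq X - d.m‖ < 1 := by
      have : Metric.ball d.m 1 ∈ 𝓝 (sq (d.m * d.m)) := by rw [hs2]; exact Metric.ball_mem_nhds _ one_pos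
      filter_upwards [hs1.continuousAt.eventually this] with X hX
      simpa [dist_eq_norm] using hX
    have h3 := h1.and (hs3.and h2)
    rw [← h0] at h3
    exact hf.continuousAt.eventually h3
  have c1 : Continuous d.xq := by unfold xq; fun_prop
  have c2 : Continuous d.xp := by unfold xp; fun_prop
  have c3 : Continuous d.yq := by unfold yq; fun_prop
  have c4 : Continuous (yp : PZ A → A) := by unfold yp; fun_prop
  filter_upwards [hU (fun z => gD (d.xq z) (d.xp z) (d.yq z) (yp z)) (by unfold gD; fun_prop)
      (by simp [gD, xq, xp, yq, yp, hma]),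
    hU (fun z => gD 1 (-d.a) (d.a + z.1.2 0) (1 + z.1.2 1)) (by unfold gD; fun_prop) (by simp [gD, hma]),
    hV (fun z => d.xq z * d.xq z + d.yq z * d.yq z) (by fun_prop) (by simp [xq, yq, hma]),
    hV (fun z => 1 * 1 + (d.a + z.1.2 0) * (d.a + z.1.2 0)) (by fun_prop) (by simp [hma])] with z h1 h2 h3 h4
  refine ⟨h1, h2, ?_⟩
  rintro X (rfl | rfl)
  exacts [h3, h4]

theorem Psi_ift (hm : IsUnit d.m) (hma : d.m * d.m = 1 + d.a * d.a)
    (hs1 : ContDiffAt ℝ ω sq (d.m * d.m)) (hs2 : sq (d.m * d.m) = d.m)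
    (hs3 : ∀ᶠ X in 𝓝 (d.m * d.m), sq X * sq X = X) : ∃ r > 0, ∀ e : Fin 7 → A, ‖e‖ < r → ∀ V : ℝ → A × A,
      (∀ᶠ l in 𝓝 (0:ℝ), ‖V l‖ < r ∧ (d.Good sq ((l, e), V l) → V l = d.Psi sq ((l, e), V l))) → AnalyticAt ℝ V 0 := by
  obtain ⟨r1, hr1, h1⟩ := ift_fix _ (d.Psi_cd sq hm hma hs1 hs2) (d.Psi_zero sq) (d.Psi_deriv sq hm hma hs1 hs2 hs3)
  obtain ⟨r2, hr2, h2⟩ := Metric.eventually_nhds_iff_ball.1 (d.Good_ev sq hm hma hs1 hs2 hs3)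
  refine ⟨min r1 r2, lt_min hr1 hr2, fun e he V hV => h1 e (he.trans_le (min_le_left _ _)) V ?_⟩
  filter_upwards [hV, Metric.ball_mem_nhds (0:ℝ) hr2] with l hl hl2
  refine ⟨hl.1.trans_le (min_le_left _ _), hl.2 (h2 _ ?_)⟩
  simp only [mem_ball_zero_iff, Prod.norm_def, max_lt_iff, Real.norm_eq_abs] at hl2 ⊢
  have h3 := hl.1.trans_le (min_le_right r1 r2)
  simp only [Prod.norm_def, max_lt_iff] at h3
  exact ⟨⟨hl2, he.trans_le (min_le_right _ _)⟩, h3⟩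
end PsiData
end alg
end partW3

section partW4
namespace WA
open MeasureTheory Real

theorem ek_deriv (k : ℤ) (q : ℝ) : HasDerivAt (ek k) (Complex.I * k * ek k q) q := by
  have h1 : HasDerivAt (fun q : ℝ => (k * q * Complex.I : ℂ)) (k * 1 * Complex.I) q :=
    ((Complex.ofRealCLM.hasDerivAt (x := q)).const_mul (k : ℂ)).mul_const _
  refine (h1.cexp).congr_deriv ?_
  simp only [ek]; ring

theorem coef_bd {μ : ℝ} (hμ : μ ∈ Ioo (0:ℝ) 1) {f f' : ℝ → ℝ} {K : ℝ} (hK : 0 ≤ K)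
    (hs : ∀ q, 2 ≤ |q| → f q = 0)
    (hd : ∀ q, HasDerivAt f (f' q) q) (h1 : ∀ q q', |f' q - f' q'| ≤ K * |q - q'| ^ μ) (k : ℤ) (hk : k ≠ 0) :
    ‖∫ q, ek (-k) q * (f q : ℂ)‖ ≤ 40 * K * |(k:ℝ)| ^ (-(1 + μ)) := by
  have hcf' : Continuous f' := by
    rw [Metric.continuous_iff]
    intro b ε hε
    have : Filter.Tendsto (fun x : ℝ => K * |x - b| ^ μ) (nhds b) (nhds 0) := by
      have : ContinuousAt (fun x : ℝ => K * |x - b| ^ μ) b := by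
        refine ContinuousAt.mul continuousAt_const ?_
        refine ContinuousAt.rpow_const (by fun_prop) (Or.inr hμ.1.le)
      simpa [ContinuousAt, Real.zero_rpow hμ.1.ne'] using this
    obtain ⟨δ, hδ, h⟩ := Metric.tendsto_nhds_nhds.1 this ε hε
    refine ⟨δ, hδ, fun a ha => ?_⟩
    rw [Real.dist_eq]
    have := h ha
    rw [Real.dist_eq, sub_zero] at this
    exact (h1 a b).trans_lt ((le_abs_self _).trans_lt this)
  have hcf : Continuous f := continuous_iff_continuousAt.2 fun q => (hd q).continuousAt
  have hs' : ∀ q, 2 < |q| → f' q = 0 := by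
    intro q hq
    have hev : f =ᶠ[nhds q] fun _ => 0 := by
      filter_upwards [(continuous_abs.isOpen_preimage _ isOpen_Ioi).mem_nhds (show q ∈ abs ⁻¹' Ioi 2 from hq)] with x hx
      exact hs x (le_of_lt hx)
    exact (hd q).unique ((hasDerivAt_const q (0:ℝ)).congr_of_eventuallyEq hev)
  have hcs : HasCompactSupport f := HasCompactSupport.intro (isCompact_Icc (a := -2) (b := 2)) (fun x hx => by
    apply hs; by_contra h; push Not at h; exact hx ⟨by linarith [(abs_lt.1 h).1], (abs_lt.1 h).2.le⟩)
  have hcs' : HasCompactSupport f' := HasCompactSupport.intro (isCompact_Icc (a := -2) (b := 2)) (fun x hx => by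
    apply hs'; by_contra h; push Not at h; exact hx (abs_le.1 h))
  have int1 : ∀ (g : ℝ → ℂ) (u : ℝ → ℝ), Continuous g → Continuous u → HasCompactSupport u →
      Integrable (fun q => g q * (u q : ℂ)) := by
    intro g u hg hu hcu
    refine Continuous.integrable_of_hasCompactSupport (by fun_prop) ?_
    refine HasCompactSupport.mul_left ?_
    exact hcu.comp_left (g := fun x : ℝ => (x:ℂ)) (by simp)
  have hkc : (k : ℂ) ≠ 0 := by exact_mod_cast hk
  have ibp : ∫ q, ek (-k) q * (f' q : ℂ) = - ∫ q, (Complex.I * (-k : ℤ) * ek (-k) q) * (f q : ℂ) := by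
    apply integral_mul_deriv_eq_deriv_mul_of_integrable (fun q _ => ek_deriv (-k) q) (fun q _ => (hd q).ofReal_comp)
    · exact int1 _ _ (by fun_prop) hcf' hcs'
    · exact int1 _ _ (by fun_prop) hcf hcs
    · exact int1 _ _ (by fun_prop) hcf hcs
  have ibp2 : ∫ q, ek (-k) q * (f' q : ℂ) = Complex.I * k * ∫ q, ek (-k) q * (f q : ℂ) := by
    rw [ibp, ← integral_const_mul, ← integral_neg]
    congr 1; funext q; push_cast; ring
  set h : ℝ := π / k with hh
  have shift : ∫ q, ek (-k) q * (f' q : ℂ) = - ∫ q, ek (-k) q * (f' (q + h) : ℂ) := by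
    rw [← integral_add_right_eq_self (fun q => ek (-k) q * (f' q : ℂ)) h, ← integral_neg]
    congr 1; funext q
    have : ek (-k) (q + h) = - ek (-k) q := by
      have e : ((-k : ℤ) * ((q + h : ℝ) : ℂ) * Complex.I) = ((-k : ℤ) * (q : ℂ) * Complex.I) + -(π * Complex.I) := by
        rw [hh]; push_cast; field_simp; ring
      rw [ek, e, Complex.exp_add, Complex.exp_neg, Complex.exp_pi_mul_I, ek]; norm_num
    rw [this]; ring
  have hcs2 : HasCompactSupport (fun q => f' (q + h)) := hcs'.comp_homeomorph (Homeomorph.addRight h)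
  have two : 2 * ∫ q, ek (-k) q * (f' q : ℂ) = ∫ q, ek (-k) q * ((f' q - f' (q + h) : ℝ) : ℂ) := by
    have : ∀ q, ek (-k) q * ((f' q - f' (q + h) : ℝ) : ℂ) = ek (-k) q * (f' q : ℂ) - ek (-k) q * (f' (q + h) : ℂ) := by
      intro q; push_cast; ring
    simp_rw [this]
    rw [integral_sub (int1 _ _ (by fun_prop) hcf' hcs') (int1 _ _ (by fun_prop) (by fun_prop) hcs2)]
    linear_combination shift
  have hk1 : (1:ℝ) ≤ |(k:ℝ)| := by exact_mod_cast Int.one_le_abs hk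
  have hk0 : (0:ℝ) < |(k:ℝ)| := by linarith
  have hhabs : |h| = π / |(k:ℝ)| := by rw [hh, abs_div, abs_of_pos pi_pos]
  have hh4 : |h| ≤ 4 := by
    rw [hhabs, div_le_iff₀ hk0]; nlinarith [pi_lt_four]
  have hhm : |h| ^ μ ≤ 4 * |(k:ℝ)| ^ (-μ) := by
    rw [hhabs, div_rpow pi_pos.le hk0.le, rpow_neg hk0.le, div_eq_mul_inv]
    gcongr
    calc π ^ μ ≤ 4 ^ μ := by gcongr; exacts [hμ.1.le, pi_lt_four.le]
      _ ≤ 4 ^ (1:ℝ) := rpow_le_rpow_of_exponent_le (by norm_num) hμ.2.le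
      _ = 4 := by norm_num
  have bd : ‖∫ q, ek (-k) q * ((f' q - f' (q + h) : ℝ) : ℂ)‖ ≤ K * |h| ^ μ * 12 := by
    have e : ∫ q, ek (-k) q * ((f' q - f' (q + h) : ℝ) : ℂ) = ∫ q in (-6)..6, ek (-k) q * ((f' q - f' (q + h) : ℝ) : ℂ) := by
      refine (intervalIntegral.integral_eq_integral_of_support_subset ?_).symm
      intro q hq
      by_contra hn
      apply hq
      have : 6 ≤ |q| := by
        by_contra hlt; push Not at hlt; exact hn ⟨(abs_lt.1 hlt).1, (abs_lt.1 hlt).2.le⟩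
      simp only []
      have h3 : 6 - 4 ≤ |q + h| := by
        have := abs_sub_abs_le_abs_sub q (-h); rw [abs_neg, sub_neg_eq_add] at this; linarith
      rcases h3.eq_or_lt with h4 | h4
      · have : f' (q + h) = 0 := by
          have hcl : IsClosed {x | f' x = 0} := isClosed_eq hcf' continuous_const
          have hmem : q + h ∈ closure {x : ℝ | 2 < |x|} := by
            rw [Metric.mem_closure_iff]
            intro ε hε
            rcases le_or_gt 0 (q + h) with hp | hp
            · rw [abs_of_nonneg hp] at h4
              refine ⟨q + h + ε/2, ?_, ?_⟩
              · simp only [mem_setOf_eq]; rw [abs_of_nonneg (by linarith)]; linarith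
              · rw [Real.dist_eq]; ring_nf; rw [abs_of_neg (by linarith)]; linarith
            · rw [abs_of_neg hp] at h4
              refine ⟨q + h - ε/2, ?_, ?_⟩
              · simp only [mem_setOf_eq]; rw [abs_of_neg (by linarith)]; linarith
              · rw [Real.dist_eq]; ring_nf; rw [abs_of_pos (by linarith)]; linarith
          exact (hcl.closure_subset_iff.2 (fun x hx => hs' x hx)) hmem
        rw [this, hs' q (by linarith)]; simp
      · rw [hs' q (by linarith), hs' (q + h) (by linarith)]; simp
    rw [e]
    have := intervalIntegral.norm_integral_le_of_norm_le_const (a := (-6:ℝ)) (b := 6) (C := K * |h| ^ μ)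
      (f := fun q => ek (-k) q * ((f' q - f' (q + h) : ℝ) : ℂ)) (fun q _ => by
        rw [norm_mul, norm_ek, one_mul, Complex.norm_real, Real.norm_eq_abs]
        refine (h1 q (q + h)).trans (le_of_eq ?_)
        rw [show q - (q + h) = -h by ring, abs_neg])
    refine this.trans (le_of_eq ?_)
    norm_num
  rw [← two, ibp2] at bd
  simp only [norm_mul, Complex.norm_ofNat, Complex.norm_I, one_mul, Complex.norm_intCast] at bd
  have hr : |(k:ℝ)| ^ (-(1 + μ)) = |(k:ℝ)| ^ (-μ) / |(k:ℝ)| := by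
    rw [show -(1 + μ) = -μ - 1 by ring, rpow_sub_one hk0.ne']
  rw [hr, ← mul_div_assoc, le_div_iff₀ hk0]
  have : K * |h| ^ μ ≤ K * (4 * |(k:ℝ)| ^ (-μ)) := by gcongr
  have hp : 0 ≤ K * |(k:ℝ)| ^ (-μ) := by positivity
  nlinarith
end WA
end partW4

section partW4b
namespace WA
open MeasureTheory Real

/-- the function on `(-π,π) × [-1,0]` represented by `a`. -/
def va (a : WA) (q p : ℝ) : ℂ := ex (ev q a) p

theorem va_cont (a : WA) (p : ℝ) : Continuous (fun q => va a q p) := cont_ev a _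
theorem va_cont2 (a : WA) (q : ℝ) : Continuous (fun p => va a q p) := cont_ex _
theorem norm_va_le (a : WA) (q p : ℝ) : ‖va a q p‖ ≤ ‖a‖ := (norm_ex_le _ _).trans (norm_ev_le _ _)
@[simp] theorem va_add (a b q p) : va (a + b) q p = va a q p + va b q p := by simp [va]
@[simp] theorem va_sub (a b q p) : va (a - b) q p = va a q p - va b q p := by simp [va]
@[simp] theorem va_neg (a q p) : va (-a) q p = - va a q p := by simp [va]; rfl
@[simp] theorem va_zero (q p) : va 0 q p = 0 := by simp [va]; rfl
@[simp] theorem va_mul (a b q p) : va (a * b) q p = va a q p * va b q p := by simp [va]; rfl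
@[simp] theorem va_one (q p) : va 1 q p = 1 := by simp [va]; rfl
@[simp] theorem va_smul (c : ℝ) (a q p) : va (c • a) q p = c * va a q p := by simp [va]
theorem va_inverse {a : WA} (h : IsUnit a) (q p) : va (Ring.inverse a) q p = (va a q p)⁻¹ := ev_inverse q h _

theorem int_va (a : WA) (k : ℤ) (p) :
    ∫ q in (-π)..π, ek (-k) q * va a q p = 2 * π * ex (a.co k) p := int_ev a k _

theorem va_inj {a b : WA} (h : ∀ p ∈ Ioo (-1:ℝ) 0, ∀ q ∈ Ioo (-π) π, va a q p = va b q p) : a = b := by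
  have h1 : ∀ k, ∀ p ∈ Ioo (-1:ℝ) 0, ex (a.co k) p = ex (b.co k) p := by
    intro k p hp
    have h1 := int_va a k p
    have h2 := int_va b k p
    have : ∫ q in (-π)..π, ek (-k) q * va a q p = ∫ q in (-π)..π, ek (-k) q * va b q p := by
      refine intervalIntegral.integral_congr_Ioo_of_le (by linarith [pi_pos]) fun q hq => ?_
      simp only [h p hp q hq]
    rw [h1, h2] at this
    have h3 : (2 * Real.pi : ℂ) ≠ 0 := by simp [Real.pi_ne_zero]
    exact mul_left_cancel₀ h3 this
  apply ext'
  intro k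
  ext p
  have : Icc (-1:ℝ) 0 ⊆ {p | ex (a.co k) p = ex (b.co k) p} := by
    rw [← closure_Ioo (by norm_num)]
    exact closure_minimal (h1 k) (isClosed_eq (cont_ex _) (cont_ex _))
  simpa [ex_coe] using this p.2

def cW (μ : ℝ) : ℝ := 1 + ∑' k : ℤ, 40 * |(k:ℝ)| ^ (-(1 + μ))

theorem lemW {μ : ℝ} (hμ : μ ∈ Ioo (0:ℝ) 1) {f fq : ℝ → ℝ → ℝ} {K : ℝ} (hK : 0 ≤ K)
    (hc : ContinuousOn (fun z : ℝ × ℝ => f z.1 z.2) (univ ×ˢ Icc (-1) 0))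
    (hs : ∀ p ∈ Icc (-1:ℝ) 0, ∀ q, 2 ≤ |q| → f q p = 0)
    (hb : ∀ p ∈ Icc (-1:ℝ) 0, ∀ q, |f q p| ≤ K)
    (hd : ∀ p ∈ Ioo (-1:ℝ) 0, ∀ q, HasDerivAt (fun q => f q p) (fq q p) q)
    (hh : ∀ p ∈ Ioo (-1:ℝ) 0, ∀ q q', |fq q p - fq q' p| ≤ K * |q - q'| ^ μ) :
    ∃ F : WA, ‖F‖ ≤ cW μ * K ∧ ∀ p ∈ Icc (-1:ℝ) 0, ∀ q ∈ Ioo (-π) π, va F q p = f q p := by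
  have hcc : Continuous (fun z : Icc (-1:ℝ) 0 × ℝ => f z.2 z.1) :=
    hc.comp_continuous (f := fun z : Icc (-1:ℝ) 0 × ℝ => (z.2, (z.1:ℝ))) (by fun_prop) (fun z => ⟨trivial, z.1.2⟩)
  have hpi : (3:ℝ) < π := pi_gt_three
  let c : ℤ → CI := fun k => ⟨fun p => ((1 / (2 * π) : ℝ) : ℂ) * ∫ q in (-π)..π, ek (-k) q * (f q p : ℂ), by
    refine continuous_const.mul ?_
    refine intervalIntegral.continuous_parametric_intervalIntegral_of_continuous' (f := fun (p : Icc (-1:ℝ) 0) q => ek (-k) q * (f q p : ℂ)) ?_ _ _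
    exact ((cont_ek _).comp continuous_snd).mul (Complex.continuous_ofReal.comp hcc)⟩
  have hcapp : ∀ k (p : Icc (-1:ℝ) 0), c k p = ((1 / (2 * π) : ℝ) : ℂ) * ∫ q in (-π)..π, ek (-k) q * (f q p : ℂ) := fun k p => rfl
  have h2pi : ‖((1 / (2 * π) : ℝ) : ℂ)‖ = 1 / (2 * π) := by
    rw [Complex.norm_real, Real.norm_eq_abs, abs_of_pos (by positivity)]
  have b0 : ‖c 0‖ ≤ K := by
    refine (ContinuousMap.norm_le _ hK).2 fun p => ?_
    rw [hcapp, norm_mul, h2pi]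
    have := intervalIntegral.norm_integral_le_of_norm_le_const (a := -π) (b := π) (C := K)
      (f := fun q => ek (-0) q * (f q p : ℂ)) (fun q _ => by
        rw [norm_mul, norm_ek, one_mul, Complex.norm_real]; exact hb p p.2 q)
    rw [show |π - -π| = 2 * π by rw [abs_of_pos] <;> linarith] at this
    rw [one_div, inv_mul_le_iff₀ (by positivity)]
    linarith
  have bk : ∀ k : ℤ, k ≠ 0 → ‖c k‖ ≤ K * (40 * |(k:ℝ)| ^ (-(1 + μ))) := by
    intro k hk
    refine (ContinuousMap.norm_le _ (by positivity)).2 ?_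
    have hsub : Icc (-1:ℝ) 0 ⊆ {p | ‖ex (c k) p‖ ≤ K * (40 * |(k:ℝ)| ^ (-(1 + μ)))} := by
      rw [← closure_Ioo (by norm_num)]
      refine closure_minimal ?_ (isClosed_le (cont_ex _).norm continuous_const)
      intro p hp
      have hp' := Ioo_subset_Icc_self hp
      have := coef_bd hμ hK (hs p hp') (hd p hp) (hh p hp) k hk
      show ‖ex (c k) p‖ ≤ _
      rw [ex_of_mem _ hp', hcapp, norm_mul, h2pi, intervalIntegral.integral_eq_integral_of_support_subset]
      · rw [one_div, inv_mul_le_iff₀ (by positivity)]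
        refine this.trans ?_
        have : 0 ≤ K * (40 * |(k:ℝ)| ^ (-(1 + μ))) := by positivity
        nlinarith
      · intro q hq
        by_contra hn
        apply hq
        have : 2 ≤ |q| := by
          by_contra hlt; push Not at hlt; exact hn ⟨by linarith [(abs_lt.1 hlt).1], by linarith [(abs_lt.1 hlt).2]⟩
        simp [hs p hp' q this]
    intro p
    simpa [ex_coe] using hsub p.2
  have hsum1 : Summable fun k : ℤ => 40 * |(k:ℝ)| ^ (-(1 + μ)) :=
    (Real.summable_abs_int_rpow (by linarith [hμ.1])).mul_left _
  have ball : ∀ k, ‖c k‖ ≤ K * ((if k = 0 then 1 else 0) + 40 * |(k:ℝ)| ^ (-(1 + μ))) := by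
    intro k
    by_cases hk : k = 0
    · subst hk
      refine b0.trans ?_
      have : (0:ℝ) ≤ 40 * |((0:ℤ):ℝ)| ^ (-(1 + μ)) := by positivity
      simp only [if_true]
      nlinarith
    · simpa [hk] using bk k hk
  have hS : HasSum (fun k : ℤ => K * ((if k = 0 then 1 else 0) + 40 * |(k:ℝ)| ^ (-(1 + μ)))) (K * cW μ) :=
    ((hasSum_ite_eq 0 1).add hsum1.hasSum).mul_left K
  have hsc : Summable fun k => ‖c k‖ := Summable.of_nonneg_of_le (fun _ => norm_nonneg _) ball hS.summable
  refine ⟨mk c hsc, ?_, ?_⟩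
  · rw [norm_eq, mul_comm]
    simp only [co_mk]
    exact hasSum_le ball hsc.hasSum hS
  · intro p hp q hq
    have : Fact (0 < 2 * π) := ⟨by positivity⟩
    have hcq : Continuous (fun q => (f q p : ℂ)) :=
      Complex.continuous_ofReal.comp (hcc.comp (Continuous.prodMk (continuous_const (y := (⟨p, hp⟩ : Icc (-1:ℝ) 0))) continuous_id))
    have hG : Continuous (AddCircle.liftIco (2*π) (-π) (fun q => (f q p : ℂ))) := by
      apply AddCircle.liftIco_continuous
      · rw [hs p hp, hs p hp]
        · rw [abs_of_pos] <;> linarith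
        · rw [abs_of_neg] <;> linarith
      · exact hcq.continuousOn
    let G : C(AddCircle (2*π), ℂ) := ⟨_, hG⟩
    have hGc : ∀ k, fourierCoeff G k = ex (c k) p := by
      intro k
      show fourierCoeff (AddCircle.liftIco (2*π) (-π) (fun q => (f q p : ℂ))) k = _
      rw [fourierCoeff_liftIco_eq, fourierCoeffOn_eq_integral, ex_of_mem _ hp, hcapp]
      rw [show -π + 2 * π - -π = 2 * π by ring, show -π + 2 * π = π by ring, Complex.real_smul]
      congr 1
      apply intervalIntegral.integral_congr
      intro q _
      simp only [smul_eq_mul]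
      rw [fourier_coe_apply, ek]
      congr 2
      push_cast
      have : (π : ℂ) ≠ 0 := by simp [pi_ne_zero]
      field_simp
    have hsf : Summable (fourierCoeff G) := by
      refine Summable.of_norm (Summable.of_nonneg_of_le (fun _ => norm_nonneg _) (fun k => ?_) hsc)
      rw [hGc]; exact norm_ex_le _ _
    have h1 := has_pointwise_sum_fourier_series_of_summable hsf (q : AddCircle (2*π))
    have h2 : G (q : AddCircle (2*π)) = f q p := by
      show AddCircle.liftIco (2*π) (-π) (fun q => (f q p : ℂ)) q = _
      rw [AddCircle.liftIco_coe_apply ⟨hq.1.le, by linarith [hq.2]⟩]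
    rw [h2] at h1
    refine HasSum.unique ?_ h1
    have h3 := ((ContinuousMap.evalCLM ℂ (⟨p, hp⟩ : Icc (-1:ℝ) 0)).hasSum (hasSum_ev q (mk c hsc)))
    rw [va, ex_of_mem _ hp]
    suffices e : (fun i => fourierCoeff G i • (fourier i) (q : AddCircle (2*π))) = fun b => (ContinuousMap.evalCLM ℂ (⟨p, hp⟩ : Icc (-1:ℝ) 0)) (ek b q • (mk c hsc).co b) by
      rw [e]; exact h3
    funext k
    rw [hGc, ex_of_mem _ hp, fourier_coe_apply]
    simp only [co_mk, ContinuousMap.evalCLM_apply, ContinuousMap.smul_apply, smul_eq_mul, ek]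
    rw [mul_comm]
    congr 2
    push_cast
    have : (π : ℂ) ≠ 0 := by simp [pi_ne_zero]
    field_simp
end WA
end partW4b

section partW5
namespace WA
open MeasureTheory Real

theorem va_prim (a : WA) (q p : ℝ) (hp : p ∈ Icc (-1:ℝ) 0) : va (prim a) q p = ∫ t in (-1:ℝ)..p, va a q t := by
  have h := intervalIntegral.hasSum_intervalIntegral_of_summable_norm (a := (-1:ℝ)) (b := p)
    (f := fun j : ℤ => (⟨fun t => ek j q * ex (a.co j) t, by fun_prop⟩ : C(ℝ, ℂ))) ?_
  · have h1 : ∀ t, ∑' j : ℤ, ek j q * ex (a.co j) t = va a q t := by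
      intro t
      exact ((ContinuousMap.evalCLM ℂ (projIcc (-1:ℝ) 0 (by norm_num) t)).hasSum (hasSum_ev q a)).tsum_eq
    simp only [ContinuousMap.coe_mk, h1] at h
    refine HasSum.unique ?_ h
    have h3 := ((ContinuousMap.evalCLM ℂ (projIcc (-1:ℝ) 0 (by norm_num) p)).hasSum (hasSum_ev q (prim a)))
    have h4 : (fun i : ℤ => ∫ t in (-1:ℝ)..p, ek i q * ex (a.co i) t) =
        fun i => (ContinuousMap.evalCLM ℂ (projIcc (-1:ℝ) 0 (by norm_num) p)) (ek i q • (prim a).co i) := by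
      funext i
      rw [intervalIntegral.integral_const_mul]
      show _ = ek i q * ex ((prim a).co i) p
      congr 1
      rw [prim, co_diag, ex_KL _ _ _ _ hp]
      simp [Ki]
    rw [h4]; exact h3
  · refine Summable.of_nonneg_of_le (fun _ => norm_nonneg _) (fun j => ?_) a.sco
    refine (ContinuousMap.norm_le _ (norm_nonneg _)).2 fun q => ?_
    simpa [norm_ek] using norm_ex_le _ _

/-- integral over the period for elements vanishing for `1 ≤ |q|` -/
theorem int_va1 (a : WA) (k : ℤ) (p : ℝ) (h0 : ∀ q ∈ Ioo (-π) π, 1 ≤ |q| → va a q p = 0) :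
    ∫ q in (-1:ℝ)..1, ek (-k) q * va a q p = 2 * π * ex (a.co k) p := by
  rw [← int_va]
  have hpi : (3:ℝ) < π := pi_gt_three
  have hc : Continuous (fun q => ek (-k) q * va a q p) := (cont_ek _).mul (va_cont a p)
  rw [← intervalIntegral.integral_add_adjacent_intervals (a := -π) (b := -1) (c := π) (hc.intervalIntegrable _ _) (hc.intervalIntegrable _ _),
    ← intervalIntegral.integral_add_adjacent_intervals (a := -1) (b := 1) (c := π) (hc.intervalIntegrable _ _) (hc.intervalIntegrable _ _)]
  rw [intervalIntegral.integral_congr_Ioo_of_le (a := -π) (g := fun _ => 0) (by linarith), intervalIntegral.integral_congr_Ioo_of_le (a := 1) (b := π) (g := fun _ => 0) (by linarith)]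
  · simp
  · intro q hq
    simp only
    rw [h0 q ⟨by linarith [hq.1], hq.2⟩ (by rw [abs_of_pos] <;> linarith [hq.1]), mul_zero]
  · intro q hq
    simp only
    rw [h0 q ⟨hq.1, by linarith [hq.2]⟩ (by rw [abs_of_neg] <;> linarith [hq.2]), mul_zero]

theorem ibp_va (a : WA) (k : ℤ) (p : ℝ) (g : ℝ → ℂ) (h0 : ∀ q ∈ Ioo (-π) π, 1 ≤ |q| → va a q p = 0)
    (hg : ContinuousOn g (Ioo (-3/2) (3/2)))
    (hd : ∀ q ∈ Ioo (-3/2:ℝ) (3/2), HasDerivAt (fun q => va a q p) (g q) q) :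
    ∫ q in (-1:ℝ)..1, ek (-k) q * g q = 2 * π * (Complex.I * k * ex (a.co k) p) := by
  have hpi : (3:ℝ) < π := pi_gt_three
  have hsub : uIcc (-1:ℝ) 1 ⊆ Ioo (-3/2) (3/2) := by
    rw [uIcc_of_le (by norm_num)]
    intro q hq
    exact ⟨by linarith [hq.1], by linarith [hq.2]⟩
  rw [intervalIntegral.integral_mul_deriv_eq_deriv_mul (fun q _ => ek_deriv (-k) q) (fun q hq => hd q (hsub hq))]
  · rw [h0 1 ⟨by linarith, by linarith⟩ (by simp), h0 (-1) ⟨by linarith, by linarith⟩ (by simp)]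
    have := int_va1 a k p h0
    have e : ∀ q, Complex.I * ((-k : ℤ):ℂ) * ek (-k) q * va a q p = (-(Complex.I * k)) * (ek (-k) q * va a q p) := by
      intro q; push_cast; ring
    simp_rw [e]
    rw [intervalIntegral.integral_const_mul, this]; ring
  · exact Continuous.intervalIntegrable (by fun_prop) _ _
  · exact (hg.mono hsub).intervalIntegrable

theorem lemB {b c : WA} {p : ℝ} (hb : ∀ q ∈ Ioo (-π) π, 1 ≤ |q| → va b q p = 0)
    (hc : ∀ q ∈ Ioo (-π) π, 1 ≤ |q| → va c q p = 0)
    (hd : ∀ q ∈ Ioo (-3/2:ℝ) (3/2), HasDerivAt (fun q => va b q p) (va c q p) q) (k : ℤ) :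
    ex (c.co k) p = Complex.I * k * ex (b.co k) p := by
  have h1 := ibp_va b k p (fun q => va c q p) hb (va_cont _ _).continuousOn hd
  rw [int_va1 c k p hc] at h1
  have h3 : (2 * Real.pi : ℂ) ≠ 0 := by simp [Real.pi_ne_zero]
  exact mul_left_cancel₀ h3 h1

theorem co_zero_of {b : WA} {p : ℝ} (hb : ∀ q ∈ Ioo (-π) π, va b q p = 0) (k : ℤ) : ex (b.co k) p = 0 := by
  have h1 := int_va1 b k p (fun q hq _ => hb q hq)
  have h2 : ∫ q in (-1:ℝ)..1, ek (-k) q * va b q p = 0 := by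
    have hpi : (3:ℝ) < π := pi_gt_three
    rw [intervalIntegral.integral_congr_Ioo_of_le (g := fun _ => 0) (by norm_num)]
    · simp
    · intro q hq
      simp only
      rw [hb q ⟨by linarith [hq.1], by linarith [hq.2]⟩, mul_zero]
  rw [h2] at h1
  have h3 : (2 * Real.pi : ℂ) ≠ 0 := by simp [Real.pi_ne_zero]
  exact (mul_eq_zero.1 h1.symm).resolve_left h3

theorem lemC {a b c : WA} {B : ℝ → ℝ → ℂ}
    (ha : ∀ p ∈ Icc (-1:ℝ) 0, ∀ q ∈ Ioo (-π) π, 1 ≤ |q| → va a q p = 0)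
    (hb : ∀ p ∈ Icc (-1:ℝ) 0, ∀ q ∈ Ioo (-π) π, 1 ≤ |q| → va b q p = 0)
    (hc : ∀ p ∈ Icc (-1:ℝ) 0, ∀ q ∈ Ioo (-π) π, 1 ≤ |q| → va c q p = 0)
    (hB : ContinuousOn (fun z : ℝ × ℝ => B z.1 z.2) (Ioo (-3/2) (3/2) ×ˢ Ioo (-1) 0))
    (hdb : ∀ p ∈ Ioo (-1:ℝ) 0, ∀ q ∈ Ioo (-3/2:ℝ) (3/2), HasDerivAt (fun p => va b q p) (B q p) p)
    (hda : ∀ p ∈ Ioo (-1:ℝ) 0, ∀ q ∈ Ioo (-3/2:ℝ) (3/2), HasDerivAt (fun q => va a q p) (B q p + va c q p) q)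
    (k : ℤ) (p : ℝ) (hp : p ∈ Ioo (-1:ℝ) 0) :
    HasDerivAt (ex (b.co k)) (Complex.I * k * ex (a.co k) p - ex (c.co k) p) p := by
  have hpi : (3:ℝ) < π := pi_gt_three
  have h3 : (2 * Real.pi : ℂ) ≠ 0 := by simp [Real.pi_ne_zero]
  have hsub : Icc (-1:ℝ) 1 ⊆ Ioo (-3/2) (3/2) := by
    intro q hq
    exact ⟨by linarith [hq.1], by linarith [hq.2]⟩
  have hp' := Ioo_subset_Icc_self hp
  have hBq : ∀ p ∈ Ioo (-1:ℝ) 0, ContinuousOn (fun q => B q p) (Ioo (-3/2) (3/2)) := fun p hp =>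
    hB.comp (f := fun q : ℝ => (q, p)) (by fun_prop) (fun q hq => ⟨hq, hp⟩)
  -- value of the integral of B
  have hval : ∫ q in (-1:ℝ)..1, ek (-k) q * B q p = 2 * π * (Complex.I * k * ex (a.co k) p - ex (c.co k) p) := by
    have h1 := ibp_va a k p (fun q => B q p + va c q p) (ha p hp') ((hBq p hp).add (va_cont _ _).continuousOn) (hda p hp)
    have h2 := int_va1 c k p (hc p hp')
    simp_rw [mul_add] at h1
    rw [intervalIntegral.integral_add, h2] at h1
    · linear_combination h1
    · refine ContinuousOn.intervalIntegrable ?_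
      rw [uIcc_of_le (by norm_num)]
      exact (cont_ek _).continuousOn.mul ((hBq p hp).mono hsub)
    · exact ((cont_ek _).mul (va_cont c p)).intervalIntegrable _ _
  -- differentiate under the integral
  obtain ⟨ε, hε, hball⟩ := Metric.nhds_basis_closedBall.mem_iff.1 (isOpen_Ioo.mem_nhds hp)
  have hcomp : IsCompact (Icc (-1:ℝ) 1 ×ˢ Metric.closedBall p ε) := isCompact_Icc.prod (isCompact_closedBall _ _)
  obtain ⟨M, hM⟩ := hcomp.exists_bound_of_continuousOn (hB.mono (prod_mono hsub hball))
  have key := intervalIntegral.hasDerivAt_integral_of_dominated_loc_of_deriv_le (μ := volume) (a := (-1:ℝ)) (b := 1)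
    (F := fun p q => ek (-k) q * va b q p) (F' := fun p q => ek (-k) q * B q p) (x₀ := p) (bound := fun _ => M) (s := Metric.ball p ε)
    (Metric.ball_mem_nhds p hε)
    (Filter.Eventually.of_forall fun p => ((cont_ek _).mul (va_cont b p)).aestronglyMeasurable)
    (((cont_ek _).mul (va_cont b p)).intervalIntegrable _ _)
    (by
      refine (ContinuousOn.intervalIntegrable (E := ℂ) ?_).aestronglyMeasurable_restrict_uIoc
      rw [uIcc_of_le (by norm_num)]
      exact (cont_ek _).continuousOn.mul ((hBq p hp).mono hsub))
    (by
      refine Filter.Eventually.of_forall fun q hq x hx => ?_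
      rw [uIoc_of_le (by norm_num)] at hq
      rw [norm_mul, norm_ek, one_mul]
      exact hM (q, x) ⟨Ioc_subset_Icc_self hq, Metric.ball_subset_closedBall hx⟩)
    (by simp)
    (by
      refine Filter.Eventually.of_forall fun q hq x hx => ?_
      rw [uIoc_of_le (by norm_num)] at hq
      exact (hdb x (hball (Metric.ball_subset_closedBall hx)) q (hsub (Ioc_subset_Icc_self hq))).const_mul _)
  have h5 := key.2.const_mul ((2 * π : ℂ)⁻¹)
  rw [hval, ← mul_assoc, inv_mul_cancel₀ h3, one_mul] at h5
  refine h5.congr_of_eventuallyEq ?_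
  filter_upwards [isOpen_Ioo.mem_nhds hp] with x hx
  rw [int_va1 b k x (hb x (Ioo_subset_Icc_self hx)), ← mul_assoc, inv_mul_cancel₀ h3, one_mul]
end WA
end partW5

section partW6
open scoped Topology ContDiff

/-- smooth bump with derivative bounds -/
structure Bmp where
  (f f1 f2 f3 : ℝ → ℝ)
  (C : ℝ)
  (hd : ∀ x, HasDerivAt f (f1 x) x)
  (hd1 : ∀ x, HasDerivAt f1 (f2 x) x)
  (hd2 : ∀ x, HasDerivAt f2 (f3 x) x)
  (b0 : ∀ x, |f x| ≤ 1)
  (b1 : ∀ x, |f1 x| ≤ C)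
  (b2 : ∀ x, |f2 x| ≤ C)
  (b3 : ∀ x, |f3 x| ≤ C)
  (hC : 1 ≤ C)
namespace Bmp
theorem c0 (B : Bmp) : Continuous B.f := continuous_iff_continuousAt.2 fun x => (B.hd x).continuousAt
theorem c1 (B : Bmp) : Continuous B.f1 := continuous_iff_continuousAt.2 fun x => (B.hd1 x).continuousAt
theorem mvt {f f' : ℝ → ℝ} {s : Set ℝ} (hs : Convex ℝ s) {C : ℝ} (h : ∀ x ∈ s, HasDerivAt f (f' x) x) (hb : ∀ x ∈ s, |f' x| ≤ C)
    {x y : ℝ} (hx : x ∈ s) (hy : y ∈ s) : |f x - f y| ≤ C * |x - y| :=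
  hs.norm_image_sub_le_of_norm_hasDerivWithin_le (fun x hx => (h x hx).hasDerivWithinAt) hb hy hx

theorem mk' (r1 r2 : ℝ) (h0 : 0 < r1) (h1 : r1 < r2) : ∃ B : Bmp, (∀ x, |x| ≤ r1 → B.f x = 1) ∧
    (∀ x, r2 ≤ |x| → B.f x = 0) ∧ (∀ x, r2 ≤ |x| → B.f1 x = 0) := by
  let u : ContDiffBump (0:ℝ) := ⟨r1, r2, h0, h1⟩
  let f : ℝ → ℝ := u
  have hf : ContDiff ℝ ∞ f := u.contDiff
  have hf1 : ContDiff ℝ ∞ (deriv f) := (contDiff_infty_iff_deriv.1 hf).2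
  have hf2 : ContDiff ℝ ∞ (deriv (deriv f)) := (contDiff_infty_iff_deriv.1 hf1).2
  have hs : HasCompactSupport f := u.hasCompactSupport
  obtain ⟨C1, hC1⟩ := hf1.continuous.bounded_above_of_compact_support hs.deriv
  obtain ⟨C2, hC2⟩ := hf2.continuous.bounded_above_of_compact_support hs.deriv.deriv
  have hf3 : ContDiff ℝ ∞ (deriv (deriv (deriv f))) := (contDiff_infty_iff_deriv.1 hf2).2
  obtain ⟨C3, hC3⟩ := hf3.continuous.bounded_above_of_compact_support hs.deriv.deriv.deriv
  have hd : ∀ x, HasDerivAt f (deriv f x) x := fun x => (hf.differentiable (by simp) x).hasDerivAt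
  have z0 : ∀ x, r2 ≤ |x| → f x = 0 := fun x hx => u.zero_of_le_dist (by simpa [Real.dist_eq, u] using hx)
  refine ⟨⟨f, deriv f, deriv (deriv f), deriv (deriv (deriv f)), max 1 (max C1 (max C2 C3)), hd, fun x => (hf1.differentiable (by simp) x).hasDerivAt,
    fun x => (hf2.differentiable (by simp) x).hasDerivAt, fun x => ?_, fun x => (hC1 x).trans ((le_max_left _ _).trans (le_max_right _ _)),
    fun x => (hC2 x).trans ((le_max_left _ _).trans ((le_max_right _ _).trans (le_max_right _ _))),
    fun x => (hC3 x).trans ((le_max_right _ _).trans ((le_max_right _ _).trans (le_max_right _ _))), le_max_left _ _⟩, fun x hx => ?_, z0, fun x hx => ?_⟩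
  · rw [abs_of_nonneg u.nonneg]; exact u.le_one
  · exact u.one_of_mem_closedBall (by simpa [Real.dist_eq, u] using hx)
  · have hmin : IsLocalMin f x := by
      refine Filter.Eventually.of_forall fun y => ?_
      rw [z0 x hx]; exact u.nonneg
    exact hmin.deriv_eq_zero
end Bmp

namespace WA
open Real

theorem rpow_aux {μ t : ℝ} (hμ : μ ∈ Ioo (0:ℝ) 1) (h0 : 0 ≤ t) (h1 : t ≤ 1) : t ≤ t ^ μ := by
  rcases h0.eq_or_lt with h | h
  · rw [← h]; positivity
  · calc t = t ^ (1:ℝ) := (rpow_one t).symm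
      _ ≤ t ^ μ := rpow_le_rpow_of_exponent_ge h h1 hμ.2.le

theorem rpow_aux6 {μ t : ℝ} (hμ : μ ∈ Ioo (0:ℝ) 1) (h0 : 0 ≤ t) (h1 : t ≤ 6) : t ≤ 6 * t ^ μ := by
  rcases le_or_gt t 1 with h | h
  · have := rpow_aux hμ h0 h
    have h2 : 0 ≤ t ^ μ := by positivity
    linarith
  · have : 1 ≤ t ^ μ := one_le_rpow h.le hμ.1.le
    linarith

theorem lemK0 {μ : ℝ} (hμ : μ ∈ Ioo (0:ℝ) 1) (χ : Bmp) (hχ0 : ∀ x, 7/4 ≤ |x| → χ.f x = 0) (hχ1 : ∀ x, 7/4 ≤ |x| → χ.f1 x = 0)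
    {j jq : ℝ → ℝ → ℝ} {K : ℝ} (hK : 0 ≤ K)
    (hc : ContinuousOn (fun z : ℝ × ℝ => j z.1 z.2) (univ ×ˢ Icc (-1) 0))
    (hb : ∀ p ∈ Icc (-1:ℝ) 0, ∀ q ∈ Icc (-3:ℝ) 3, |j q p| ≤ K)
    (hd : ∀ p ∈ Ioo (-1:ℝ) 0, ∀ q, HasDerivAt (fun q => j q p) (jq q p) q)
    (hb1 : ∀ p ∈ Ioo (-1:ℝ) 0, ∀ q ∈ Icc (-3:ℝ) 3, |jq q p| ≤ K)
    (hh : ∀ p ∈ Ioo (-1:ℝ) 0, ∀ q ∈ Icc (-3:ℝ) 3, ∀ q' ∈ Icc (-3:ℝ) 3, |jq q p - jq q' p| ≤ K * |q - q'| ^ μ) :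
    ∃ F : WA, ‖F‖ ≤ cW μ * (4 * (χ.C + 1)) * K ∧ ∀ p ∈ Icc (-1:ℝ) 0, ∀ q ∈ Ioo (-π) π, va F q p = (χ.f q * j q p : ℝ) := by
  have hC := χ.hC
  have habs : ∀ q : ℝ, q ∉ Icc (-3:ℝ) 3 → 3 < |q| := fun q hq => by
    by_contra h; push Not at h; exact hq (abs_le.1 h)
  have hbf : ∀ p ∈ Ioo (-1:ℝ) 0, ∀ q, |χ.f1 q * j q p + χ.f q * jq q p| ≤ (χ.C + 1) * K := by
    intro p hp q
    by_cases hq : q ∈ Icc (-3:ℝ) 3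
    · refine (abs_add_le _ _).trans ?_
      rw [abs_mul, abs_mul]
      have h1 := mul_le_mul (χ.b1 q) (hb p (Ioo_subset_Icc_self hp) q hq) (abs_nonneg _) (by linarith)
      have h2 := mul_le_mul (χ.b0 q) (hb1 p hp q hq) (abs_nonneg _) (by linarith)
      linarith
    · have := habs q hq
      rw [hχ0 q (by linarith), hχ1 q (by linarith)]; simp; positivity
  obtain ⟨F, h1, h2⟩ := lemW hμ (f := fun q p => χ.f q * j q p) (fq := fun q p => χ.f1 q * j q p + χ.f q * jq q p)
    (K := 4 * (χ.C + 1) * K) (by positivity) ((χ.c0.comp continuous_fst).continuousOn.mul hc)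
    (fun p hp q hq => by rw [hχ0 q (by linarith), zero_mul])
    (by
      intro p hp q
      by_cases hq : q ∈ Icc (-3:ℝ) 3
      · rw [abs_mul]
        have h1 := mul_le_mul (χ.b0 q) (hb p hp q hq) (abs_nonneg _) (by linarith)
        have : 0 ≤ (4 * (χ.C + 1) - 1) * K := by apply mul_nonneg _ hK; linarith
        linarith
      · have := habs q hq
        rw [hχ0 q (by linarith)]; simp; positivity)
    (fun p hp q => (χ.hd q).mul (hd p hp q))
    (by
      intro p hp q q'
      rcases le_or_gt 1 |q - q'| with h | h
      · have h3 : 1 ≤ |q - q'| ^ μ := one_le_rpow h hμ.1.le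
        have h4 := hbf p hp q
        have h5 := hbf p hp q'
        calc _ ≤ (χ.C + 1) * K + (χ.C + 1) * K := (abs_sub _ _).trans (add_le_add h4 h5)
          _ ≤ 4 * (χ.C + 1) * K * 1 := by nlinarith [mul_nonneg (by linarith : 0 ≤ χ.C + 1) hK]
          _ ≤ _ := by gcongr
      · by_cases hq : q ∈ Icc (-3:ℝ) 3 ∧ q' ∈ Icc (-3:ℝ) 3
        · have ht := rpow_aux hμ (abs_nonneg (q - q')) h.le
          have e1 := Bmp.mvt (convex_Icc (-3:ℝ) 3) (fun x _ => hd p hp x) (hb1 p hp) hq.1 hq.2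
          have e2 := Bmp.mvt convex_univ (fun x _ => χ.hd1 x) (fun x _ => χ.b2 x) (mem_univ q) (mem_univ q')
          have e3 := Bmp.mvt convex_univ (fun x _ => χ.hd x) (fun x _ => χ.b1 x) (mem_univ q) (mem_univ q')
          have e4 := hh p hp q hq.1 q' hq.2
          have e5 := hb p (Ioo_subset_Icc_self hp) q' hq.2
          have e6 := hb1 p hp q' hq.2
          have m1 := mul_le_mul (χ.b1 q) e1 (abs_nonneg _) (by linarith)
          have m2 := mul_le_mul e2 e5 (abs_nonneg _) (by positivity)
          have m3 := mul_le_mul (χ.b0 q) e4 (abs_nonneg _) (by linarith)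
          have m4 := mul_le_mul e3 e6 (abs_nonneg _) (by positivity)
          rw [← abs_mul] at m1 m2 m3 m4
          have id : χ.f1 q * j q p + χ.f q * jq q p - (χ.f1 q' * j q' p + χ.f q' * jq q' p) =
            (χ.f1 q * (j q p - j q' p) + (χ.f1 q - χ.f1 q') * j q' p) + (χ.f q * (jq q p - jq q' p) + (χ.f q - χ.f q') * jq q' p) := by ring
          rw [id]
          have t1 := abs_add_le (χ.f1 q * (j q p - j q' p) + (χ.f1 q - χ.f1 q') * j q' p) (χ.f q * (jq q p - jq q' p) + (χ.f q - χ.f q') * jq q' p)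
          have t2 := abs_add_le (χ.f1 q * (j q p - j q' p)) ((χ.f1 q - χ.f1 q') * j q' p)
          have t3 := abs_add_le (χ.f q * (jq q p - jq q' p)) ((χ.f q - χ.f q') * jq q' p)
          have hCK : 0 ≤ χ.C * K := by positivity
          have n1 : χ.C * K * |q - q'| ≤ χ.C * K * |q - q'| ^ μ := by gcongr
          have n2 : 0 ≤ K * |q - q'| ^ μ := by positivity
          have n3 : 0 ≤ χ.C * K * |q - q'| ^ μ := by positivity
          linarith
        · have hq2 : 7/4 ≤ |q| ∧ 7/4 ≤ |q'| := by
            have t1 := abs_sub_abs_le_abs_sub q q'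
            have t2 := abs_sub_abs_le_abs_sub q' q
            rw [abs_sub_comm] at t2
            rw [not_and_or] at hq
            rcases hq with h | h
            · have := habs _ h; constructor <;> linarith
            · have := habs _ h; constructor <;> linarith
          rw [hχ0 q hq2.1, hχ1 q hq2.1, hχ0 q' hq2.2, hχ1 q' hq2.2]; simp; positivity)
  refine ⟨F, by rw [mul_assoc]; exact h1, h2⟩
end WA
end partW6

section partW7
open scoped Topology ContDiff

structure Geo where
  (xs ps a s pc : ℝ)
  (χ z1 z2 : Bmp)
  (hχ1 : ∀ x, |x| ≤ 3/2 → χ.f x = 1)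
  (hχ0 : ∀ x, 7/4 ≤ |x| → χ.f x = 0)
  (hχ0' : ∀ x, 7/4 ≤ |x| → χ.f1 x = 0)
  (h10 : z1.f 0 = 1)
  (h1 : ∀ x, 1 ≤ |x| → z1.f x = 0)
  (h1' : ∀ x, 1 ≤ |x| → z1.f1 x = 0)
  (h20 : z2.f 0 = 1)
  (h2 : ∀ x, 1/4 ≤ |x| → z2.f x = 0)
  (h2' : ∀ x, 1/4 ≤ |x| → z2.f1 x = 0)
  (hs : 0 < s)
  (hpc : pc = 0 ∨ pc = -1/2)

namespace Geo
open Real WA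
variable (G : Geo)
def xi (q p : ℝ) : ℝ := G.z1.f q * G.z2.f (p - G.pc)
def xiq (q p : ℝ) : ℝ := G.z1.f1 q * G.z2.f (p - G.pc)
def xip (q p : ℝ) : ℝ := G.z1.f q * G.z2.f1 (p - G.pc)
def xiqq (q p : ℝ) : ℝ := G.z1.f2 q * G.z2.f (p - G.pc)
def xiqp (q p : ℝ) : ℝ := G.z1.f1 q * G.z2.f1 (p - G.pc)
def X (ε l q p : ℝ) : ℝ := G.xs + ε * (q - G.a * (p - G.pc) + l * G.xi q p)
def Xq (l q p : ℝ) : ℝ := 1 + l * G.xiq q p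
def Xp (l q p : ℝ) : ℝ := -G.a + l * G.xip q p
def ph (ε p : ℝ) : ℝ := G.ps + ε * G.s * (p - G.pc)

theorem cxi : Continuous (fun z : ℝ × ℝ => G.xi z.1 z.2) :=
  (G.z1.c0.comp continuous_fst).mul (G.z2.c0.comp (continuous_snd.sub continuous_const))
theorem cxiq : Continuous (fun z : ℝ × ℝ => G.xiq z.1 z.2) :=
  (G.z1.c1.comp continuous_fst).mul (G.z2.c0.comp (continuous_snd.sub continuous_const))
theorem cxip : Continuous (fun z : ℝ × ℝ => G.xip z.1 z.2) :=
  (G.z1.c0.comp continuous_fst).mul (G.z2.c1.comp (continuous_snd.sub continuous_const))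
theorem cxiqp : Continuous (fun z : ℝ × ℝ => G.xiqp z.1 z.2) :=
  (G.z1.c1.comp continuous_fst).mul (G.z2.c1.comp (continuous_snd.sub continuous_const))
theorem cX (ε l : ℝ) : Continuous (fun z : ℝ × ℝ => G.X ε l z.1 z.2) := by
  have := G.cxi; unfold X; fun_prop
theorem cXq (l : ℝ) : Continuous (fun z : ℝ × ℝ => G.Xq l z.1 z.2) := by
  have := G.cxiq; unfold Xq; fun_prop
theorem cXp (l : ℝ) : Continuous (fun z : ℝ × ℝ => G.Xp l z.1 z.2) := by
  have := G.cxip; unfold Xp; fun_prop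
theorem cph (ε : ℝ) : Continuous (G.ph ε) := by unfold ph; fun_prop

theorem dxi_q (q p : ℝ) : HasDerivAt (fun q => G.xi q p) (G.xiq q p) q := (G.z1.hd q).mul_const _
theorem dxi_p (q p : ℝ) : HasDerivAt (fun p => G.xi q p) (G.xip q p) p :=
  ((G.z2.hd (p - G.pc)).comp_sub_const p G.pc).const_mul _
theorem dxiq_q (q p : ℝ) : HasDerivAt (fun q => G.xiq q p) (G.xiqq q p) q := (G.z1.hd1 q).mul_const _
theorem dxiq_p (q p : ℝ) : HasDerivAt (fun p => G.xiq q p) (G.xiqp q p) p :=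
  ((G.z2.hd (p - G.pc)).comp_sub_const p G.pc).const_mul _
theorem dxip_q (q p : ℝ) : HasDerivAt (fun q => G.xip q p) (G.xiqp q p) q := (G.z1.hd q).mul_const _
theorem dX_q (ε l q p : ℝ) : HasDerivAt (fun q => G.X ε l q p) (ε * G.Xq l q p) q :=
  ((((hasDerivAt_id q).sub_const _).add ((G.dxi_q q p).const_mul l)).const_mul ε).const_add _
theorem dX_p (ε l q p : ℝ) : HasDerivAt (fun p => G.X ε l q p) (ε * G.Xp l q p) p := by
  refine ((((((hasDerivAt_id p).sub_const G.pc).const_mul G.a).const_sub q).add ((G.dxi_p q p).const_mul l)).const_mul ε |>.const_add G.xs).congr_deriv ?_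
  simp [Xp]
theorem dXq_p (l q p : ℝ) : HasDerivAt (fun p => G.Xq l q p) (l * G.xiqp q p) p :=
  ((G.dxiq_p q p).const_mul l).const_add _
theorem dXp_q (l q p : ℝ) : HasDerivAt (fun q => G.Xp l q p) (l * G.xiqp q p) q :=
  ((G.dxip_q q p).const_mul l).const_add _
theorem dph (ε p : ℝ) : HasDerivAt (G.ph ε) (ε * G.s) p := by
  refine ((((hasDerivAt_id p).sub_const G.pc).const_mul (ε * G.s)).const_add G.ps).congr_deriv ?_
  simp

def C : ℝ := G.z1.C * G.z2.C
theorem hC : 1 ≤ G.C := one_le_mul_of_one_le_of_one_le G.z1.hC G.z2.hC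
theorem bmul {a b c d : ℝ} (h1 : |a| ≤ c) (h2 : |b| ≤ d) (hc : 1 ≤ c) : |a * b| ≤ c * d := by
  rw [abs_mul]; exact mul_le_mul h1 h2 (abs_nonneg _) (by linarith)
theorem b_xi (q p : ℝ) : |G.xi q p| ≤ 1 := by
  have := bmul (G.z1.b0 q) (G.z2.b0 (p - G.pc)) le_rfl; rw [one_mul] at this; exact this
theorem b_xiq (q p : ℝ) : |G.xiq q p| ≤ G.C := bmul (G.z1.b1 q) ((G.z2.b0 (p - G.pc)).trans G.z2.hC) G.z1.hC
theorem b_xip (q p : ℝ) : |G.xip q p| ≤ G.C := bmul ((G.z1.b0 q).trans G.z1.hC) (G.z2.b1 (p - G.pc)) G.z1.hC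
theorem b_xiqq (q p : ℝ) : |G.xiqq q p| ≤ G.C := bmul (G.z1.b2 q) ((G.z2.b0 (p - G.pc)).trans G.z2.hC) G.z1.hC
theorem b_xiqp (q p : ℝ) : |G.xiqp q p| ≤ G.C := bmul (G.z1.b1 q) (G.z2.b1 (p - G.pc)) G.z1.hC

theorem out_q {q : ℝ} (hq : 1 ≤ |q|) (p : ℝ) : G.xi q p = 0 ∧ G.xiq q p = 0 ∧ G.xip q p = 0 := by
  simp [xi, xiq, xip, G.h1 q hq, G.h1' q hq]
theorem out_p {p : ℝ} (hp : 1/4 ≤ |p - G.pc|) (q : ℝ) : G.xi q p = 0 ∧ G.xiq q p = 0 ∧ G.xip q p = 0 := by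
  simp [xi, xiq, xip, G.h2 _ hp, G.h2' _ hp]

def Cn (μ : ℝ) : ℝ := cW μ * (4 * (G.χ.C + 1))

theorem hCn (μ : ℝ) : 0 ≤ G.Cn μ := by
  have h1 : 0 ≤ cW μ := by
    have : 0 ≤ ∑' k : ℤ, 40 * |(k:ℝ)| ^ (-(1 + μ)) := tsum_nonneg fun k => by positivity
    unfold cW; linarith
  have := G.χ.hC
  exact mul_nonneg h1 (by linarith)

/-- elements from the smooth functions ξ_q, ξ_p -/
theorem elem_xi {μ : ℝ} (hμ : μ ∈ Ioo (0:ℝ) 1) : ∃ Eq Ep : WA,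
    (∀ p ∈ Icc (-1:ℝ) 0, ∀ q ∈ Ioo (-π) π, va Eq q p = (G.xiq q p : ℝ)) ∧
    (∀ p ∈ Icc (-1:ℝ) 0, ∀ q ∈ Ioo (-π) π, va Ep q p = (G.xip q p : ℝ)) := by
  have hC := G.hC
  have cut : ∀ q p, G.χ.f q * G.xiq q p = G.xiq q p ∧ G.χ.f q * G.xip q p = G.xip q p := by
    intro q p
    rcases le_or_gt |q| 1 with h | h
    · rw [G.hχ1 q (by linarith)]; simp
    · obtain ⟨_, h2, h3⟩ := G.out_q h.le p; rw [h2, h3]; simp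
  have hw : ∀ {q q' : ℝ}, q ∈ Icc (-3:ℝ) 3 → q' ∈ Icc (-3:ℝ) 3 → |q - q'| ≤ 6 * |q - q'| ^ μ := by
    intro q q' h h'
    exact rpow_aux6 hμ (abs_nonneg _) (abs_le.2 ⟨by linarith [h.1, h'.2], by linarith [h.2, h'.1]⟩)
  have c6 : G.C ≤ 6 * G.C := by linarith
  have hol : ∀ {f f' : ℝ → ℝ}, (∀ x, HasDerivAt f (f' x) x) → (∀ x, |f' x| ≤ G.C) → ∀ q ∈ Icc (-3:ℝ) 3, ∀ q' ∈ Icc (-3:ℝ) 3,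
      |f q - f q'| ≤ 6 * G.C * |q - q'| ^ μ := by
    intro f f' hf hf' q hq q' hq'
    have h1 := Bmp.mvt convex_univ (fun x _ => hf x) (fun x _ => hf' x) (mem_univ q) (mem_univ q')
    have h2 := mul_le_mul_of_nonneg_left (hw hq hq') (by linarith : 0 ≤ G.C)
    linarith
  obtain ⟨Eq, _, hq⟩ := lemK0 hμ G.χ G.hχ0 G.hχ0' (j := G.xiq) (jq := G.xiqq) (K := 6 * G.C) (by linarith)
    G.cxiq.continuousOn (fun p _ q _ => (G.b_xiq q p).trans c6) (fun p _ q => G.dxiq_q q p)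
    (fun p _ q _ => (G.b_xiqq q p).trans c6)
    (fun p _ => hol (fun q => (G.z1.hd2 q).mul_const _) (fun q => bmul (G.z1.b3 q) ((G.z2.b0 (p - G.pc)).trans G.z2.hC) G.z1.hC))
  obtain ⟨Ep, _, hp⟩ := lemK0 hμ G.χ G.hχ0 G.hχ0' (j := G.xip) (jq := G.xiqp) (K := 6 * G.C) (by linarith)
    G.cxip.continuousOn (fun p _ q _ => (G.b_xip q p).trans c6) (fun p _ q => G.dxip_q q p)
    (fun p _ q _ => (G.b_xiqp q p).trans c6)
    (fun p _ => hol (fun q => (G.z1.hd1 q).mul_const _) (fun q => bmul (G.z1.b2 q) (G.z2.b1 (p - G.pc)) G.z1.hC))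
  refine ⟨Eq, Ep, fun p h q h' => ?_, fun p h q h' => ?_⟩
  · rw [hq p h q h', (cut q p).1]
  · rw [hp p h q h', (cut q p).2]

theorem X_near {ε l q p : ℝ} (hε : 0 ≤ ε) (hl : |l| ≤ 1) (hq : q ∈ Icc (-3:ℝ) 3) (hp : p ∈ Icc (-1:ℝ) 0) :
    |G.X ε l q p - G.xs| ≤ ε * (4 + |G.a|) ∧ |G.ph ε p - G.ps| ≤ ε * G.s := by
  have hpp : |p - G.pc| ≤ 1 := by
    rcases G.hpc with h | h <;> rw [h] <;> refine abs_le.2 ⟨?_, ?_⟩ <;> linarith [hp.1, hp.2]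
  constructor
  · rw [X, add_sub_cancel_left, abs_mul, abs_of_nonneg hε]
    gcongr
    have h1 : |G.a * (p - G.pc)| ≤ |G.a| := by
      rw [abs_mul]; exact mul_le_of_le_one_right (abs_nonneg _) hpp
    have h2 : |l * G.xi q p| ≤ 1 := by have := bmul hl (G.b_xi q p) le_rfl; linarith
    have h3 : |q| ≤ 3 := abs_le.2 hq
    have := abs_add_le (q - G.a * (p - G.pc)) (l * G.xi q p)
    have := abs_sub q (G.a * (p - G.pc))
    linarith
  · rw [ph, add_sub_cancel_left, abs_mul, abs_mul, abs_of_nonneg hε, abs_of_pos G.hs]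
    exact mul_le_of_le_one_right (mul_nonneg hε G.hs.le) hpp

theorem lemE {μ pa pb : ℝ} (hμ : μ ∈ Ioo (0:ℝ) 1) {k kx : ℝ × ℝ → ℝ} {K : ℝ} (hK : 0 ≤ K)
    (hps : G.ps ∈ Icc pa pb)
    (hph : ∀ᶠ ε in 𝓝[>] (0:ℝ), (∀ p ∈ Icc (-1:ℝ) 0, G.ph ε p ∈ Icc pa pb) ∧ (∀ p ∈ Ioo (-1:ℝ) 0, G.ph ε p ∈ Ioo pa pb))
    (hk : ContinuousOn k (univ ×ˢ Icc pa pb))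
    (hd : ∀ x, ∀ p ∈ Ioo pa pb, HasDerivAt (fun x => k (x, p)) (kx (x, p)) x)
    (hb : ∀ x ∈ Icc (G.xs - 1) (G.xs + 1), ∀ p ∈ Ioo pa pb, |kx (x, p)| ≤ K)
    (hh : ∀ x ∈ Icc (G.xs - 1) (G.xs + 1), ∀ x' ∈ Icc (G.xs - 1) (G.xs + 1), ∀ p ∈ Ioo pa pb,
      |kx (x, p) - kx (x', p)| ≤ K * |x - x'| ^ μ) {τ : ℝ} (hτ : 0 < τ) :
    ∀ᶠ ε in 𝓝[>] (0:ℝ), ∀ l, |l| ≤ 1 → ∃ F : WA, ‖F‖ ≤ G.Cn μ * (|k (G.xs, G.ps)| + τ) ∧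
      ∀ p ∈ Icc (-1:ℝ) 0, ∀ q ∈ Ioo (-π) π, va F q p = (G.χ.f q * k (G.X ε l q p, G.ph ε p) : ℝ) := by
  have hC := G.hC
  have hcw : ContinuousWithinAt k (univ ×ˢ Icc pa pb) (G.xs, G.ps) := hk _ ⟨trivial, hps⟩
  obtain ⟨δ, hδ, hkδ⟩ := Metric.continuousWithinAt_iff.1 hcw τ hτ
  have sm : ∀ A t : ℝ, 0 < t → ∀ᶠ ε in 𝓝[>] (0:ℝ), ε * A < t := by
    intro A t ht
    have : Filter.Tendsto (fun ε : ℝ => ε * A) (𝓝[>] 0) (𝓝 0) := by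
      have h : Continuous (fun ε : ℝ => ε * A) := by fun_prop
      have := h.tendsto 0
      rw [zero_mul] at this
      exact this.mono_left nhdsWithin_le_nhds
    exact this.eventually_lt_const ht
  set N : ℝ := (1 + G.C) * (1 + G.C) + 6 * G.C with hN
  filter_upwards [hph, sm (4 + |G.a|) δ hδ, sm G.s δ hδ, sm (4 + |G.a|) 1 one_pos, sm (K * N) τ hτ, sm 1 1 one_pos,
    self_mem_nhdsWithin] with ε hph e1 e2 e3 e4 e5 hε l hl
  have hε : 0 < ε := hε
  have win : ∀ q ∈ Icc (-3:ℝ) 3, ∀ p ∈ Icc (-1:ℝ) 0, G.X ε l q p ∈ Icc (G.xs - 1) (G.xs + 1) := by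
    intro q hq p hp
    have := abs_le.1 ((G.X_near hε.le hl hq hp).1.trans e3.le)
    exact ⟨by linarith [this.1], by linarith [this.2]⟩
  have bXq : ∀ q p, |G.Xq l q p| ≤ 1 + G.C := by
    intro q p
    have h1 := bmul hl (G.b_xiq q p) le_rfl
    have h2 := abs_add_le 1 (l * G.xiq q p)
    rw [abs_one] at h2
    unfold Xq; linarith
  have hKτ : ε * (K * (1 + G.C)) ≤ τ := by
    refine le_trans ?_ e4.le
    gcongr
    nlinarith
  refine lemK0 hμ G.χ G.hχ0 G.hχ0' (j := fun q p => k (G.X ε l q p, G.ph ε p))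
    (jq := fun q p => kx (G.X ε l q p, G.ph ε p) * (ε * G.Xq l q p)) (by positivity) ?_ ?_ ?_ ?_ ?_
  · refine hk.comp (f := fun z : ℝ × ℝ => (G.X ε l z.1 z.2, G.ph ε z.2)) ?_ ?_
    · exact ((G.cX ε l).prodMk ((G.cph ε).comp continuous_snd)).continuousOn
    · intro z hz; exact ⟨trivial, hph.1 _ hz.2⟩
  · intro p hp q hq
    have h1 := G.X_near hε.le hl hq hp
    have h2 := hkδ (x := (G.X ε l q p, G.ph ε p)) ⟨trivial, hph.1 p hp⟩ (by
      rw [Prod.dist_eq, max_lt_iff, Real.dist_eq, Real.dist_eq]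
      exact ⟨h1.1.trans_lt e1, h1.2.trans_lt e2⟩)
    rw [Real.dist_eq] at h2
    have := abs_sub_abs_le_abs_sub (k (G.X ε l q p, G.ph ε p)) (k (G.xs, G.ps))
    linarith
  · intro p hp q
    exact (hd _ _ (hph.2 p hp)).comp q (G.dX_q ε l q p)
  · intro p hp q hq
    have h1 := hb _ (win q hq p (Ioo_subset_Icc_self hp)) _ (hph.2 p hp)
    rw [abs_mul, abs_mul, abs_of_pos hε]
    have h2 := mul_le_mul h1 (bXq q p) (abs_nonneg _) hK
    have h3 := mul_le_mul_of_nonneg_left h2 hε.le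
    have := abs_nonneg (k (G.xs, G.ps))
    linarith
  · intro p hp q hq q' hq'
    have hp' := Ioo_subset_Icc_self hp
    have h1 := hh _ (win q hq p hp') _ (win q' hq' p hp') _ (hph.2 p hp)
    have h2 := hb _ (win q' hq' p hp') _ (hph.2 p hp)
    have dX : |G.X ε l q p - G.X ε l q' p| ≤ (1 + G.C) * |q - q'| := by
      refine Bmp.mvt convex_univ (fun x _ => G.dX_q ε l x p) (fun x _ => ?_) (mem_univ q) (mem_univ q')
      rw [abs_mul, abs_of_pos hε]
      have := mul_le_mul (show ε ≤ 1 by linarith) (bXq x p) (abs_nonneg _) zero_le_one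
      linarith
    have dX2 : |G.X ε l q p - G.X ε l q' p| ^ μ ≤ (1 + G.C) * |q - q'| ^ μ := by
      calc _ ≤ ((1 + G.C) * |q - q'|) ^ μ := by gcongr; exact hμ.1.le
        _ = (1 + G.C) ^ μ * |q - q'| ^ μ := mul_rpow (by linarith) (abs_nonneg _)
        _ ≤ (1 + G.C) ^ (1:ℝ) * |q - q'| ^ μ := by gcongr; exacts [by linarith, hμ.2.le]
        _ = _ := by rw [rpow_one]
    have dXq : |G.Xq l q p - G.Xq l q' p| ≤ G.C * (6 * |q - q'| ^ μ) := by
      have h3 := Bmp.mvt convex_univ (fun x _ => G.dxiq_q x p) (fun x _ => G.b_xiqq x p) (mem_univ q) (mem_univ q')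
      have h4 : |q - q'| ≤ 6 * |q - q'| ^ μ :=
        rpow_aux6 hμ (abs_nonneg _) (abs_le.2 ⟨by linarith [hq.1, hq'.2], by linarith [hq.2, hq'.1]⟩)
      have h5 : G.Xq l q p - G.Xq l q' p = l * (G.xiq q p - G.xiq q' p) := by unfold Xq; ring
      rw [h5]
      calc _ ≤ 1 * (G.C * |q - q'|) := bmul hl h3 le_rfl
        _ ≤ _ := by rw [one_mul]; gcongr
    set t := |q - q'| ^ μ with ht
    have ht0 : 0 ≤ t := by positivity
    have id : kx (G.X ε l q p, G.ph ε p) * (ε * G.Xq l q p) - kx (G.X ε l q' p, G.ph ε p) * (ε * G.Xq l q' p) =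
      ε * ((kx (G.X ε l q p, G.ph ε p) - kx (G.X ε l q' p, G.ph ε p)) * G.Xq l q p + kx (G.X ε l q' p, G.ph ε p) * (G.Xq l q p - G.Xq l q' p)) := by ring
    rw [id, abs_mul, abs_of_pos hε]
    have m1 : |(kx (G.X ε l q p, G.ph ε p) - kx (G.X ε l q' p, G.ph ε p)) * G.Xq l q p| ≤ (K * ((1 + G.C) * t)) * (1 + G.C) := by
      rw [abs_mul]
      exact mul_le_mul (h1.trans (by gcongr)) (bXq q p) (abs_nonneg _) (by positivity)
    have m2 : |kx (G.X ε l q' p, G.ph ε p) * (G.Xq l q p - G.Xq l q' p)| ≤ K * (G.C * (6 * t)) := by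
      rw [abs_mul]
      exact mul_le_mul h2 dXq (abs_nonneg _) hK
    have m3 := (abs_add_le _ _).trans (add_le_add m1 m2)
    have m4 := mul_le_mul_of_nonneg_left m3 hε.le
    have m5 : ε * (K * N) * t ≤ (|k (G.xs, G.ps)| + τ) * t := by
      have := abs_nonneg (k (G.xs, G.ps))
      gcongr; linarith
    refine m4.trans (le_trans (le_of_eq ?_) m5)
    rw [hN]; ring
end Geo
end partW7

section partW8
open scoped Topology ContDiff
open Real

def lin2 (a b : ℝ) : ℝ × ℝ →L[ℝ] ℝ := a • ContinuousLinearMap.fst ℝ ℝ ℝ + b • ContinuousLinearMap.snd ℝ ℝ ℝ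

theorem path {f : ℝ × ℝ → ℝ} {fx fp : ℝ} {x p : ℝ → ℝ} {x' p' t : ℝ} (h : HasFDerivAt f (lin2 fx fp) (x t, p t))
    (hx : HasDerivAt x x' t) (hp : HasDerivAt p p' t) : HasDerivAt (fun t => f (x t, p t)) (fx * x' + fp * p') t := by
  have := HasFDerivAt.comp_hasDerivAt t (f := fun t => (x t, p t)) h (hx.prodMk hp)
  exact this

structure HD (μ pa pb : ℝ) where
  (Y Yx Yp Yxx Yxp Ypp : ℝ × ℝ → ℝ)
  (b r : ℝ → ℝ)
  (κ A B : ℝ)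
  (cY : ContinuousOn Y (univ ×ˢ Icc pa pb))
  (cYx : ContinuousOn Yx (univ ×ˢ Icc pa pb))
  (cYp : ContinuousOn Yp (univ ×ˢ Icc pa pb))
  (pos : ∀ x, ∀ p ∈ Icc pa pb, 0 < Yp (x, p))
  (dY : ∀ x, ∀ p ∈ Ioo pa pb, HasFDerivAt Y (lin2 (Yx (x, p)) (Yp (x, p))) (x, p))
  (dYx : ∀ x, ∀ p ∈ Ioo pa pb, HasFDerivAt Yx (lin2 (Yxx (x, p)) (Yxp (x, p))) (x, p))
  (dYp : ∀ x, ∀ p ∈ Ioo pa pb, HasFDerivAt Yp (lin2 (Yxp (x, p)) (Ypp (x, p))) (x, p))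
  (cYxx : ContinuousOn Yxx (univ ×ˢ Ioo pa pb))
  (cYxp : ContinuousOn Yxp (univ ×ˢ Ioo pa pb))
  (cYpp : ContinuousOn Ypp (univ ×ˢ Ioo pa pb))
  (heq : ∀ x, ∀ p ∈ Ioo pa pb, Yxx (x, p) - (2 * Yx (x, p) * Yxp (x, p) / Yp (x, p)
    - (1 + Yx (x, p) ^ 2) * Ypp (x, p) / Yp (x, p) ^ 2) = Yp (x, p) * (b p + r p * Y (x, p)))
  (loc : ∀ xs, ∃ K, 0 ≤ K ∧ ∀ f ∈ ({Yxx, Yxp} : Set (ℝ × ℝ → ℝ)), (∀ x ∈ Icc (xs - 1) (xs + 1), ∀ p ∈ Ioo pa pb, |f (x, p)| ≤ K) ∧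
    ∀ x ∈ Icc (xs - 1) (xs + 1), ∀ x' ∈ Icc (xs - 1) (xs + 1), ∀ p ∈ Ioo pa pb, |f (x, p) - f (x', p)| ≤ K * |x - x'| ^ μ)
  (cb : ContinuousOn b (Icc pa pb))
  (cr : ContinuousOn r (Icc pa pb))

def HD.Top {μ pa pb : ℝ} (H : HD μ pa pb) : Prop :=
  (∀ x, HasDerivAt (fun x => H.Y (x, pb)) (H.Yx (x, pb)) x) ∧
  (∀ x, HasDerivAt (fun x => H.Yx (x, pb) / √(1 + H.Yx (x, pb) ^ 2))
    (H.κ * ((1 + H.Yx (x, pb) ^ 2) / H.Yp (x, pb) ^ 2) + H.A + H.B * H.Y (x, pb)) x)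

structure St (μ pa pb : ℝ) where
  (G : Geo)
  (H : HD μ pa pb)
  (ε ϖ : ℝ)
  (hε : 0 < ε)
  (hph : ∀ p ∈ Icc (-1:ℝ) 0, G.ph ε p ∈ Icc pa pb)
  (hph' : ∀ p ∈ Ioo (-1:ℝ) 0, G.ph ε p ∈ Ioo pa pb)
  (hsa : G.s * H.Yp (G.xs, G.ps) = 1 + G.a ^ 2)
  (hcase : (ϖ = 0 ∧ G.pc = -1/2) ∨ (ϖ = 1 ∧ G.pc = 0 ∧ G.ps = pb ∧ H.Top))
  (E1 E2 : ℝ → WA)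
  (Eq Ep c r2 c' : WA)
  (hE1 : ∀ l, |l| ≤ 1 → ∀ p ∈ Icc (-1:ℝ) 0, ∀ q ∈ Ioo (-π) π,
    WA.va (E1 l) q p = (G.χ.f q * (H.Yx (G.X ε l q p, G.ph ε p) - G.a) : ℝ))
  (hE2 : ∀ l, |l| ≤ 1 → ∀ p ∈ Icc (-1:ℝ) 0, ∀ q ∈ Ioo (-π) π,
    WA.va (E2 l) q p = (G.χ.f q * (H.Yp (G.X ε l q p, G.ph ε p) - H.Yp (G.xs, G.ps)) : ℝ))
  (hEq : ∀ p ∈ Icc (-1:ℝ) 0, ∀ q ∈ Ioo (-π) π, WA.va Eq q p = (G.xiq q p : ℝ))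
  (hEp : ∀ p ∈ Icc (-1:ℝ) 0, ∀ q ∈ Ioo (-π) π, WA.va Ep q p = (G.xip q p : ℝ))
  (hc : ∀ p ∈ Icc (-1:ℝ) 0, ∀ q ∈ Ioo (-π) π,
    WA.va c q p = (ε / G.s * (G.χ.f q * (H.b (G.ph ε p) + H.r (G.ph ε p) * H.Y (G.X ε 0 q p, G.ph ε p))) : ℝ))
  (hr2 : ∀ p ∈ Icc (-1:ℝ) 0, ∀ q ∈ Ioo (-π) π, WA.va r2 q p = (ε ^ 2 / G.s * (G.χ.f q * H.r (G.ph ε p)) : ℝ))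
  (hc' : ∀ p ∈ Icc (-1:ℝ) 0, ∀ q ∈ Ioo (-π) π,
    WA.va c' q p = (ε * (G.χ.f q * (H.A + H.B * H.Y (G.X ε 0 q p, G.ph ε p))) : ℝ))

namespace WA
/-- values of the nonlinear expressions -/
theorem gval {xq xp yq yp : WA} {q p X Z u v s : ℝ} (h1 : va xq q p = X) (h2 : va xp q p = Z) (h3 : va yq q p = (u * X : ℝ))
    (h4 : va yp q p = (u * Z + s * v : ℝ)) (hX : 0 < X) (hs : 0 < s) (hv : 0 < v) (hU : IsUnit (gD xq xp yq yp)) :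
    va (gD xq xp yq yp) q p = (X * (s * v) : ℝ) ∧ va (gF xq xp yq yp) q p = ((1 + u ^ 2) / (s * v) * Z + u : ℝ) ∧
    va (gG xq xp yq yp) q p = ((1 + u ^ 2) / (s * v) * X : ℝ) ∧ va (gH xq xp yq yp) q p = ((1 + u ^ 2) / (s * v) ^ 2 : ℝ) := by
  have hD : va (gD xq xp yq yp) q p = (X * (s * v) : ℝ) := by
    simp only [gD, va_sub, va_mul, h1, h2, h3, h4]; push_cast; ring
  have e1 : (X : ℂ) ≠ 0 := by exact_mod_cast hX.ne'
  have e2 : (s : ℂ) ≠ 0 := by exact_mod_cast hs.ne'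
  have e3 : (v : ℂ) ≠ 0 := by exact_mod_cast hv.ne'
  refine ⟨hD, ?_, ?_, ?_⟩
  · simp only [gF, va_mul, va_add, va_inverse hU, hD, h1, h2, h3, h4]; push_cast; field_simp; ring
  · simp only [gG, va_mul, va_add, va_inverse hU, hD, h1, h2, h3, h4]; push_cast; field_simp
  · simp only [gH, va_mul, va_add, va_inverse hU, hD, h1, h2, h3, h4]; push_cast; field_simp

theorem gSval {sq : WA → WA} {xq yq m : WA} {q p X u m' : ℝ} (h1 : va xq q p = X) (h3 : va yq q p = (u * X : ℝ)) (hX : 0 < X)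
    (hm : va m q p = m') (hm' : 1 ≤ m')
    (hg : IsUnit (sq (xq * xq + yq * yq)) ∧ sq (xq * xq + yq * yq) * sq (xq * xq + yq * yq) = xq * xq + yq * yq ∧
      ‖sq (xq * xq + yq * yq) - m‖ < 1) :
    va (gS sq xq yq) q p = (u / √(1 + u ^ 2) : ℝ) := by
  obtain ⟨hU, h2, hn⟩ := hg
  set w := va (sq (xq * xq + yq * yq)) q p with hw
  have hw2 : w * w = ((X * √(1 + u ^ 2) : ℝ) : ℂ) * ((X * √(1 + u ^ 2) : ℝ) : ℂ) := by
    rw [hw, ← va_mul, h2, va_add, va_mul, va_mul, h1, h3, ← Complex.ofReal_mul, ← Complex.ofReal_mul, ← Complex.ofReal_mul, ← Complex.ofReal_add]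
    congr 1
    have := Real.mul_self_sqrt (show 0 ≤ 1 + u ^ 2 by positivity)
    linear_combination (-X ^ 2) * this
  have hre : 0 < w.re := by
    have h4 := (norm_va_le (sq (xq * xq + yq * yq) - m) q p).trans_lt hn
    rw [va_sub, hm, ← hw] at h4
    have h5 := (Complex.abs_re_le_norm _).trans_lt h4
    simp only [Complex.sub_re, Complex.ofReal_re] at h5
    linarith [(abs_lt.1 h5).1]
  have ht : 0 < X * √(1 + u ^ 2) := by positivity
  have : w = ((X * √(1 + u ^ 2) : ℝ) : ℂ) := by
    rcases mul_self_eq_mul_self_iff.1 hw2 with h | h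
    · exact h
    · rw [h] at hre; simp only [Complex.neg_re, Complex.ofReal_re] at hre; linarith
  simp only [gS, va_mul, va_inverse hU, ← hw, this, h3]
  have e1 : (X : ℂ) ≠ 0 := by exact_mod_cast hX.ne'
  have e2 : ((√(1 + u ^ 2) : ℝ) : ℂ) ≠ 0 := by
    have : 0 < √(1 + u ^ 2) := by positivity
    exact_mod_cast this.ne'
  push_cast; field_simp
end WA

namespace St
open WA
variable {μ pa pb : ℝ} (S : St μ pa pb)
def u (l q p : ℝ) : ℝ := S.H.Yx (S.G.X S.ε l q p, S.G.ph S.ε p)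
def v (l q p : ℝ) : ℝ := S.H.Yp (S.G.X S.ε l q p, S.G.ph S.ε p)
def y (l q p : ℝ) : ℝ := S.H.Y (S.G.X S.ε l q p, S.G.ph S.ε p)
def uxx (l q p : ℝ) : ℝ := S.H.Yxx (S.G.X S.ε l q p, S.G.ph S.ε p)
def uxp (l q p : ℝ) : ℝ := S.H.Yxp (S.G.X S.ε l q p, S.G.ph S.ε p)
def upp (l q p : ℝ) : ℝ := S.H.Ypp (S.G.X S.ε l q p, S.G.ph S.ε p)
theorem v_pos (l q : ℝ) {p : ℝ} (hp : p ∈ Icc (-1:ℝ) 0) : 0 < S.v l q p := S.H.pos _ _ (S.hph p hp)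

section derivs
variable (l q : ℝ) {p : ℝ} (hp : p ∈ Ioo (-1:ℝ) 0)
theorem uq (hp : p ∈ Ioo (-1:ℝ) 0) : HasDerivAt (fun q => S.u l q p) (S.uxx l q p * (S.ε * S.G.Xq l q p)) q := by
  refine (path (x := fun q => S.G.X S.ε l q p) (p := fun _ => S.G.ph S.ε p) (t := q) (S.H.dYx _ _ (S.hph' p hp)) (S.G.dX_q S.ε l q p) (hasDerivAt_const q _)).congr_deriv ?_
  simp [uxx]
theorem vq (hp : p ∈ Ioo (-1:ℝ) 0) : HasDerivAt (fun q => S.v l q p) (S.uxp l q p * (S.ε * S.G.Xq l q p)) q := by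
  refine (path (x := fun q => S.G.X S.ε l q p) (p := fun _ => S.G.ph S.ε p) (t := q) (S.H.dYp _ _ (S.hph' p hp)) (S.G.dX_q S.ε l q p) (hasDerivAt_const q _)).congr_deriv ?_
  simp [uxp]
theorem up (hp : p ∈ Ioo (-1:ℝ) 0) : HasDerivAt (fun p => S.u l q p)
    (S.uxx l q p * (S.ε * S.G.Xp l q p) + S.uxp l q p * (S.ε * S.G.s)) p :=
  path (S.H.dYx _ _ (S.hph' p hp)) (S.G.dX_p S.ε l q p) (S.G.dph S.ε p)
theorem vp (hp : p ∈ Ioo (-1:ℝ) 0) : HasDerivAt (fun p => S.v l q p)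
    (S.uxp l q p * (S.ε * S.G.Xp l q p) + S.upp l q p * (S.ε * S.G.s)) p :=
  path (S.H.dYp _ _ (S.hph' p hp)) (S.G.dX_p S.ε l q p) (S.G.dph S.ε p)
theorem yp (hp : p ∈ Ioo (-1:ℝ) 0) : HasDerivAt (fun p => S.y l q p)
    (S.ε * (S.u l q p * S.G.Xp l q p + S.G.s * S.v l q p)) p := by
  refine (path (S.H.dY _ _ (S.hph' p hp)) (S.G.dX_p S.ε l q p) (S.G.dph S.ε p)).congr_deriv ?_
  simp only [u, v]; ring

/-- common derivative ∂_p y_q = ∂_q y_p -/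
def An (l q p : ℝ) : ℝ := S.uxx l q p * S.ε * S.G.Xq l q p * S.G.Xp l q p + S.uxp l q p * (S.ε * S.G.s) * S.G.Xq l q p
  + S.u l q p * (l * S.G.xiqp q p)
theorem An_p (hp : p ∈ Ioo (-1:ℝ) 0) : HasDerivAt (fun p => S.u l q p * S.G.Xq l q p) (S.An l q p) p := by
  refine ((S.up l q hp).mul (S.G.dXq_p l q p)).congr_deriv ?_
  simp only [An]; ring
theorem An_q (hp : p ∈ Ioo (-1:ℝ) 0) :
    HasDerivAt (fun q => S.u l q p * S.G.Xp l q p + S.G.s * S.v l q p) (S.An l q p) q := by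
  refine (((S.uq l q hp).mul (S.G.dXp_q l q p)).add ((S.vq l q hp).const_mul _)).congr_deriv ?_
  simp only [An]; ring

def Gam (l q p : ℝ) : ℝ := (1 + S.u l q p ^ 2) / (S.G.s * S.v l q p)
/-- ∂_p of g11/D -/
def Bn (l q p : ℝ) : ℝ :=
  (2 * S.u l q p * (S.uxx l q p * (S.ε * S.G.Xp l q p) + S.uxp l q p * (S.ε * S.G.s)) / (S.G.s * S.v l q p)
    - (1 + S.u l q p ^ 2) * (S.uxp l q p * (S.ε * S.G.Xp l q p) + S.upp l q p * (S.ε * S.G.s)) / (S.G.s * S.v l q p ^ 2)) * S.G.Xq l q p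
  + S.Gam l q p * (l * S.G.xiqp q p)
theorem Bn_p (hp : p ∈ Ioo (-1:ℝ) 0) : HasDerivAt (fun p => S.Gam l q p * S.G.Xq l q p) (S.Bn l q p) p := by
  have hv := S.v_pos l q (Ioo_subset_Icc_self hp)
  have hs := S.G.hs
  refine (((((S.up l q hp).pow 2).const_add 1).div ((S.vp l q hp).const_mul S.G.s) (by positivity)).mul (S.G.dXq_p l q p)).congr_deriv ?_
  simp only [Bn, Gam, Pi.pow_apply, Pi.div_apply]
  field_simp
  ring
theorem Bn_q (hp : p ∈ Ioo (-1:ℝ) 0) : HasDerivAt (fun q => S.Gam l q p * S.G.Xp l q p + S.u l q p)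
    (S.Bn l q p + S.ε / S.G.s * (S.G.Xq l q p * (S.G.s * S.v l q p)) * (S.H.b (S.G.ph S.ε p) + S.H.r (S.G.ph S.ε p) * S.y l q p)) q := by
  have hv := S.v_pos l q (Ioo_subset_Icc_self hp)
  have hs := S.G.hs
  have he : S.uxx l q p - (2 * S.u l q p * S.uxp l q p / S.v l q p - (1 + S.u l q p ^ 2) * S.upp l q p / S.v l q p ^ 2) =
    S.v l q p * (S.H.b (S.G.ph S.ε p) + S.H.r (S.G.ph S.ε p) * S.y l q p) := S.H.heq _ _ (S.hph' p hp)
  refine ((((((S.uq l q hp).pow 2).const_add 1).div ((S.vq l q hp).const_mul S.G.s) (by positivity)).mul (S.G.dXp_q l q p)).add (S.uq l q hp)).congr_deriv ?_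
  have e2 : S.ε / S.G.s * (S.G.Xq l q p * (S.G.s * S.v l q p)) * (S.H.b (S.G.ph S.ε p) + S.H.r (S.G.ph S.ε p) * S.y l q p) =
    S.ε * S.G.Xq l q p * (S.v l q p * (S.H.b (S.G.ph S.ε p) + S.H.r (S.G.ph S.ε p) * S.y l q p)) := by field_simp
  rw [e2, ← he]
  simp only [Bn, Gam, Pi.pow_apply, Pi.div_apply]
  field_simp
  ring
end derivs

theorem cont_comp {f : ℝ × ℝ → ℝ} (hf : ContinuousOn f (univ ×ˢ Ioo pa pb)) (l : ℝ) :
    ContinuousOn (fun z : ℝ × ℝ => f (S.G.X S.ε l z.1 z.2, S.G.ph S.ε z.2)) (univ ×ˢ Ioo (-1) 0) :=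
  hf.comp (f := fun z : ℝ × ℝ => (S.G.X S.ε l z.1 z.2, S.G.ph S.ε z.2))
    ((S.G.cX S.ε l).prodMk ((S.G.cph S.ε).comp continuous_snd)).continuousOn (fun z hz => ⟨trivial, S.hph' _ hz.2⟩)

theorem cont_An (l : ℝ) : ContinuousOn (fun z : ℝ × ℝ => S.An l z.1 z.2) (univ ×ˢ Ioo (-1) 0) := by
  have h1 := S.cont_comp S.H.cYxx l
  have h2 := S.cont_comp S.H.cYxp l
  have h3 := S.cont_comp (S.H.cYx.mono (prod_mono subset_rfl Ioo_subset_Icc_self)) l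
  have h4 := (S.G.cXq l).continuousOn (s := univ ×ˢ Ioo (-1:ℝ) 0)
  have h5 := (S.G.cXp l).continuousOn (s := univ ×ˢ Ioo (-1:ℝ) 0)
  have h6 := (S.G.cxiqp).continuousOn (s := univ ×ˢ Ioo (-1:ℝ) 0)
  exact ((((h1.mul continuousOn_const).mul h4).mul h5).add ((h2.mul continuousOn_const).mul h4)).add (h3.mul (continuousOn_const.mul h6))

theorem cont_Bn (l : ℝ) : ContinuousOn (fun z : ℝ × ℝ => S.Bn l z.1 z.2) (univ ×ˢ Ioo (-1) 0) := by
  have h1 := S.cont_comp S.H.cYxx l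
  have h2 := S.cont_comp S.H.cYxp l
  have h2' := S.cont_comp S.H.cYpp l
  have h3 := S.cont_comp (S.H.cYx.mono (prod_mono subset_rfl Ioo_subset_Icc_self)) l
  have h3' := S.cont_comp (S.H.cYp.mono (prod_mono subset_rfl Ioo_subset_Icc_self)) l
  have h4 := (S.G.cXq l).continuousOn (s := univ ×ˢ Ioo (-1:ℝ) 0)
  have h5 := (S.G.cXp l).continuousOn (s := univ ×ˢ Ioo (-1:ℝ) 0)
  have h6 := (S.G.cxiqp).continuousOn (s := univ ×ˢ Ioo (-1:ℝ) 0)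
  have hs := S.G.hs
  have n1 : ∀ z ∈ (univ : Set ℝ) ×ˢ Ioo (-1:ℝ) 0, S.G.s * S.v l z.1 z.2 ≠ 0 := fun z hz => by
    have := S.v_pos l z.1 (Ioo_subset_Icc_self hz.2); positivity
  have n2 : ∀ z ∈ (univ : Set ℝ) ×ˢ Ioo (-1:ℝ) 0, S.G.s * S.v l z.1 z.2 ^ 2 ≠ 0 := fun z hz => by
    have := S.v_pos l z.1 (Ioo_subset_Icc_self hz.2); positivity
  have a1 := (h1.mul ((continuousOn_const (c := S.ε)).mul h5)).add (h2.mul (continuousOn_const (c := S.ε * S.G.s)))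
  have a2 := (h2.mul ((continuousOn_const (c := S.ε)).mul h5)).add (h2'.mul (continuousOn_const (c := S.ε * S.G.s)))
  have a3 := (continuousOn_const (c := (1:ℝ))).add (h3.pow 2)
  exact (((((continuousOn_const (c := (2:ℝ))).mul h3).mul a1).div (continuousOn_const.mul h3') n1 |>.sub
    ((a3.mul a2).div (continuousOn_const.mul (h3'.pow 2)) n2)).mul h4).add
    ((a3.div (continuousOn_const.mul h3') n1).mul (continuousOn_const.mul h6))
end St
end partW8

section partW9
open scoped Topology ContDiff
open Real

namespace WA
def Tcl (ϖ : ℝ) : WA × WA × WA →L[ℝ] WA × WA :=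
  let F := ContinuousLinearMap.fst ℝ WA (WA × WA)
  let G := (ContinuousLinearMap.fst ℝ WA WA).comp (ContinuousLinearMap.snd ℝ WA (WA × WA))
  let φ := (ContinuousLinearMap.snd ℝ WA WA).comp (ContinuousLinearMap.snd ℝ WA (WA × WA))
  let q := Pois.comp (ϖ • φ) + Hil.comp (Bp.comp (Tu.comp (F.prod G) + G))
  q.prod (G + Tu.comp (F.prod G) - Hil.comp q)
theorem Tcl_apply (ϖ : ℝ) (F G φ : WA) : Tcl ϖ (F, G, φ) = (Tq F G (ϖ • φ), Tp F G (ϖ • φ)) := rfl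

theorem va_sq_eq {s1 s2 X1 X2 m : WA} {q p m' : ℝ} (h1 : s1 * s1 = X1) (h2 : s2 * s2 = X2) (hX : va X1 q p = va X2 q p)
    (hm : va m q p = m') (hm' : 1 ≤ m') (n1 : ‖s1 - m‖ < 1) (n2 : ‖s2 - m‖ < 1) : va s1 q p = va s2 q p := by
  have hre : ∀ s : WA, ‖s - m‖ < 1 → 0 < (va s q p).re := by
    intro s hs
    have h4 := (norm_va_le (s - m) q p).trans_lt hs
    rw [va_sub, hm] at h4
    have h5 := (Complex.abs_re_le_norm _).trans_lt h4
    simp only [Complex.sub_re, Complex.ofReal_re] at h5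
    linarith [(abs_lt.1 h5).1]
  have : va s1 q p * va s1 q p = va s2 q p * va s2 q p := by rw [← va_mul, ← va_mul, h1, h2, hX]
  rcases mul_self_eq_mul_self_iff.1 this with h | h
  · exact h
  · have a1 := hre s1 n1
    have a2 := hre s2 n2
    rw [h, Complex.neg_re] at a1; linarith
end WA

def HD.dat (a : ℝ) (ϖ : ℝ) (Eq Ep : WA) : PsiData WA :=
  { a := a • 1, m := √(1 + a ^ 2) • 1, ξq := Eq, ξp := Ep, P := WA.prim, N := WA.Pr0, J := WA.Jop, T := WA.Tcl ϖ }

namespace St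
open WA
variable {μ pa pb : ℝ} (S : St μ pa pb)
def dat : PsiData WA := HD.dat S.G.a S.ϖ S.Eq S.Ep
def e : Fin 7 → WA := ![S.E1 0, (-S.G.a) • S.E1 0 + S.G.s • S.E2 0, S.c, S.r2, (S.ε * S.G.s ^ 2 * S.H.κ) • 1, S.c', (S.ε ^ 2 * S.H.B) • 1]
def Vq (l : ℝ) : WA := S.E1 l - S.E1 0 + l • (S.Eq * (S.G.a • 1 + S.E1 l))
def Vp (l : ℝ) : WA := (-S.G.a) • (S.E1 l - S.E1 0) + l • (S.Ep * (S.G.a • 1 + S.E1 l)) + S.G.s • (S.E2 l - S.E2 0)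
def z (l : ℝ) : PZ WA := ((l, S.e), (S.Vq l, S.Vp l))
@[simp] theorem e0 : S.e 0 = S.E1 0 := rfl
@[simp] theorem e1 : S.e 1 = (-S.G.a) • S.E1 0 + S.G.s • S.E2 0 := rfl
@[simp] theorem e2 : S.e 2 = S.c := rfl
@[simp] theorem e3 : S.e 3 = S.r2 := rfl
@[simp] theorem e4 : S.e 4 = (S.ε * S.G.s ^ 2 * S.H.κ) • 1 := rfl
@[simp] theorem e5 : S.e 5 = S.c' := rfl
@[simp] theorem e6 : S.e 6 = (S.ε ^ 2 * S.H.B) • 1 := rfl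

/-- abbreviations for the four metric entries -/
def xq (l : ℝ) : WA := S.dat.xq (S.z l)
def xp (l : ℝ) : WA := S.dat.xp (S.z l)
def yq (l : ℝ) : WA := S.dat.yq (S.z l)
def yp' (l : ℝ) : WA := PsiData.yp (S.z l)
def yq0 : WA := S.dat.a + S.E1 0
def yp0 : WA := 1 + S.e 1

section vals
variable {l q p : ℝ}
theorem va_xq (hp : p ∈ Icc (-1:ℝ) 0) (hq : q ∈ Ioo (-π) π) : va (S.xq l) q p = (S.G.Xq l q p : ℝ) := by
  simp only [xq, PsiData.xq, dat, HD.dat, z, va_add, va_one, va_smul, S.hEq p hp q hq, Geo.Xq]; push_cast; ring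
theorem va_xp (hp : p ∈ Icc (-1:ℝ) 0) (hq : q ∈ Ioo (-π) π) : va (S.xp l) q p = (S.G.Xp l q p : ℝ) := by
  simp only [xp, PsiData.xp, dat, HD.dat, z, va_add, va_neg, va_one, va_smul, S.hEp p hp q hq, Geo.Xp]; push_cast; ring
theorem pi3 (hq : q ∈ Ioo (-3/2:ℝ) (3/2)) : q ∈ Ioo (-π) π := by
  have := pi_gt_three; exact ⟨by linarith [hq.1], by linarith [hq.2]⟩
theorem chi1 (hq : q ∈ Ioo (-3/2:ℝ) (3/2)) : S.G.χ.f q = 1 := S.G.hχ1 q (abs_le.2 ⟨by linarith [hq.1], hq.2.le⟩)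
theorem va_Vq (hl : |l| ≤ 1) (hp : p ∈ Icc (-1:ℝ) 0) (hq : q ∈ Ioo (-3/2:ℝ) (3/2)) :
    va (S.Vq l) q p = (S.u l q p * S.G.Xq l q p - S.u 0 q p : ℝ) := by
  simp only [Vq, va_add, va_sub, va_smul, va_mul, va_one, S.hEq p hp q (pi3 hq), S.hE1 l hl p hp q (pi3 hq), S.hE1 0 (by simp) p hp q (pi3 hq),
    S.chi1 hq, Geo.Xq, u]; push_cast; ring
theorem va_Vp (hl : |l| ≤ 1) (hp : p ∈ Icc (-1:ℝ) 0) (hq : q ∈ Ioo (-3/2:ℝ) (3/2)) :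
    va (S.Vp l) q p = (S.u l q p * S.G.Xp l q p + S.G.s * S.v l q p - (-S.G.a * S.u 0 q p + S.G.s * S.v 0 q p) : ℝ) := by
  simp only [Vp, va_add, va_sub, va_smul, va_mul, va_one, S.hEp p hp q (pi3 hq), S.hE1 l hl p hp q (pi3 hq), S.hE1 0 (by simp) p hp q (pi3 hq),
    S.hE2 l hl p hp q (pi3 hq), S.hE2 0 (by simp) p hp q (pi3 hq), S.chi1 hq, Geo.Xp, u, v]; push_cast; ring
theorem va_yq0 (hp : p ∈ Icc (-1:ℝ) 0) (hq : q ∈ Ioo (-3/2:ℝ) (3/2)) : va S.yq0 q p = (S.u 0 q p * 1 : ℝ) := by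
  simp only [yq0, dat, HD.dat, va_add, va_smul, va_one, S.hE1 0 (by simp) p hp q (pi3 hq), S.chi1 hq, u]; push_cast; ring
theorem va_yp0 (hp : p ∈ Icc (-1:ℝ) 0) (hq : q ∈ Ioo (-3/2:ℝ) (3/2)) : va S.yp0 q p = (S.u 0 q p * (-S.G.a) + S.G.s * S.v 0 q p : ℝ) := by
  have h : (S.G.s * S.H.Yp (S.G.xs, S.G.ps) : ℂ) = 1 + S.G.a ^ 2 := by exact_mod_cast S.hsa
  simp only [yp0, e1, va_add, va_smul, va_one, S.hE1 0 (by simp) p hp q (pi3 hq), S.hE2 0 (by simp) p hp q (pi3 hq), S.chi1 hq, u, v]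
  push_cast; linear_combination -h
theorem yq_eq : S.yq l = S.yq0 + S.Vq l := rfl
theorem yp_eq : S.yp' l = S.yp0 + S.Vp l := rfl
theorem va_yq (hl : |l| ≤ 1) (hp : p ∈ Icc (-1:ℝ) 0) (hq : q ∈ Ioo (-3/2:ℝ) (3/2)) :
    va (S.yq l) q p = (S.u l q p * S.G.Xq l q p : ℝ) := by
  rw [yq_eq, va_add, S.va_yq0 hp hq, S.va_Vq hl hp hq]; push_cast; ring
theorem va_yp (hl : |l| ≤ 1) (hp : p ∈ Icc (-1:ℝ) 0) (hq : q ∈ Ioo (-3/2:ℝ) (3/2)) :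
    va (S.yp' l) q p = (S.u l q p * S.G.Xp l q p + S.G.s * S.v l q p : ℝ) := by
  rw [yp_eq, va_add, S.va_yp0 hp hq, S.va_Vp hl hp hq]; push_cast; ring

/-- where ξ vanishes -/
def Out (q p : ℝ) : Prop := S.G.xi q p = 0 ∧ S.G.xiq q p = 0 ∧ S.G.xip q p = 0
variable {S}
theorem Out.V (ho : S.Out q p) (hl : |l| ≤ 1) (hp : p ∈ Icc (-1:ℝ) 0) (hq : q ∈ Ioo (-π) π) :
    va (S.Vq l) q p = 0 ∧ va (S.Vp l) q p = 0 ∧ va (S.xq l) q p = 1 ∧ va (S.xp l) q p = va (-S.dat.a) q p := by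
  obtain ⟨h1, h2, h3⟩ := ho
  have hX : S.G.X S.ε l q p = S.G.X S.ε 0 q p := by simp [Geo.X, h1]
  refine ⟨?_, ?_, ?_, ?_⟩
  · simp only [Vq, va_add, va_sub, va_smul, va_mul, S.hEq p hp q hq, S.hE1 l hl p hp q hq, S.hE1 0 (by simp) p hp q hq, hX, h2]; simp
  · simp only [Vp, va_add, va_sub, va_smul, va_mul, S.hEp p hp q hq, S.hE1 l hl p hp q hq, S.hE1 0 (by simp) p hp q hq,
      S.hE2 l hl p hp q hq, S.hE2 0 (by simp) p hp q hq, hX, h3]; simp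
  · rw [S.va_xq hp hq, Geo.Xq, h2]; simp
  · rw [S.va_xp hp hq, Geo.Xp, h3]; simp [dat, HD.dat]
theorem Out.D (ho : S.Out q p) (hl : |l| ≤ 1) (hp : p ∈ Icc (-1:ℝ) 0) (hq : q ∈ Ioo (-π) π) :
    va (gD (S.xq l) (S.xp l) (S.yq l) (S.yp' l)) q p = va (gD 1 (-S.dat.a) S.yq0 S.yp0) q p := by
  obtain ⟨h1, h2, h3, h4⟩ := ho.V hl hp hq
  simp only [gD, yq_eq, yp_eq, va_sub, va_mul, va_add, h1, h2, h3, h4, va_one, add_zero]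
theorem Out.FGH (ho : S.Out q p) (hl : |l| ≤ 1) (hp : p ∈ Icc (-1:ℝ) 0) (hq : q ∈ Ioo (-π) π)
    (hU : IsUnit (gD (S.xq l) (S.xp l) (S.yq l) (S.yp' l))) (hU0 : IsUnit (gD 1 (-S.dat.a) S.yq0 S.yp0)) :
    va (gF (S.xq l) (S.xp l) (S.yq l) (S.yp' l)) q p = va (gF 1 (-S.dat.a) S.yq0 S.yp0) q p ∧
    va (gG (S.xq l) (S.xp l) (S.yq l) (S.yp' l)) q p = va (gG 1 (-S.dat.a) S.yq0 S.yp0) q p ∧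
    va (gH (S.xq l) (S.xp l) (S.yq l) (S.yp' l)) q p = va (gH 1 (-S.dat.a) S.yq0 S.yp0) q p := by
  obtain ⟨h1, h2, h3, h4⟩ := ho.V hl hp hq
  have hD := ho.D hl hp hq
  simp only [gF, gG, gH, va_mul, va_add, va_inverse hU, va_inverse hU0, hD, h3, h4]
  simp only [yq_eq, yp_eq, va_add, h1, h2, va_one, add_zero, and_self]
theorem Out.Sg {sq : WA → WA} (ho : S.Out q p) (hl : |l| ≤ 1) (hp : p ∈ Icc (-1:ℝ) 0) (hq : q ∈ Ioo (-π) π)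
    (hg : IsUnit (sq (S.xq l * S.xq l + S.yq l * S.yq l)) ∧ sq (S.xq l * S.xq l + S.yq l * S.yq l) * sq (S.xq l * S.xq l + S.yq l * S.yq l)
      = S.xq l * S.xq l + S.yq l * S.yq l ∧ ‖sq (S.xq l * S.xq l + S.yq l * S.yq l) - S.dat.m‖ < 1)
    (hg0 : IsUnit (sq (1 * 1 + S.yq0 * S.yq0)) ∧ sq (1 * 1 + S.yq0 * S.yq0) * sq (1 * 1 + S.yq0 * S.yq0)
      = 1 * 1 + S.yq0 * S.yq0 ∧ ‖sq (1 * 1 + S.yq0 * S.yq0) - S.dat.m‖ < 1) :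
    va (gS sq (S.xq l) (S.yq l)) q p = va (gS sq 1 S.yq0) q p := by
  obtain ⟨h1, h2, h3, h4⟩ := ho.V hl hp hq
  have hy : va (S.yq l) q p = va S.yq0 q p := by rw [yq_eq, va_add, h1, add_zero]
  have := va_sq_eq (m' := √(1 + S.G.a ^ 2)) (q := q) (p := p) hg.2.1 hg0.2.1 (by simp [h3, hy]) (by simp [dat, HD.dat])
    (Real.one_le_sqrt.2 (by nlinarith [sq_nonneg S.G.a])) hg.2.2 hg0.2.2
  simp only [gS, va_mul, va_inverse hg.1, va_inverse hg0.1, this, hy]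
variable (S)
theorem out_q (hq : 1 ≤ |q|) : S.Out q p := S.G.out_q hq p
theorem out_m : S.Out q (-1) := S.G.out_p (by rcases S.G.hpc with h | h <;> rw [h] <;> norm_num [abs_of_neg, abs_of_nonneg]) q

theorem va_w (hl : |l| ≤ 1) (hp : p ∈ Icc (-1:ℝ) 0) (hq : q ∈ Ioo (-3/2:ℝ) (3/2)) :
    va (prim (S.Vp l)) q p = ((S.y l q p - S.y 0 q p) / S.ε : ℝ) := by
  have hε := S.hε
  rw [va_prim _ _ _ hp]
  have hc : ∀ l, ContinuousOn (fun t => S.y l q t) (Icc (-1) 0) := fun l =>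
    S.H.cY.comp (f := fun t => (S.G.X S.ε l q t, S.G.ph S.ε t))
      ((((S.G.cX S.ε l).comp (Continuous.prodMk_right q)).prodMk (S.G.cph S.ε)).continuousOn) (fun t ht => ⟨trivial, S.hph _ ht⟩)
  have h1 := intervalIntegral.integral_eq_sub_of_hasDerivAt_of_le hp.1 (f := fun t => (((S.y l q t - S.y 0 q t) / S.ε : ℝ) : ℂ))
    (f' := fun t => va (S.Vp l) q t) ?_ ?_ ((va_cont2 _ _).intervalIntegrable _ _)
  · rw [h1]
    have : S.y l q (-1) = S.y 0 q (-1) := by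
      have := (S.out_m (q := q)).1; simp [y, Geo.X, this]
    rw [this]; simp
  · refine Complex.continuous_ofReal.comp_continuousOn ?_
    exact (((hc l).sub (hc 0)).div_const _).mono (Icc_subset_Icc le_rfl hp.2)
  · intro t ht
    have ht' : t ∈ Ioo (-1:ℝ) 0 := ⟨ht.1, ht.2.trans_le hp.2⟩
    refine ((((S.yp l q ht').sub (S.yp 0 q ht')).div_const S.ε).ofReal_comp).congr_deriv ?_
    rw [S.va_Vp hl (Ioo_subset_Icc_self ht') hq]
    congr 1
    simp only [Geo.Xp]; field_simp; ring
theorem va_w0 (hl : |l| ≤ 1) (hp : p ∈ Icc (-1:ℝ) 0) (hq : q ∈ Ioo (-π) π) (hq' : 1 ≤ |q|) : va (prim (S.Vp l)) q p = 0 := by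
  rw [va_prim _ _ _ hp, intervalIntegral.integral_congr (g := fun _ => 0)]
  · simp
  · intro t ht
    rw [uIcc_of_le hp.1] at ht
    exact ((S.out_q hq').V hl ⟨ht.1, ht.2.trans hp.2⟩ hq).2.1
end vals
end St
end partW9

section partW10
open scoped Topology ContDiff
open Real

namespace St
open WA
variable {μ pa pb : ℝ} (S : St μ pa pb)
section fix
variable {l : ℝ}
theorem ioo_ev {q : ℝ} (hq : q ∈ Ioo (-3/2:ℝ) (3/2)) {f g : ℝ → ℂ} (h : ∀ q ∈ Ioo (-3/2:ℝ) (3/2), f q = g q) : f =ᶠ[𝓝 q] g := by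
  filter_upwards [isOpen_Ioo.mem_nhds hq] with t ht using h t ht
theorem ioo_ev' {p : ℝ} (hp : p ∈ Ioo (-1:ℝ) 0) {f g : ℝ → ℂ} (h : ∀ p ∈ Icc (-1:ℝ) 0, f p = g p) : f =ᶠ[𝓝 p] g := by
  filter_upwards [isOpen_Ioo.mem_nhds hp] with t ht using h t (Ioo_subset_Icc_self ht)

theorem Xq0 (q p : ℝ) : S.G.Xq 0 q p = 1 := by simp [Geo.Xq]
theorem Xp0 (q p : ℝ) : S.G.Xp 0 q p = -S.G.a := by simp [Geo.Xp]

def DD (l : ℝ) : WA := gD (S.xq l) (S.xp l) (S.yq l) (S.yp' l)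
def DD0 : WA := gD 1 (-S.dat.a) S.yq0 S.yp0
def MM : WA := 1 + S.dat.a * S.dat.a
theorem va_MM (q p : ℝ) : va S.MM q p = (1 + S.G.a ^ 2 : ℝ) := by
  simp [MM, dat, HD.dat]; ring
def m3 : WA := S.dat.m * S.dat.m * S.dat.m
theorem va_m (q p : ℝ) : va S.dat.m q p = (√(1 + S.G.a ^ 2) : ℝ) := by simp [dat, HD.dat]
theorem va_m3 (q p : ℝ) : va S.m3 q p = (√(1 + S.G.a ^ 2) ^ 3 : ℝ) := by
  simp only [m3, va_mul, va_m]; push_cast; ring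

theorem vals (hl : |l| ≤ 1) (hX : ∀ q p, 0 < S.G.Xq l q p) (hU : IsUnit (S.DD l)) {q p : ℝ} (hp : p ∈ Icc (-1:ℝ) 0)
    (hq : q ∈ Ioo (-3/2:ℝ) (3/2)) :
    va (S.DD l) q p = (S.G.Xq l q p * (S.G.s * S.v l q p) : ℝ) ∧
    va (gF (S.xq l) (S.xp l) (S.yq l) (S.yp' l)) q p = (S.Gam l q p * S.G.Xp l q p + S.u l q p : ℝ) ∧
    va (gG (S.xq l) (S.xp l) (S.yq l) (S.yp' l)) q p = (S.Gam l q p * S.G.Xq l q p : ℝ) ∧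
    va (gH (S.xq l) (S.xp l) (S.yq l) (S.yp' l)) q p = ((1 + S.u l q p ^ 2) / (S.G.s * S.v l q p) ^ 2 : ℝ) :=
  gval (S.va_xq hp (pi3 hq)) (S.va_xp hp (pi3 hq)) (S.va_yq hl hp hq) (S.va_yp hl hp hq) (hX q p) S.G.hs (S.v_pos l q hp) hU
theorem vals0 (hU : IsUnit S.DD0) {q p : ℝ} (hp : p ∈ Icc (-1:ℝ) 0)
    (hq : q ∈ Ioo (-3/2:ℝ) (3/2)) :
    va S.DD0 q p = (1 * (S.G.s * S.v 0 q p) : ℝ) ∧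
    va (gF 1 (-S.dat.a) S.yq0 S.yp0) q p = (S.Gam 0 q p * (-S.G.a) + S.u 0 q p : ℝ) ∧
    va (gG 1 (-S.dat.a) S.yq0 S.yp0) q p = (S.Gam 0 q p * 1 : ℝ) ∧
    va (gH 1 (-S.dat.a) S.yq0 S.yp0) q p = ((1 + S.u 0 q p ^ 2) / (S.G.s * S.v 0 q p) ^ 2 : ℝ) :=
  gval (by simp) (by simp [dat, HD.dat]) (S.va_yq0 hp hq) (S.va_yp0 hp hq) one_pos S.G.hs (S.v_pos 0 q hp) hU

def bb (l : ℝ) : WA := (-S.dat.a) * S.Vq l + S.MM * (gG (S.xq l) (S.xp l) (S.yq l) (S.yp' l) - gG 1 (-S.dat.a) S.yq0 S.yp0)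
def aa (l : ℝ) : WA := (-S.dat.a) * S.Vp l + S.MM * (gF (S.xq l) (S.xp l) (S.yq l) (S.yp' l) - gF 1 (-S.dat.a) S.yq0 S.yp0)
def cc (l : ℝ) : WA := S.MM * (S.DD l * (S.c + S.r2 * prim (S.Vp l)) - S.DD0 * S.c)

theorem dVq (hl : |l| ≤ 1) {q p : ℝ} (hp : p ∈ Ioo (-1:ℝ) 0) (hq : q ∈ Ioo (-3/2:ℝ) (3/2)) :
    HasDerivAt (fun p => va (S.Vq l) q p) ((S.An l q p - S.An 0 q p : ℝ) : ℂ) p := by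
  have h := ((S.An_p l q hp).sub (S.An_p 0 q hp)).ofReal_comp
  refine h.congr_of_eventuallyEq (ioo_ev' hp fun t ht => ?_)
  rw [S.va_Vq hl ht hq]; simp [Xq0]
theorem dVp (hl : |l| ≤ 1) {q p : ℝ} (hp : p ∈ Ioo (-1:ℝ) 0) (hq : q ∈ Ioo (-3/2:ℝ) (3/2)) :
    HasDerivAt (fun q => va (S.Vp l) q p) ((S.An l q p - S.An 0 q p : ℝ) : ℂ) q := by
  have h := ((S.An_q l q hp).sub (S.An_q 0 q hp)).ofReal_comp
  refine h.congr_of_eventuallyEq (ioo_ev hq fun t ht => ?_)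
  rw [S.va_Vp hl (Ioo_subset_Icc_self hp) ht]; simp [Xp0]; ring

theorem fix1 (hl : |l| ≤ 1) (k : ℤ) (p : ℝ) (hp : p ∈ Ioo (-1:ℝ) 0) :
    HasDerivAt (ex ((S.Vq l).co k)) (Complex.I * k * ex ((S.Vp l).co k) p) p := by
  have h := lemC (a := S.Vp l) (b := S.Vq l) (c := 0) (B := fun q p => ((S.An l q p - S.An 0 q p : ℝ) : ℂ))
    (fun p hp q hq h1 => ((S.out_q h1).V hl hp hq).2.1) (fun p hp q hq h1 => ((S.out_q h1).V hl hp hq).1) (fun p hp q hq h1 => by simp)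
    (Complex.continuous_ofReal.comp_continuousOn (((S.cont_An l).sub (S.cont_An 0)).mono (prod_mono (subset_univ _) subset_rfl)))
    (fun p hp q hq => S.dVq hl hp hq) (fun p hp q hq => by rw [va_zero, add_zero]; exact S.dVp hl hp hq) k p hp
  have e : ex ((0 : WA).co k) p = 0 := rfl
  rw [e, sub_zero] at h; exact h

theorem fix2 (hl : |l| ≤ 1) (hX : ∀ q p, 0 < S.G.Xq l q p) (hU : IsUnit (S.DD l)) (hU0 : IsUnit S.DD0) (k : ℤ) (p : ℝ) (hp : p ∈ Ioo (-1:ℝ) 0) :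
    HasDerivAt (ex ((S.bb l).co k)) (Complex.I * k * ex ((S.aa l).co k) p - ex ((S.cc l).co k) p) p := by
  have va_a : ∀ q p, va (-S.dat.a) q p = ((-S.G.a : ℝ) : ℂ) := by intro q p; simp [dat, HD.dat]
  have o : ∀ p ∈ Icc (-1:ℝ) 0, ∀ q ∈ Ioo (-π) π, 1 ≤ |q| → va (S.aa l) q p = 0 ∧ va (S.bb l) q p = 0 ∧ va (S.cc l) q p = 0 := by
    intro p hp q hq h1
    have ho : S.Out q p := S.out_q h1
    obtain ⟨h2, h3, h4⟩ := ho.FGH hl hp hq hU hU0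
    have h5 : va (S.DD l) q p = va S.DD0 q p := ho.D hl hp hq
    obtain ⟨h6, h7, -, -⟩ := ho.V hl hp hq
    simp only [aa, bb, cc, va_add, va_sub, va_mul, h2, h3, h5, h6, h7, S.va_w0 hl hp hq h1]
    simp
  refine lemC (B := fun q p => ((-S.G.a * (S.An l q p - S.An 0 q p) + (1 + S.G.a ^ 2) * (S.Bn l q p - S.Bn 0 q p) : ℝ) : ℂ))
    (fun p hp q hq h1 => (o p hp q hq h1).1) (fun p hp q hq h1 => (o p hp q hq h1).2.1) (fun p hp q hq h1 => (o p hp q hq h1).2.2)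
    ?_ ?_ ?_ k p hp
  · refine Complex.continuous_ofReal.comp_continuousOn (ContinuousOn.mono ?_ (prod_mono (subset_univ _) subset_rfl))
    exact (continuousOn_const.mul ((S.cont_An l).sub (S.cont_An 0))).add (continuousOn_const.mul ((S.cont_Bn l).sub (S.cont_Bn 0)))
  · intro p hp q hq
    have h := (S.dVq hl hp hq).const_mul ((-S.G.a : ℝ) : ℂ) |>.add
      ((((S.Bn_p l q hp).sub (S.Bn_p 0 q hp)).ofReal_comp).const_mul ((1 + S.G.a ^ 2 : ℝ) : ℂ))
    refine (h.congr_of_eventuallyEq (ioo_ev' hp fun t ht => ?_)).congr_deriv ?_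
    · obtain ⟨-, -, h3, -⟩ := S.vals hl hX hU ht hq
      obtain ⟨-, -, h3', -⟩ := S.vals0 hU0 ht hq
      simp only [bb, va_add, va_mul, va_sub, va_MM, h3, h3', va_a, Pi.add_apply, Pi.sub_apply, Xq0]
      push_cast; ring
    · push_cast; ring
  · intro p hp q hq
    have h := (S.dVp hl hp hq).const_mul ((-S.G.a : ℝ) : ℂ) |>.add
      ((((S.Bn_q l q hp).sub (S.Bn_q 0 q hp)).ofReal_comp).const_mul ((1 + S.G.a ^ 2 : ℝ) : ℂ))
    refine (h.congr_of_eventuallyEq (ioo_ev hq fun t ht => ?_)).congr_deriv ?_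
    · obtain ⟨-, h3, -, -⟩ := S.vals hl hX hU (Ioo_subset_Icc_self hp) ht
      obtain ⟨-, h3', -, -⟩ := S.vals0 hU0 (Ioo_subset_Icc_self hp) ht
      simp only [aa, va_add, va_mul, va_sub, va_MM, h3, h3', va_a, Pi.add_apply, Pi.sub_apply, Xp0]
      push_cast; ring
    · have hp' := Ioo_subset_Icc_self hp
      obtain ⟨h3, -, -, -⟩ := S.vals hl hX hU hp' hq
      obtain ⟨h3', -, -, -⟩ := S.vals0 hU0 hp' hq
      have hε : (S.ε : ℂ) ≠ 0 := by exact_mod_cast S.hε.ne'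
      have hs : (S.G.s : ℂ) ≠ 0 := by exact_mod_cast S.G.hs.ne'
      simp only [cc, va_add, va_mul, va_sub, va_MM, h3, h3', S.hc p hp' q (pi3 hq), S.hr2 p hp' q (pi3 hq), S.va_w hl hp' hq, S.chi1 hq, Xq0, y]
      push_cast
      field_simp
      ring

theorem fix5 (hϖ : S.ϖ = 1 ∧ S.G.pc = 0 ∧ S.G.ps = pb ∧ S.H.Top) (sq : WA → WA) (hl : |l| ≤ 1) (hX : ∀ q p, 0 < S.G.Xq l q p)
    (hG : S.dat.Good sq (S.z l)) (k : ℤ) :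
    ex ((S.Vq l).co k) 0 = ex ((Pr0 (S.dat.NB sq (S.z l)) + Jop (S.dat.NC (S.z l))).co k) 0 := by
  obtain ⟨-, hpc, hps, ht1, ht2⟩ := hϖ
  have hph0 : S.G.ph S.ε 0 = pb := by simp [Geo.ph, hpc, hps]
  have h0 : (0:ℝ) ∈ Icc (-1:ℝ) 0 := by simp
  obtain ⟨hU, hU0, hS⟩ := hG
  have hU : IsUnit (S.DD l) := hU
  have hU0 : IsUnit S.DD0 := hU0
  have hS1 := hS _ (Or.inl rfl)
  have hS2 := hS _ (Or.inr rfl)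
  have hε : (S.ε : ℂ) ≠ 0 := by exact_mod_cast S.hε.ne'
  have hεr := S.hε.ne'
  have hs : (S.G.s : ℂ) ≠ 0 := by exact_mod_cast S.G.hs.ne'
  have hy : ∀ l q, HasDerivAt (fun q => S.y l q 0) (S.u l q 0 * (S.ε * S.G.Xq l q 0)) q := by
    intro l q
    have h1 := (ht1 (S.G.X S.ε l q 0)).comp q (S.G.dX_q S.ε l q 0)
    simpa only [y, u, hph0, Function.comp_def] using h1
  have hu : ∀ l q, HasDerivAt (fun q => S.u l q 0 / √(1 + S.u l q 0 ^ 2)) ((S.H.κ * ((1 + S.u l q 0 ^ 2) / S.v l q 0 ^ 2) + S.H.A + S.H.B * S.y l q 0) * (S.ε * S.G.Xq l q 0)) q := by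
    intro l q
    have h1 := (ht2 (S.G.X S.ε l q 0)).comp q (S.G.dX_q S.ε l q 0)
    simpa only [y, u, v, hph0, Function.comp_def] using h1
  have hone : 1 ≤ √(1 + S.G.a ^ 2) := Real.one_le_sqrt.2 (by nlinarith [sq_nonneg S.G.a])
  set b : WA := S.m3 * (gS sq (S.xq l) (S.yq l) - gS sq 1 S.yq0) with hb
  have hNB : S.dat.NB sq (S.z l) = S.Vq l - b := rfl
  rcases eq_or_ne k 0 with rfl | hk
  · have h1 := lemB (b := prim (S.Vp l)) (c := S.Vq l) (p := 0) (fun q hq h1 => S.va_w0 hl h0 hq h1)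
      (fun q hq h1 => ((S.out_q h1).V hl h0 hq).1) (fun q hq => by
        refine (((((hy l q).sub (hy 0 q)).div_const S.ε).ofReal_comp).congr_of_eventuallyEq (ioo_ev hq fun t ht => S.va_w hl h0 ht)).congr_deriv ?_
        rw [S.va_Vq hl h0 hq, Xq0]; congr 1; field_simp) 0
    rw [h1]
    simp [Pr0, Jop, mulL]
  · have hNC : S.dat.NC (S.z l) = S.m3 * (S.xq l * (S.e 4 * gH (S.xq l) (S.xp l) (S.yq l) (S.yp' l) + S.e 5 + S.e 6 * prim (S.Vp l))
      - (S.e 4 * gH 1 (-S.dat.a) S.yq0 S.yp0 + S.e 5)) := rfl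
    have h1 := lemB (b := b) (c := S.dat.NC (S.z l)) (p := 0) (fun q hq h1 => by
        rw [hb, va_mul, va_sub, (S.out_q h1).Sg hl h0 hq hS1 hS2]; simp)
      (fun q hq h1 => by
        obtain ⟨-, -, h4⟩ := (S.out_q h1).FGH hl h0 hq hU hU0
        simp only [hNC, va_mul, va_sub, va_add, h4, S.va_w0 hl h0 hq h1, ((S.out_q h1).V hl h0 hq).2.2.1]
        ring) (fun q hq => by
        refine (((((hu l q).sub (hu 0 q)).const_mul (√(1 + S.G.a ^ 2) ^ 3)).ofReal_comp).congr_of_eventuallyEq (ioo_ev hq fun t ht => ?_)).congr_deriv ?_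
        · rw [hb, va_mul, va_m3, va_sub, gSval (S.va_xq h0 (pi3 ht)) (S.va_yq hl h0 ht) (hX t 0) (S.va_m t 0) hone hS1,
            gSval (by simp : va 1 t 0 = (1:ℝ)) (S.va_yq0 h0 ht) one_pos (S.va_m t 0) hone hS2]
          push_cast; simp
        · obtain ⟨-, -, -, h4⟩ := S.vals hl hX hU h0 hq
          obtain ⟨-, -, -, h4'⟩ := S.vals0 hU0 h0 hq
          have hv : (S.v l q 0 : ℂ) ≠ 0 := by exact_mod_cast (S.v_pos l q h0).ne'
          have hv0 : (S.v 0 q 0 : ℂ) ≠ 0 := by exact_mod_cast (S.v_pos 0 q h0).ne'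
          simp only [hNC, va_mul, va_sub, va_add, va_m3, S.va_xq h0 (pi3 hq), e4, e5, e6, va_smul, va_one, h4, h4', S.hc' 0 h0 q (pi3 hq),
            S.va_w hl h0 hq, S.chi1 hq, Xq0]
          simp only [y]
          push_cast
          field_simp
          ring) k
    have hk' : (k : ℂ) ≠ 0 := by exact_mod_cast hk
    rw [hNB]
    simp only [Pr0, Jop, mulL, co_add, co_sub, co_diag, LinearMap.coe_mk, AddHom.coe_mk, ex_add, ex_csmul, ex_sub, h1, hk, if_false]
    field_simp [Complex.I_ne_zero]
    ring

theorem fix (sq : WA → WA) (hl : |l| ≤ 1) (hX : ∀ q p, 0 < S.G.Xq l q p)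
    (hG : S.dat.Good sq (S.z l)) : (S.Vq l, S.Vp l) = S.dat.Psi sq (S.z l) := by
  have hU : IsUnit (S.DD l) := hG.1
  have hU0 : IsUnit S.DD0 := hG.2.1
  have hFh : S.Vq l - S.dat.Fh (S.z l) = S.aa l := by
    have : S.dat.Fh (S.z l) = S.Vq l + S.dat.a * S.Vp l - S.MM * (gF (S.xq l) (S.xp l) (S.yq l) (S.yp' l) - gF 1 (-S.dat.a) S.yq0 S.yp0) := rfl
    rw [this, aa]; ring
  have hGh : S.dat.Gh (S.z l) - S.Vp l = S.bb l + prim (S.cc l) := by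
    have : S.dat.Gh (S.z l) = S.Vp l - S.dat.a * S.Vq l + S.MM * (gG (S.xq l) (S.xp l) (S.yq l) (S.yp' l) - gG 1 (-S.dat.a) S.yq0 S.yp0)
      + prim (S.cc l) := rfl
    rw [this, bb]; ring
  have m1 : (-1:ℝ) ∈ Icc (-1:ℝ) 0 := by simp
  have h := WA.repr (Vq := S.Vq l) (Vp := S.Vp l) (F := S.dat.Fh (S.z l)) (G := S.dat.Gh (S.z l))
    (φ := S.ϖ • (Pr0 (S.dat.NB sq (S.z l)) + Jop (S.dat.NC (S.z l)))) (fun k p hp => S.fix1 hl k p hp)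
    (fun k p hp => by
      rw [hFh, hGh]
      have h1 := S.fix2 hl hX hU hU0 k p hp
      have h2 : HasDerivAt (ex ((prim (S.cc l)).co k)) (ex ((S.cc l).co k) p) p := by
        have h3 := Ki_deriv (-1) 0 ((S.cc l).co k) p
        refine (h3.congr_of_eventuallyEq (ioo_ev' hp fun t ht => ?_)).congr_deriv (by simp)
        rw [prim, co_diag, ex_KL _ _ _ _ ht]; simp
      refine (h1.add h2).congr_deriv (by ring))
    (fun k => co_zero_of (fun q hq => ((S.out_m).V hl m1 hq).1) k)
    (fun k => by
      rw [hGh]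
      refine co_zero_of (fun q hq => ?_) k
      obtain ⟨-, h3, -⟩ := (S.out_m).FGH hl m1 hq hU hU0
      rw [va_add, va_prim _ _ _ m1, intervalIntegral.integral_same, bb]
      simp only [va_add, va_mul, va_sub, h3, ((S.out_m).V hl m1 hq).1]; simp)
    (fun k => by
      rcases S.hcase with ⟨h1, h2⟩ | h1
      · rw [h1, zero_smul]
        have : ex ((0:WA).co k) 0 = 0 := rfl
        rw [this]
        have ho : ∀ q, S.Out q 0 := fun q => S.G.out_p (by rw [h2]; norm_num [abs_of_nonneg]) q
        exact co_zero_of (fun q hq => ((ho q).V hl (by simp) hq).1) k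
      · rw [S.fix5 h1 sq hl hX hG k, h1.1, one_smul])
  have : S.dat.Psi sq (S.z l) = Tcl S.ϖ (S.dat.Fh (S.z l), S.dat.Gh (S.z l), Pr0 (S.dat.NB sq (S.z l)) + Jop (S.dat.NC (S.z l))) := rfl
  rw [this, Tcl_apply]
  exact Prod.ext h.1 h.2
end fix
end St
end partW10

section partW11
open scoped Topology ContDiff
open Real

namespace WA
def evL (q p : ℝ) : WA →L[ℝ] ℝ := LinearMap.mkContinuous
  { toFun := fun a => (va a q p).re, map_add' := fun a b => by simp, map_smul' := fun c a => by simp } 1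
  (fun a => by rw [one_mul]; exact (Complex.abs_re_le_norm _).trans (norm_va_le a q p))
theorem evL_apply (q p : ℝ) (a : WA) : evL q p a = (va a q p).re := rfl
end WA

theorem HD.low {μ pa pb : ℝ} (hμ : μ ∈ Ioo (0:ℝ) 1) (H : HD μ pa pb) (G : Geo) (hps : G.ps ∈ Icc pa pb)
    (hph : ∀ᶠ ε in 𝓝[>] (0:ℝ), (∀ p ∈ Icc (-1:ℝ) 0, G.ph ε p ∈ Icc pa pb) ∧ (∀ p ∈ Ioo (-1:ℝ) 0, G.ph ε p ∈ Ioo pa pb))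
    {b r : ℝ → ℝ} (hb : ContinuousOn b (Icc pa pb)) (hr : ContinuousOn r (Icc pa pb)) :
    ∃ N : ℝ, ∀ᶠ ε in 𝓝[>] (0:ℝ), ∃ F : WA, ‖F‖ ≤ N ∧ ∀ p ∈ Icc (-1:ℝ) 0, ∀ q ∈ Ioo (-π) π,
      WA.va F q p = (G.χ.f q * (b (G.ph ε p) + r (G.ph ε p) * H.Y (G.X ε 0 q p, G.ph ε p)) : ℝ) := by
  obtain ⟨K, hK, hloc⟩ := H.loc G.xs
  obtain ⟨b1, h1⟩ := hloc H.Yxx (by simp)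
  obtain ⟨R, hR⟩ := isCompact_Icc.exists_bound_of_continuousOn hr
  obtain ⟨L, hL⟩ := ((isCompact_Icc (a := G.xs - 1) (b := G.xs + 1)).prod (isCompact_Icc (a := pa) (b := pb))).exists_bound_of_continuousOn
    (H.cYx.mono (prod_mono (subset_univ _) subset_rfl))
  have hR0 : 0 ≤ R := (norm_nonneg _).trans (hR _ hps)
  have hL0 : 0 ≤ L := (norm_nonneg _).trans (hL (G.xs, G.ps) ⟨⟨by simp, by simp⟩, hps⟩)
  have sl : ∀ x, ∀ p ∈ Ioo pa pb, HasDerivAt (fun x => H.Yx (x, p)) (H.Yxx (x, p)) x := fun x p hp => by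
    have := path (x := fun x => x) (p := fun _ => p) (t := x) (H.dYx x p hp) (hasDerivAt_id x) (hasDerivAt_const x p)
    simpa using this
  refine ⟨_, (G.lemE hμ (k := fun z => b z.2 + r z.2 * H.Y z) (kx := fun z => r z.2 * H.Yx z) (K := R * L + R * (6 * K)) (by positivity) hps hph
    ?_ ?_ ?_ ?_ one_pos).mono fun ε h => h 0 (by simp)⟩
  · have h2 : ∀ f : ℝ → ℝ, ContinuousOn f (Icc pa pb) → ContinuousOn (fun z : ℝ × ℝ => f z.2) (univ ×ˢ Icc pa pb) :=
      fun f hf => hf.comp continuousOn_snd (fun z hz => hz.2)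
    exact (h2 b hb).add ((h2 r hr).mul H.cY)
  · intro x p hp
    have := path (x := fun x => x) (p := fun _ => p) (t := x) (H.dY x p hp) (hasDerivAt_id x) (hasDerivAt_const x p)
    simp only [mul_one, mul_zero, add_zero] at this
    exact (this.const_mul (r p)).const_add (b p)
  · intro x hx p hp
    have h3 := hR p (Ioo_subset_Icc_self hp)
    have h4 := hL (x, p) ⟨hx, Ioo_subset_Icc_self hp⟩
    rw [Real.norm_eq_abs] at h3 h4
    have : |r p * H.Yx (x, p)| ≤ R * L := by rw [abs_mul]; gcongr
    have : 0 ≤ R * (6 * K) := by positivity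
    linarith
  · intro x hx x' hx' p hp
    have h3 := hR p (Ioo_subset_Icc_self hp)
    rw [Real.norm_eq_abs] at h3
    have h4 := Bmp.mvt (convex_Icc _ _) (fun x _ => sl x p hp) (fun x hx => b1 x hx p hp) hx hx'
    have h5 := WA.rpow_aux6 hμ (abs_nonneg (x - x')) (abs_le.2 ⟨by linarith [hx.1, hx'.2], by linarith [hx.2, hx'.1]⟩)
    have h6 : K * |x - x'| ≤ K * (6 * |x - x'| ^ μ) := by gcongr
    have h7 : 0 ≤ R * L * |x - x'| ^ μ := by positivity
    rw [show r p * H.Yx (x, p) - r p * H.Yx (x', p) = r p * (H.Yx (x, p) - H.Yx (x', p)) by ring, abs_mul]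
    calc _ ≤ R * (K * (6 * |x - x'| ^ μ)) := by gcongr; exact h4.trans h6
      _ ≤ _ := by linarith

set_option maxHeartbeats 1600000 in
theorem HD.core {μ pa pb : ℝ} (hμ : μ ∈ Ioo (0:ℝ) 1) (H : HD μ pa pb) (hab : pa < pb) (xs ps ϖ pc : ℝ)
    (hcase : (ϖ = 0 ∧ pc = -1/2 ∧ ps ∈ Ioo pa pb) ∨ (ϖ = 1 ∧ pc = 0 ∧ ps = pb ∧ H.Top)) :
    AnalyticAt ℝ (fun x => H.Y (x, ps)) xs := by
  have hps : ps ∈ Icc pa pb := by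
    rcases hcase with ⟨-, -, h⟩ | ⟨-, -, h, -⟩
    · exact Ioo_subset_Icc_self h
    · rw [h]; exact ⟨hab.le, le_rfl⟩
  set a := H.Yx (xs, ps) with ha
  set v := H.Yp (xs, ps) with hv
  have hvp : 0 < v := H.pos xs ps hps
  set s := (1 + a ^ 2) / v with hs
  have hsp : 0 < s := by positivity
  obtain ⟨χ, c1, c2, c3⟩ := Bmp.mk' (3/2) (7/4) (by norm_num) (by norm_num)
  obtain ⟨z1, d1, d2, d3⟩ := Bmp.mk' (1/2) 1 (by norm_num) (by norm_num)
  obtain ⟨z2, e1, e2, e3⟩ := Bmp.mk' (1/8) (1/4) (by norm_num) (by norm_num)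
  let G : Geo := ⟨xs, ps, a, s, pc, χ, z1, z2, c1, c2, c3, d1 0 (by norm_num), d2, d3, e1 0 (by norm_num), e2, e3, hsp,
    by rcases hcase with h | h; exacts [Or.inr h.2.1, Or.inl h.2.1]⟩
  have sm : ∀ A t : ℝ, 0 < t → ∀ᶠ ε in 𝓝[>] (0:ℝ), ε * A < t := by
    intro A t ht
    have : Filter.Tendsto (fun ε : ℝ => ε * A) (𝓝[>] 0) (𝓝 0) := by
      have h : Continuous (fun ε : ℝ => ε * A) := by fun_prop
      have := h.tendsto 0
      rw [zero_mul] at this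
      exact this.mono_left nhdsWithin_le_nhds
    exact this.eventually_lt_const ht
  have hph : ∀ᶠ ε in 𝓝[>] (0:ℝ), (∀ p ∈ Icc (-1:ℝ) 0, G.ph ε p ∈ Icc pa pb) ∧ (∀ p ∈ Ioo (-1:ℝ) 0, G.ph ε p ∈ Ioo pa pb) := by
    rcases hcase with ⟨-, hpc, h⟩ | ⟨-, hpc, h, -⟩
    · filter_upwards [sm s _ (sub_pos.2 h.1), sm s _ (sub_pos.2 h.2), self_mem_nhdsWithin] with ε h1 h2 h3
      have h3 : 0 < ε * s := mul_pos h3 hsp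
      have : ∀ p ∈ Icc (-1:ℝ) 0, G.ph ε p ∈ Ioo pa pb := fun p hp => by
        change ps + ε * s * (p - pc) ∈ Ioo pa pb
        rw [hpc]; constructor <;> nlinarith [hp.1, hp.2]
      exact ⟨fun p hp => Ioo_subset_Icc_self (this p hp), fun p hp => this p (Ioo_subset_Icc_self hp)⟩
    · filter_upwards [sm s _ (sub_pos.2 hab), self_mem_nhdsWithin] with ε h1 h3
      have h3 : 0 < ε * s := mul_pos h3 hsp
      constructor <;> intro p hp
      · change ps + ε * s * (p - pc) ∈ Icc pa pb
        rw [hpc, h]; constructor <;> nlinarith [hp.1, hp.2]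
      · change ps + ε * s * (p - pc) ∈ Ioo pa pb
        rw [hpc, h]; constructor <;> nlinarith [hp.1, hp.2]
  obtain ⟨K, hK, hloc⟩ := H.loc xs
  obtain ⟨b1, b1'⟩ := hloc H.Yxx (by simp)
  obtain ⟨b2, b2'⟩ := hloc H.Yxp (by simp)
  obtain ⟨Eq, Ep, hEq, hEp⟩ := G.elem_xi hμ
  let d : PsiData WA := HD.dat a ϖ Eq Ep
  have hm0 : 0 < √(1 + a ^ 2) := by positivity
  have hm : IsUnit d.m := by
    refine IsUnit.of_mul_eq_one ((√(1 + a ^ 2))⁻¹ • 1) ?_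
    change (√(1 + a ^ 2) • (1 : WA)) * ((√(1 + a ^ 2))⁻¹ • 1) = 1
    rw [smul_mul_smul_comm, mul_inv_cancel₀ hm0.ne']; simp
  have hma : d.m * d.m = 1 + d.a * d.a := by
    change (√(1 + a ^ 2) • (1 : WA)) * (√(1 + a ^ 2) • (1 : WA)) = 1 + (a • (1:WA)) * (a • (1:WA))
    rw [smul_mul_smul_comm, smul_mul_smul_comm, Real.mul_self_sqrt (by positivity), add_smul]; simp [pow_two]
  obtain ⟨sq, s1, s2, s3⟩ := exists_sq d.m hm
  obtain ⟨r, hr, hift⟩ := d.Psi_ift sq hm hma s1 s2 s3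
  set τ := r / (4 * (1 + |a| + s) * (G.Cn μ + 1)) with hτ
  have hCn := G.hCn μ
  have hτp : 0 < τ := by positivity
  set T := G.Cn μ * τ with hT
  have hTp : 0 ≤ T := by positivity
  have hTr : (1 + |a| + s) * T ≤ r / 4 := by
    have : (1 + |a| + s) * ((G.Cn μ + 1) * τ) = r / 4 := by rw [hτ]; field_simp
    rw [← this]; gcongr; rw [hT]; gcongr; linarith
  have sl : ∀ {f fx fp : ℝ × ℝ → ℝ}, (∀ x, ∀ p ∈ Ioo pa pb, HasFDerivAt f (lin2 (fx (x, p)) (fp (x, p))) (x, p)) → ∀ c x, ∀ p ∈ Ioo pa pb,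
      HasDerivAt (fun x => f (x, p) - c) (fx (x, p)) x := fun h c x p hp => by
    have := path (x := fun x => x) (p := fun _ => p) (t := x) (h x p hp) (hasDerivAt_id x) (hasDerivAt_const x p)
    simp only [mul_one, mul_zero, add_zero] at this
    exact this.sub_const c
  have E1 := G.lemE hμ (k := fun z => H.Yx z - a) (kx := H.Yxx) hK hps hph (H.cYx.sub continuousOn_const) (sl H.dYx a) b1 b1' hτp
  have E2 := G.lemE hμ (k := fun z => H.Yp z - v) (kx := H.Yxp) hK hps hph (H.cYp.sub continuousOn_const) (sl H.dYp v) b2 b2' hτp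
  obtain ⟨N3, E3⟩ := H.low hμ G hps hph H.cb H.cr
  obtain ⟨N4, E4⟩ := H.low hμ G hps hph H.cr (continuousOn_const (c := (0:ℝ)))
  obtain ⟨N5, E5⟩ := H.low hμ G hps hph (continuousOn_const (c := H.A)) (continuousOn_const (c := H.B))
  have hpos : ∀ᶠ ε in 𝓝[>] (0:ℝ), 0 < ε := self_mem_nhdsWithin
  obtain ⟨ε, hε, hph, E1, E2, ⟨F3, n3, v3⟩, ⟨F4, n4, v4⟩, ⟨F5, n5, v5⟩, l1, l2, l3, l4, l5, l6⟩ :=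
    (hpos.and <| hph.and <| E1.and <| E2.and <| E3.and <| E4.and <| E5.and <|
      (sm (N3 / s) r hr).and <| (sm (N4 / s) r hr).and <| (sm (s ^ 2 * |H.κ| * ‖(1:WA)‖) r hr).and <|
      (sm N5 r hr).and <| (sm (|H.B| * ‖(1:WA)‖) r hr).and (sm 1 1 one_pos)).exists
  have hε : 0 < ε := hε
  simp only [mul_one] at l6
  have k1 : (fun z => H.Yx z - a) (G.xs, G.ps) = 0 := sub_self a
  have k2 : (fun z => H.Yp z - v) (G.xs, G.ps) = 0 := sub_self v
  simp only [k1, k2, abs_zero, zero_add, ← hT] at E1 E2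
  have ch : ∀ {P : ℝ → WA → Prop}, (∀ l, |l| ≤ 1 → ∃ F, P l F) → ∃ E : ℝ → WA, ∀ l, |l| ≤ 1 → P l (E l) := by
    intro P h
    choose E hE using (fun l => show ∃ F, |l| ≤ 1 → P l F by
      by_cases hl : |l| ≤ 1
      · exact (h l hl).imp fun F hF _ => hF
      · exact ⟨0, fun h => absurd h hl⟩)
    exact ⟨E, hE⟩
  obtain ⟨E1, hE1⟩ := ch E1
  obtain ⟨E2, hE2⟩ := ch E2
  let S : St μ pa pb :=
    { G := G, H := H, ε := ε, ϖ := ϖ, hε := hε, hph := hph.1, hph' := hph.2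
      hsa := by change s * v = 1 + a ^ 2; rw [hs]; field_simp
      hcase := by
        rcases hcase with h | h
        · exact Or.inl ⟨h.1, h.2.1⟩
        · exact Or.inr h
      E1 := E1, E2 := E2, Eq := Eq, Ep := Ep, c := (ε / s) • F3, r2 := (ε ^ 2 / s) • F4, c' := ε • F5
      hE1 := fun l hl => (hE1 l hl).2
      hE2 := fun l hl => (hE2 l hl).2
      hEq := hEq, hEp := hEp
      hc := fun p hp q hq => by rw [WA.va_smul, v3 p hp q hq, ← Complex.ofReal_mul]
      hr2 := fun p hp q hq => by rw [WA.va_smul, v4 p hp q hq, ← Complex.ofReal_mul, zero_mul, add_zero]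
      hc' := fun p hp q hq => by rw [WA.va_smul, v5 p hp q hq, ← Complex.ofReal_mul] }
  have hE10 := (hE1 0 (by simp)).1
  have hE20 := (hE2 0 (by simp)).1
  have x1 : T ≤ (1 + |a| + s) * T := by nlinarith [abs_nonneg a]
  have x2 : |a| * T + s * T ≤ (1 + |a| + s) * T := by nlinarith
  have he : ‖S.e‖ < r := by
    rw [pi_norm_lt_iff hr]
    have n2 : ∀ (x y : ℝ) (A B : WA), ‖A‖ ≤ T → ‖B‖ ≤ T → ‖x • A + y • B‖ ≤ |x| * T + |y| * T := fun x y A B hA hB => by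
      refine (norm_add_le _ _).trans ?_
      rw [norm_smul, norm_smul, Real.norm_eq_abs, Real.norm_eq_abs]; gcongr
    intro i
    fin_cases i
    · change ‖E1 0‖ < r; linarith
    · change ‖(-a) • E1 0 + s • E2 0‖ < r
      have := n2 (-a) s _ _ hE10 hE20
      rw [abs_neg, abs_of_pos hsp] at this; linarith
    · change ‖(ε / s) • F3‖ < r
      rw [norm_smul, Real.norm_of_nonneg (by positivity)]
      refine lt_of_le_of_lt ?_ l1
      rw [mul_div_assoc', div_mul_eq_mul_div]; gcongr
    · change ‖(ε ^ 2 / s) • F4‖ < r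
      rw [norm_smul, Real.norm_of_nonneg (by positivity)]
      refine lt_of_le_of_lt ?_ l2
      have : 0 ≤ N4 := (norm_nonneg _).trans n4
      rw [mul_div_assoc', div_mul_eq_mul_div]; gcongr
      nlinarith
    · change ‖(ε * s ^ 2 * H.κ) • (1:WA)‖ < r
      rw [norm_smul, Real.norm_eq_abs, abs_mul, abs_of_pos (by positivity)]
      linarith
    · change ‖ε • F5‖ < r
      rw [norm_smul, Real.norm_of_nonneg hε.le]
      refine lt_of_le_of_lt ?_ l4
      gcongr
    · change ‖(ε ^ 2 * H.B) • (1:WA)‖ < r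
      rw [norm_smul, Real.norm_eq_abs, abs_mul, abs_of_pos (by positivity)]
      refine lt_of_le_of_lt ?_ l5
      rw [← mul_assoc]; gcongr; nlinarith
  have hV : AnalyticAt ℝ (fun l => (S.Vq l, S.Vp l)) 0 := by
    refine hift S.e he _ ?_
    have sl2 : ∀ A t : ℝ, 0 < t → ∀ᶠ l in 𝓝 (0:ℝ), |l| * A < t := by
      intro A t ht
      have h : Continuous (fun ε : ℝ => |ε| * A) := by fun_prop
      have := h.tendsto 0
      simp only [abs_zero, zero_mul] at this
      exact this.eventually_lt_const ht
    filter_upwards [sl2 1 1 one_pos, sl2 G.C 1 one_pos, sl2 (‖Eq‖ * (|a| * ‖(1:WA)‖ + T)) (r / 4) (by positivity),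
      sl2 (‖Ep‖ * (|a| * ‖(1:WA)‖ + T)) (r / 4) (by positivity)] with l g1 g2 g3 g4
    have hl : |l| ≤ 1 := by linarith
    have hE1l := (hE1 l hl).1
    have hE2l := (hE2 l hl).1
    have mlem : ∀ A : WA, ‖l • (A * (a • 1 + E1 l))‖ ≤ |l| * (‖A‖ * (|a| * ‖(1:WA)‖ + T)) := fun A => by
      rw [norm_smul, Real.norm_eq_abs]
      gcongr
      refine (norm_mul_le _ _).trans ?_
      gcongr
      refine (norm_add_le _ _).trans ?_
      rw [norm_smul, Real.norm_eq_abs]; gcongr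
    have q1 : ‖E1 l - E1 0‖ ≤ 2 * T := (norm_sub_le _ _).trans (by linarith)
    have q2 : ‖E2 l - E2 0‖ ≤ 2 * T := (norm_sub_le _ _).trans (by linarith)
    refine ⟨?_, fun hG => S.fix sq hl (fun q p => ?_) hG⟩
    · rw [Prod.norm_def, max_lt_iff]
      constructor
      · change ‖E1 l - E1 0 + l • (Eq * (a • 1 + E1 l))‖ < r
        have := norm_add_le (E1 l - E1 0) (l • (Eq * (a • 1 + E1 l)))
        linarith [mlem Eq]
      · change ‖(-a) • (E1 l - E1 0) + l • (Ep * (a • 1 + E1 l)) + s • (E2 l - E2 0)‖ < r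
        have := norm_add₃_le (a := (-a) • (E1 l - E1 0)) (b := l • (Ep * (a • 1 + E1 l))) (c := s • (E2 l - E2 0))
        rw [norm_smul, norm_smul s, Real.norm_eq_abs, Real.norm_eq_abs, abs_neg, abs_of_pos hsp] at this
        have y1 : |a| * ‖E1 l - E1 0‖ ≤ |a| * (2 * T) := by gcongr
        have y2 : s * ‖E2 l - E2 0‖ ≤ s * (2 * T) := by gcongr
        linarith [mlem Ep]
    · have h1 := G.b_xiq q p
      have : |l * G.xiq q p| < 1 := by
        rw [abs_mul]; exact lt_of_le_of_lt (by gcongr) g2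
      have := (abs_lt.1 this).1
      change 0 < 1 + l * G.xiq q p
      linarith
  have hpc : pc ∈ Icc (-1:ℝ) 0 := by rcases hcase with ⟨-, h, -⟩ | ⟨-, h, -⟩ <;> rw [h] <;> norm_num
  have hval : AnalyticAt ℝ (fun l => (H.Y (xs + ε * l, ps) - H.Y (xs, ps)) / ε) 0 := by
    have h1 := ((WA.evL 0 pc).comp (WA.prim.comp (ContinuousLinearMap.snd ℝ WA WA))).analyticAt (S.Vq 0, S.Vp 0)
    have h2 := AnalyticAt.comp (f := fun l => (S.Vq l, S.Vp l)) h1 hV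
    refine h2.congr ?_
    filter_upwards [Metric.ball_mem_nhds (0:ℝ) one_pos] with l hl
    have hl : |l| ≤ 1 := by simpa using (mem_ball_zero_iff.1 hl).le
    have h3 := S.va_w (q := 0) hl hpc ⟨by norm_num, by norm_num⟩
    change (WA.va (WA.prim (S.Vp l)) 0 pc).re = _
    rw [h3, Complex.ofReal_re]
    have h4 : ∀ l, S.y l 0 pc = H.Y (xs + ε * l, ps) := by
      intro l
      change H.Y (xs + ε * (0 - a * (pc - pc) + l * (z1.f 0 * z2.f (pc - pc))), ps + ε * s * (pc - pc)) = _
      rw [sub_self, d1 0 (by norm_num), e1 0 (by norm_num)]; simp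
    rw [h4, h4]; simp; rfl
  have h5 : AnalyticAt ℝ (fun x => (x - xs) / ε) xs := by fun_prop (disch := positivity)
  have h6 : AnalyticAt ℝ (fun l => (H.Y (xs + ε * l, ps) - H.Y (xs, ps)) / ε) ((fun x => (x - xs) / ε) xs) := by simpa using hval
  have h7 := ((AnalyticAt.comp (f := fun x => (x - xs) / ε) h6 h5).mul (analyticAt_const (v := ε))).add (analyticAt_const (v := H.Y (xs, ps)))
  refine h7.congr (Filter.Eventually.of_forall fun x => ?_)
  simp only [Pi.add_apply, Pi.mul_apply, Function.comp_apply]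
  have : xs + ε * ((x - xs) / ε) = x := by field_simp; ring
  rw [this]; field_simp; ring
end partW11

section partW12
open scoped Topology ContDiff
open Real

structure PD (μ pa d δ : ℝ) where
  (η : ℝ → ℝ) (ψ u v wa wb wc : ℝ × ℝ → ℝ) (b r : ℝ → ℝ)
  (hδ : 0 < δ) (hpa : pa < 0) (hη : Continuous η) (hηd : ∀ x, -d < η x)
  (c : ∀ f ∈ ({ψ, u, v, wa, wb, wc} : Set (ℝ × ℝ → ℝ)), ContinuousOn f {z | -d ≤ z.2 ∧ z.2 ≤ η z.1})
  (dψ : ∀ z : ℝ × ℝ, -d < z.2 → z.2 < η z.1 → HasFDerivAt ψ (lin2 (u z) (v z)) z)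
  (du : ∀ z : ℝ × ℝ, -d < z.2 → z.2 < η z.1 → HasFDerivAt u (lin2 (wa z) (wb z)) z)
  (dv : ∀ z : ℝ × ℝ, -d < z.2 → z.2 < η z.1 → HasFDerivAt v (lin2 (wb z) (wc z)) z)
  (hv : ∀ z : ℝ × ℝ, -d ≤ z.2 → z.2 ≤ η z.1 → v z ≤ -δ)
  (hol : ∀ f ∈ ({wa, wb, wc} : Set (ℝ × ℝ → ℝ)), ∃ K, 0 ≤ K ∧ ∀ z z' : ℝ × ℝ, -d ≤ z.2 → z.2 ≤ η z.1 → -d ≤ z'.2 → z'.2 ≤ η z'.1 →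
    |f z - f z'| ≤ K * (|z.1 - z'.1| + |z.2 - z'.2|) ^ μ)
  (pde : ∀ z : ℝ × ℝ, -d < z.2 → z.2 < η z.1 → wa z + wc z = b (-ψ z) + r (-ψ z) * z.2)
  (top : ∀ x, ψ (x, η x) = 0) (bot : ∀ x, ψ (x, -d) = -pa)
  (cb : ContinuousOn b (Icc pa 0)) (cr : ContinuousOn r (Icc pa 0))

namespace PD
variable {μ pa d δ : ℝ} (P : PD μ pa d δ)

theorem cψ : ContinuousOn P.ψ {z | -d ≤ z.2 ∧ z.2 ≤ P.η z.1} := P.c _ (by simp)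

theorem cl (x : ℝ) : ContinuousOn (fun y => P.ψ (x, y)) (Icc (-d) (P.η x)) :=
  P.cψ.comp (by fun_prop) (fun y hy => hy)

theorem slope (x y y' : ℝ) (h : -d ≤ y) (hy : y ≤ y') (h' : y' ≤ P.η x) : P.ψ (x, y') - P.ψ (x, y) ≤ -δ * (y' - y) := by
  have hd : ∀ t ∈ interior (Icc (-d) (P.η x)), HasDerivAt (fun y => P.ψ (x, y)) (P.v (x, t)) t := fun t ht => by
    rw [interior_Icc] at ht
    have := path (x := fun _ => x) (p := fun y => y) (t := t) (P.dψ (x, t) ht.1 ht.2) (hasDerivAt_const t x) (hasDerivAt_id t)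
    simpa using this
  refine (convex_Icc (-d) (P.η x)).image_sub_le_mul_sub_of_deriv_le (P.cl x) (fun t ht => (hd t ht).differentiableAt.differentiableWithinAt)
    (fun t ht => ?_) y ⟨h, hy.trans h'⟩ y' ⟨h.trans hy, h'⟩ hy
  rw [(hd t ht).deriv]
  have := interior_subset ht
  exact P.hv _ this.1 this.2

theorem slope' (x y y' : ℝ) (h : -d ≤ y) (hy : y ≤ P.η x) (h' : -d ≤ y') (hy' : y' ≤ P.η x) :
    δ * |y - y'| ≤ |P.ψ (x, y) - P.ψ (x, y')| := by
  rcases le_total y y' with h1 | h1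
  · have := P.slope x y y' h h1 hy'
    rw [abs_sub_comm, abs_of_nonneg (sub_nonneg.2 h1)]
    exact le_trans (by linarith) (le_abs_self _)
  · have := P.slope x y' y h' h1 hy
    rw [abs_of_nonneg (sub_nonneg.2 h1), abs_sub_comm (P.ψ _)]
    exact le_trans (by linarith) (le_abs_self _)

theorem uniq {x y y' : ℝ} (h : -d ≤ y) (hy : y ≤ P.η x) (h' : -d ≤ y') (hy' : y' ≤ P.η x) (e : P.ψ (x, y) = P.ψ (x, y')) : y = y' := by
  have := P.slope' x y y' h hy h' hy'
  rw [e, sub_self, abs_zero] at this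
  have h2 : |y - y'| ≤ 0 := by
    by_contra hc
    push Not at hc
    nlinarith [P.hδ]
  exact sub_eq_zero.1 (abs_nonpos_iff.1 h2)

theorem exY (z : ℝ × ℝ) : ∃ y, z.2 ∈ Icc pa 0 → -d ≤ y ∧ y ≤ P.η z.1 ∧ P.ψ (z.1, y) = -z.2 := by
  by_cases h : z.2 ∈ Icc pa 0
  · have := intermediate_value_Icc' (P.hηd z.1).le (P.cl z.1)
    rw [P.top, P.bot] at this
    obtain ⟨y, hy, e⟩ := this (show -z.2 ∈ Icc 0 (-pa) from ⟨by linarith [h.2], by linarith [h.1]⟩)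
    exact ⟨y, fun _ => ⟨hy.1, hy.2, e⟩⟩
  · exact ⟨0, fun h' => absurd h' h⟩

def Y (z : ℝ × ℝ) : ℝ := (P.exY z).choose
theorem Y1 (x : ℝ) {p : ℝ} (hp : p ∈ Icc pa 0) : -d ≤ P.Y (x, p) := ((P.exY (x, p)).choose_spec hp).1
theorem Y2 (x : ℝ) {p : ℝ} (hp : p ∈ Icc pa 0) : P.Y (x, p) ≤ P.η x := ((P.exY (x, p)).choose_spec hp).2.1
theorem Y3 (x : ℝ) {p : ℝ} (hp : p ∈ Icc pa 0) : P.ψ (x, P.Y (x, p)) = -p := ((P.exY (x, p)).choose_spec hp).2.2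

theorem Y1' (x : ℝ) {p : ℝ} (hp : p ∈ Ioo pa 0) : -d < P.Y (x, p) := by
  refine lt_of_le_of_ne (P.Y1 x (Ioo_subset_Icc_self hp)) fun h => ?_
  have := P.Y3 x (Ioo_subset_Icc_self hp)
  rw [← h, P.bot] at this
  linarith [hp.1]
theorem Y2' (x : ℝ) {p : ℝ} (hp : p ∈ Ioo pa 0) : P.Y (x, p) < P.η x := by
  refine lt_of_le_of_ne (P.Y2 x (Ioo_subset_Icc_self hp)) fun h => ?_
  have := P.Y3 x (Ioo_subset_Icc_self hp)
  rw [h, P.top] at this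
  linarith [hp.2]
theorem Ytop (x : ℝ) : P.Y (x, 0) = P.η x := by
  have h : (0:ℝ) ∈ Icc pa 0 := ⟨P.hpa.le, le_rfl⟩
  exact P.uniq (P.Y1 x h) (P.Y2 x h) (P.hηd x).le le_rfl (by rw [P.Y3 x h, P.top, neg_zero])

theorem cY : ContinuousOn P.Y (univ ×ˢ Icc pa 0) := by
  rintro ⟨x0, p0⟩ ⟨-, hp0⟩
  have hp0 : p0 ∈ Icc pa 0 := hp0
  have hpos : ∀ x, 0 < P.η x + d := fun x => by linarith [P.hηd x]
  set t := (P.Y (x0, p0) + d) / (P.η x0 + d) with ht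
  have h0 : 0 ≤ t := div_nonneg (by linarith [P.Y1 x0 hp0]) (hpos x0).le
  have h1 : t ≤ 1 := (div_le_one (hpos x0)).2 (by linarith [P.Y2 x0 hp0])
  let ys : ℝ × ℝ → ℝ := fun z => -d + t * (P.η z.1 + d)
  have cys : Continuous ys := by have := P.hη; fun_prop
  have e0 : ys (x0, p0) = P.Y (x0, p0) := by
    change -d + t * (P.η x0 + d) = _
    rw [ht, div_mul_cancel₀ _ (hpos x0).ne']; ring
  have m1 : ∀ z, -d ≤ ys z := fun z => by
    have := mul_nonneg h0 (hpos z.1).le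
    change -d ≤ -d + t * (P.η z.1 + d); linarith
  have m2 : ∀ z, ys z ≤ P.η z.1 := fun z => by
    have := mul_nonneg (sub_nonneg.2 h1) (hpos z.1).le
    change -d + t * (P.η z.1 + d) ≤ _; linarith
  have c2 : Continuous (fun z : ℝ × ℝ => P.ψ (z.1, ys z)) :=
    P.cψ.comp_continuous (by fun_prop) (fun z => ⟨m1 z, m2 z⟩)
  have c3 : Continuous (fun z : ℝ × ℝ => |-z.2 - P.ψ (z.1, ys z)| / δ + |ys z - P.Y (x0, p0)|) := by fun_prop
  have c4 := c3.tendsto (x0, p0)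
  simp only [e0, P.Y3 x0 hp0, sub_self, abs_zero, zero_div, add_zero] at c4
  refine tendsto_iff_norm_sub_tendsto_zero.2 ?_
  refine squeeze_zero' (Filter.Eventually.of_forall fun _ => norm_nonneg _) ?_ (c4.mono_left nhdsWithin_le_nhds)
  filter_upwards [self_mem_nhdsWithin] with z hz
  have h3 := P.slope' z.1 (P.Y z) (ys z) (P.Y1 z.1 hz.2) (P.Y2 z.1 hz.2) (m1 z) (m2 z)
  have h4 : P.ψ (z.1, P.Y z) = -z.2 := P.Y3 z.1 hz.2
  rw [h4, mul_comm, ← le_div_iff₀ P.hδ] at h3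
  exact (abs_sub_le _ (ys z) _).trans (by linarith)

/-- composition with the height function -/
def cp (f : ℝ × ℝ → ℝ) (z : ℝ × ℝ) : ℝ := f (z.1, P.Y z)
theorem ccp {f : ℝ × ℝ → ℝ} (h : ContinuousOn f {z | -d ≤ z.2 ∧ z.2 ≤ P.η z.1}) : ContinuousOn (P.cp f) (univ ×ˢ Icc pa 0) :=
  h.comp (continuousOn_fst.prodMk P.cY) fun z hz => ⟨P.Y1 z.1 hz.2, P.Y2 z.1 hz.2⟩

def Yp (z : ℝ × ℝ) : ℝ := -(P.cp P.v z)⁻¹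
def Yx (z : ℝ × ℝ) : ℝ := P.cp P.u z * P.Yp z
def Yxx (z : ℝ × ℝ) : ℝ := P.Yp z * (P.cp P.wa z + 2 * P.cp P.wb z * P.Yx z + P.cp P.wc z * P.Yx z ^ 2)
def Yxp (z : ℝ × ℝ) : ℝ := P.Yp z ^ 2 * (P.cp P.wb z + P.cp P.wc z * P.Yx z)
def Ypp (z : ℝ × ℝ) : ℝ := P.Yp z ^ 3 * P.cp P.wc z

theorem vneg {z : ℝ × ℝ} (hz : z.2 ∈ Icc pa 0) : P.cp P.v z < 0 :=
  lt_of_le_of_lt (P.hv _ (P.Y1 z.1 hz) (P.Y2 z.1 hz)) (neg_neg_of_pos P.hδ)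

theorem cYp : ContinuousOn P.Yp (univ ×ˢ Icc pa 0) := ((P.ccp (P.c P.v (by simp))).inv₀ fun z hz => (P.vneg hz.2).ne).neg
theorem cYx : ContinuousOn P.Yx (univ ×ˢ Icc pa 0) := (P.ccp (P.c P.u (by simp))).mul P.cYp
theorem cwa : ContinuousOn (P.cp P.wa) (univ ×ˢ Icc pa 0) := P.ccp (P.c P.wa (by simp))
theorem cwb : ContinuousOn (P.cp P.wb) (univ ×ˢ Icc pa 0) := P.ccp (P.c P.wb (by simp))
theorem cwc : ContinuousOn (P.cp P.wc) (univ ×ˢ Icc pa 0) := P.ccp (P.c P.wc (by simp))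
theorem cYxx : ContinuousOn P.Yxx (univ ×ˢ Icc pa 0) :=
  P.cYp.mul ((P.cwa.add ((continuousOn_const.mul P.cwb).mul P.cYx)).add (P.cwc.mul (P.cYx.pow 2)))
theorem cYxp : ContinuousOn P.Yxp (univ ×ˢ Icc pa 0) := (P.cYp.pow 2).mul (P.cwb.add (P.cwc.mul P.cYx))
theorem cYpp : ContinuousOn P.Ypp (univ ×ˢ Icc pa 0) := (P.cYp.pow 3).mul P.cwc

theorem dY (x : ℝ) {p : ℝ} (hp : p ∈ Ioo pa 0) : HasFDerivAt P.Y (lin2 (P.Yx (x, p)) (P.Yp (x, p))) (x, p) := by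
  have hI := Ioo_subset_Icc_self hp
  have hv := (P.vneg (z := (x, p)) hI).ne
  set u := P.cp P.u (x, p) with hu
  set v := P.cp P.v (x, p) with hv'
  have hn : univ ×ˢ Icc pa 0 ∈ 𝓝 (x, p) := prod_mem_nhds Filter.univ_mem (Icc_mem_nhds hp.1 hp.2)
  let g : ℝ × ℝ → ℝ × ℝ := fun z => (z.1, P.Y z)
  have hg : ContinuousAt g (x, p) := continuousAt_fst.prodMk (P.cY.continuousAt hn)
  let e : (ℝ × ℝ) ≃L[ℝ] (ℝ × ℝ) := ContinuousLinearEquiv.equivOfInverse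
    ((ContinuousLinearMap.fst ℝ ℝ ℝ).prod (-lin2 u v)) ((ContinuousLinearMap.fst ℝ ℝ ℝ).prod (lin2 (u * -v⁻¹) (-v⁻¹)))
    (fun z => by ext <;> simp [lin2]; field_simp; ring) (fun z => by ext <;> simp [lin2]; field_simp; ring)
  have hf : HasFDerivAt (fun z : ℝ × ℝ => (z.1, -P.ψ z)) (e : (ℝ × ℝ) →L[ℝ] (ℝ × ℝ)) (g (x, p)) :=
    hasFDerivAt_fst.prodMk (P.dψ _ (P.Y1' x hp) (P.Y2' x hp)).neg
  have h := hg
  have := HasFDerivAt.of_local_left_inverse hg hf (by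
    filter_upwards [hn] with z hz
    have h4 : P.ψ (z.1, P.Y z) = -z.2 := P.Y3 z.1 hz.2
    change (z.1, -P.ψ (z.1, P.Y z)) = z
    rw [h4, neg_neg])
  exact (hasFDerivAt_snd.comp (x, p) this)

theorem dcp {f : ℝ × ℝ → ℝ} {a b : ℝ} (x : ℝ) {p : ℝ} (hp : p ∈ Ioo pa 0) (h : HasFDerivAt f (lin2 a b) (x, P.Y (x, p))) :
    HasFDerivAt (P.cp f) (lin2 (a + b * P.Yx (x, p)) (b * P.Yp (x, p))) (x, p) := by
  have := HasFDerivAt.comp (g := f) (f := fun z : ℝ × ℝ => (z.1, P.Y z)) (x, p) h (hasFDerivAt_fst.prodMk (P.dY x hp))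
  refine this.congr_fderiv ?_
  ext <;> simp [lin2]

theorem dYp (x : ℝ) {p : ℝ} (hp : p ∈ Ioo pa 0) : HasFDerivAt P.Yp (lin2 (P.Yxp (x, p)) (P.Ypp (x, p))) (x, p) := by
  have hv := (P.vneg (z := (x, p)) (Ioo_subset_Icc_self hp)).ne
  have h1 := P.dcp x hp (P.dv _ (P.Y1' x hp) (P.Y2' x hp))
  have h2 := ((hasDerivAt_inv hv).comp_hasFDerivAt (x, p) h1).neg
  refine h2.congr_fderiv ?_
  ext <;> simp [lin2, Yxp, Ypp] <;> simp [Yp, cp] <;> ring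

theorem dYx (x : ℝ) {p : ℝ} (hp : p ∈ Ioo pa 0) : HasFDerivAt P.Yx (lin2 (P.Yxx (x, p)) (P.Yxp (x, p))) (x, p) := by
  have h1 := P.dcp x hp (P.du _ (P.Y1' x hp) (P.Y2' x hp))
  refine (h1.mul (P.dYp x hp)).congr_fderiv ?_
  ext <;> simp [lin2, Yxp, Ypp, Yxx, Yx, cp] <;> ring

theorem heq (x : ℝ) {p : ℝ} (hp : p ∈ Ioo pa 0) : P.Yxx (x, p) - (2 * P.Yx (x, p) * P.Yxp (x, p) / P.Yp (x, p)
    - (1 + P.Yx (x, p) ^ 2) * P.Ypp (x, p) / P.Yp (x, p) ^ 2) = P.Yp (x, p) * (P.b p + P.r p * P.Y (x, p)) := by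
  have h := P.pde (x, P.Y (x, p)) (P.Y1' x hp) (P.Y2' x hp)
  rw [P.Y3 x (Ioo_subset_Icc_self hp), neg_neg] at h
  have hv : P.Yp (x, p) ≠ 0 := neg_ne_zero.2 (inv_ne_zero (P.vneg (z := (x, p)) (Ioo_subset_Icc_self hp)).ne)
  have h : P.cp P.wa (x, p) + P.cp P.wc (x, p) = P.b p + P.r p * P.Y (x, p) := h
  rw [← h, Yxx, Yxp, Ypp]
  field_simp
  ring

/-- bounded and Hölder in the first variable -/
def LH (μ xs pa : ℝ) (f : ℝ × ℝ → ℝ) : Prop := ∃ K, 0 ≤ K ∧ (∀ x ∈ Icc (xs - 1) (xs + 1), ∀ p ∈ Ioo pa 0, |f (x, p)| ≤ K) ∧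
  ∀ x ∈ Icc (xs - 1) (xs + 1), ∀ x' ∈ Icc (xs - 1) (xs + 1), ∀ p ∈ Ioo pa 0, |f (x, p) - f (x', p)| ≤ K * |x - x'| ^ μ

theorem LH.add {μ xs pa : ℝ} {f g : ℝ × ℝ → ℝ} (hf : LH μ xs pa f) (hg : LH μ xs pa g) : LH μ xs pa (fun z => f z + g z) := by
  obtain ⟨K, hK, a, b⟩ := hf
  obtain ⟨L, hL, a', b'⟩ := hg
  refine ⟨K + L, by positivity, fun x hx p hp => (abs_add_le _ _).trans (add_le_add (a x hx p hp) (a' x hx p hp)), fun x hx x' hx' p hp => ?_⟩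
  rw [add_sub_add_comm, add_mul]
  exact (abs_add_le _ _).trans (add_le_add (b x hx x' hx' p hp) (b' x hx x' hx' p hp))

theorem LH.mul {μ xs pa : ℝ} {f g : ℝ × ℝ → ℝ} (hf : LH μ xs pa f) (hg : LH μ xs pa g) : LH μ xs pa (fun z => f z * g z) := by
  obtain ⟨K, hK, a, b⟩ := hf
  obtain ⟨L, hL, a', b'⟩ := hg
  refine ⟨2 * (K * L), by positivity, fun x hx p hp => ?_, fun x hx x' hx' p hp => ?_⟩
  · rw [abs_mul]
    have := mul_le_mul (a x hx p hp) (a' x hx p hp) (abs_nonneg _) hK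
    have h2 : 0 ≤ K * L := by positivity
    linarith
  · dsimp only
    rw [show f (x, p) * g (x, p) - f (x', p) * g (x', p) = (f (x, p) - f (x', p)) * g (x, p) + f (x', p) * (g (x, p) - g (x', p)) by ring]
    refine (abs_add_le _ _).trans ?_
    rw [abs_mul, abs_mul]
    have h1 := mul_le_mul (b x hx x' hx' p hp) (a' x hx p hp) (abs_nonneg _) (by positivity)
    have h2 := mul_le_mul (a x' hx' p hp) (b' x hx x' hx' p hp) (abs_nonneg _) hK
    linarith

theorem bd {f : ℝ × ℝ → ℝ} (h : ContinuousOn f (univ ×ˢ Icc pa 0)) (xs : ℝ) :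
    ∃ K, 0 ≤ K ∧ ∀ x ∈ Icc (xs - 1) (xs + 1), ∀ p ∈ Ioo pa 0, |f (x, p)| ≤ K := by
  obtain ⟨L, hL⟩ := ((isCompact_Icc (a := xs - 1) (b := xs + 1)).prod (isCompact_Icc (a := pa) (b := 0))).exists_bound_of_continuousOn
    (h.mono (prod_mono (subset_univ _) subset_rfl))
  exact ⟨|L|, abs_nonneg _, fun x hx p hp => (hL (x, p) ⟨hx, Ioo_subset_Icc_self hp⟩).trans (le_abs_self L)⟩

theorem lip {f fx fp : ℝ × ℝ → ℝ} (h : ContinuousOn fx (univ ×ˢ Icc pa 0))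
    (hd : ∀ x, ∀ p ∈ Ioo pa 0, HasFDerivAt f (lin2 (fx (x, p)) (fp (x, p))) (x, p)) (xs : ℝ) :
    ∃ K, 0 ≤ K ∧ ∀ x ∈ Icc (xs - 1) (xs + 1), ∀ x' ∈ Icc (xs - 1) (xs + 1), ∀ p ∈ Ioo pa 0, |f (x, p) - f (x', p)| ≤ K * |x - x'| := by
  obtain ⟨K, hK, hb⟩ := bd h xs
  refine ⟨K, hK, fun x hx x' hx' p hp => Bmp.mvt (f := fun x => f (x, p)) (convex_Icc _ _) (fun x _ => ?_) (fun x hx => hb x hx p hp) hx hx'⟩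
  have := path (x := fun x => x) (p := fun _ => p) (t := x) (hd x p hp) (hasDerivAt_id x) (hasDerivAt_const x p)
  simpa using this

theorem LH_lip {f fx fp : ℝ × ℝ → ℝ} (hμ : μ ∈ Ioo (0:ℝ) 1) (h0 : ContinuousOn f (univ ×ˢ Icc pa 0)) (h : ContinuousOn fx (univ ×ˢ Icc pa 0))
    (hd : ∀ x, ∀ p ∈ Ioo pa 0, HasFDerivAt f (lin2 (fx (x, p)) (fp (x, p))) (x, p)) (xs : ℝ) : LH μ xs pa f := by
  obtain ⟨L, hL, a⟩ := bd h0 xs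
  obtain ⟨K, hK, b⟩ := lip h hd xs
  refine ⟨L + 6 * K, by positivity, fun x hx p hp => (a x hx p hp).trans (by linarith), fun x hx x' hx' p hp => ?_⟩
  have h5 := WA.rpow_aux6 hμ (abs_nonneg (x - x')) (abs_le.2 ⟨by linarith [hx.1, hx'.2], by linarith [hx.2, hx'.1]⟩)
  have h7 : 0 ≤ L * |x - x'| ^ μ := by positivity
  have h6 := mul_le_mul_of_nonneg_left h5 hK
  have := b x hx x' hx' p hp
  linarith

theorem LH_w {f : ℝ × ℝ → ℝ} (hμ : μ ∈ Ioo (0:ℝ) 1) (hf : f ∈ ({P.wa, P.wb, P.wc} : Set (ℝ × ℝ → ℝ))) (xs : ℝ) : LH μ xs pa (P.cp f) := by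
  obtain ⟨L, hL, a⟩ := bd (P.ccp (P.c f (by rcases hf with h | h | h <;> simp [h]))) xs
  obtain ⟨K, hK, b⟩ := lip P.cYx (fun x p hp => P.dY x hp) xs
  obtain ⟨M, hM, h⟩ := P.hol f hf
  refine ⟨L + M * (1 + K) ^ μ, by positivity, fun x hx p hp => (a x hx p hp).trans (by have : 0 ≤ M * (1 + K) ^ μ := by positivity
                                                                                       linarith), fun x hx x' hx' p hp => ?_⟩
  have hI := Ioo_subset_Icc_self hp
  have h1 := h (x, P.Y (x, p)) (x', P.Y (x', p)) (P.Y1 x hI) (P.Y2 x hI) (P.Y1 x' hI) (P.Y2 x' hI)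
  have h2 : (|x - x'| + |P.Y (x, p) - P.Y (x', p)|) ^ μ ≤ ((1 + K) * |x - x'|) ^ μ :=
    Real.rpow_le_rpow (by positivity) (by linarith [b x hx x' hx' p hp]) hμ.1.le
  rw [Real.mul_rpow (by positivity) (abs_nonneg _)] at h2
  have h3 := mul_le_mul_of_nonneg_left h2 hM
  have h7 : 0 ≤ L * |x - x'| ^ μ := by positivity
  have h8 : |P.cp f (x, p) - P.cp f (x', p)| ≤ M * (|x - x'| + |P.Y (x, p) - P.Y (x', p)|) ^ μ := h1
  linarith

def toHD (hμ : μ ∈ Ioo (0:ℝ) 1) (κ A B : ℝ) : HD μ pa 0 where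
  Y := P.Y
  Yx := P.Yx
  Yp := P.Yp
  Yxx := P.Yxx
  Yxp := P.Yxp
  Ypp := P.Ypp
  b := P.b
  r := P.r
  κ := κ
  A := A
  B := B
  cY := P.cY
  cYx := P.cYx
  cYp := P.cYp
  pos := fun x p hp => neg_pos.2 (inv_lt_zero.2 (P.vneg (z := (x, p)) hp))
  dY := fun x p hp => P.dY x hp
  dYx := fun x p hp => P.dYx x hp
  dYp := fun x p hp => P.dYp x hp
  cYxx := P.cYxx.mono (prod_mono subset_rfl Ioo_subset_Icc_self)
  cYxp := P.cYxp.mono (prod_mono subset_rfl Ioo_subset_Icc_self)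
  cYpp := P.cYpp.mono (prod_mono subset_rfl Ioo_subset_Icc_self)
  heq := fun x p hp => P.heq x hp
  cb := P.cb
  cr := P.cr
  loc := fun xs => by
    have a1 := LH_lip hμ P.cYx P.cYxx (fun x p hp => P.dYx x hp) xs
    have a2 := LH_lip hμ P.cYp P.cYxp (fun x p hp => P.dYp x hp) xs
    have wa := P.LH_w hμ (f := P.wa) (by simp) xs
    have wb := P.LH_w hμ (f := P.wb) (by simp) xs
    have wc := P.LH_w hμ (f := P.wc) (by simp) xs
    obtain ⟨K, hK, h1, h2⟩ : LH μ xs pa P.Yxx := by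
      have := a2.mul ((wa.add ((wb.add wb).mul a1)).add (wc.mul (a1.mul a1)))
      convert this using 2
      simp only [Yxx]; ring
    obtain ⟨L, hL, k1, k2⟩ : LH μ xs pa P.Yxp := by
      have := (a2.mul a2).mul (wb.add (wc.mul a1))
      convert this using 2
      simp only [Yxp]; ring
    refine ⟨K + L, by positivity, ?_⟩
    rintro f (rfl | rfl)
    · refine ⟨fun x hx p hp => (h1 x hx p hp).trans (by linarith), fun x hx x' hx' p hp => (h2 x hx x' hx' p hp).trans ?_⟩
      gcongr; linarith
    · refine ⟨fun x hx p hp => (k1 x hx p hp).trans (by linarith), fun x hx x' hx' p hp => (k2 x hx x' hx' p hp).trans ?_⟩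
      gcongr; linarith
end PD
end partW12

section
open scoped Topology ContDiff
open Real

theorem uniqS {η : ℝ → ℝ} {d : ℝ} (hη : ContDiff ℝ 2 η) (hηd : ∀ x, -d < η x) :
    UniqueDiffOn ℝ {z : ℝ × ℝ | -d ≤ z.2 ∧ z.2 ≤ η z.1} := by
  have hpos : ∀ x, 0 < η x + d := fun x => by linarith [hηd x]
  have e : {z : ℝ × ℝ | -d ≤ z.2 ∧ z.2 ≤ η z.1} = (fun z : ℝ × ℝ => (z.1, -d + z.2 * (η z.1 + d))) '' (univ ×ˢ Icc 0 1) := by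
    ext ⟨x, y⟩
    constructor
    · rintro ⟨h1, h2⟩
      have h1 : -d ≤ y := h1
      have h2 : y ≤ η x := h2
      refine ⟨(x, (y + d) / (η x + d)), ⟨mem_univ _, div_nonneg (by linarith) (hpos x).le, (div_le_one (hpos x)).2 (by linarith)⟩, ?_⟩
      dsimp only
      rw [div_mul_cancel₀ _ (hpos x).ne']; simp
    · rintro ⟨⟨x', t⟩, ⟨-, h0, h1⟩, h⟩
      simp only [Prod.mk.injEq] at h h0 h1
      obtain ⟨rfl, rfl⟩ := h
      have := mul_nonneg h0 (hpos x').le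
      have := mul_nonneg (sub_nonneg.2 h1) (hpos x').le
      exact ⟨by dsimp only; linarith, by dsimp only; linarith⟩
  rw [e]
  have hd : ∀ x, HasDerivAt η (deriv η x) x := fun x => (hη.differentiable (by norm_num) x).hasDerivAt
  refine (uniqueDiffOn_univ.prod (uniqueDiffOn_Icc one_pos)).image
    (f' := fun z => (ContinuousLinearMap.fst ℝ ℝ ℝ).prod (lin2 (z.2 * deriv η z.1) (η z.1 + d))) (fun z _ => ?_) (fun z _ => ?_)
  · have h1 : HasFDerivAt (fun z : ℝ × ℝ => η z.1) (deriv η z.1 • ContinuousLinearMap.fst ℝ ℝ ℝ) z := (hd z.1).comp_hasFDerivAt z hasFDerivAt_fst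
    have h2 := ((hasFDerivAt_snd (p := z)).mul (h1.add_const d)).const_add (-d)
    refine HasFDerivAt.hasFDerivWithinAt (hasFDerivAt_fst.prodMk (h2.congr_fderiv ?_))
    ext <;> simp [lin2]
  · refine Function.Surjective.denseRange fun w => ⟨(w.1, (w.2 - z.2 * deriv η z.1 * w.1) / (η z.1 + d)), ?_⟩
    have := (hpos z.1).ne'
    ext <;> simp [lin2]
    field_simp; ring

theorem hc {f : ℝ → ℝ} {K μ pa : ℝ} (hμ : 0 < μ) (h : ∀ p ∈ Icc pa 0, ∀ p' ∈ Icc pa 0, |f p - f p'| ≤ K * |p - p'| ^ μ) :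
    ContinuousOn f (Icc pa 0) := by
  intro p hp
  refine tendsto_iff_norm_sub_tendsto_zero.2 ?_
  have c : Continuous (fun q : ℝ => K * |q - p| ^ μ) := by
    have : Continuous (fun q : ℝ => |q - p| ^ μ) := (Real.continuous_rpow_const hμ.le).comp (by fun_prop)
    fun_prop
  have c4 := c.tendsto p
  simp only [sub_self, abs_zero, Real.zero_rpow hμ.ne', mul_zero] at c4
  refine squeeze_zero' (Filter.Eventually.of_forall fun _ => norm_nonneg _) ?_ (c4.mono_left nhdsWithin_le_nhds)
  filter_upwards [self_mem_nhdsWithin] with q hq using h q hq p hp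

theorem dquot {f : ℝ → ℝ} {f' x : ℝ} (h : HasDerivAt f f' x) :
    HasDerivAt (fun x => f x / √(1 + f x ^ 2)) (f' / (1 + f x ^ 2) ^ ((3:ℝ) / 2)) x := by
  have hp : 0 < 1 + f x ^ 2 := by positivity
  have h1 := ((h.pow 2).const_add 1).sqrt hp.ne'
  have h2 := h.div h1 (by positivity)
  refine h2.congr_deriv ?_
  have e1 : (1 + f x ^ 2) ^ ((3:ℝ) / 2) = (1 + f x ^ 2) * √(1 + f x ^ 2) := by
    rw [show (3:ℝ) / 2 = 1 + 1 / 2 by norm_num, Real.rpow_add hp, Real.rpow_one, Real.sqrt_eq_rpow]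
  have e2 := Real.sq_sqrt hp.le
  have e3 : 0 < √(1 + f x ^ 2) := by positivity
  simp only [Pi.pow_apply]
  rw [e1, e2]
  field_simp
  rw [e2]
  push_cast
  ring

theorem edist2_le (z z' : ℝ × ℝ) : edist2 z z' ≤ |z.1 - z'.1| + |z.2 - z'.2| := by
  refine Real.sqrt_le_iff.2 ⟨by positivity, ?_⟩
  have := mul_nonneg (abs_nonneg (z.1 - z'.1)) (abs_nonneg (z.2 - z'.2))
  nlinarith [sq_abs (z.1 - z'.1), sq_abs (z.2 - z'.2)]
end

/-- Theorem 2.2-type result: for the capillary-gravity stratified water-wave problem with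
Hölder continuous Bernoulli function `β` and continuously differentiable density `ρ` with
Hölder continuous derivative, and no stagnation points, every streamline — each level set
`{ψ = c}`, `c ∈ [0, −p₀]`, in the closed fluid domain, including the free surface
(`c = 0`) — is the graph of a real-analytic function; in particular the wave profile `η`
is real analytic. -/
theorem stratified_streamlines_analytic
    (p₀ d g σ Q μ δ : ℝ)
    (hp₀ : p₀ < 0) (hd : 0 < d) (hg : 0 < g) (hσ : 0 < σ)
    (hμ : μ ∈ Set.Ioo (0 : ℝ) 1) (hδ : 0 < δ)
    (η : ℝ → ℝ) (ψ : ℝ × ℝ → ℝ) (β ρ : ℝ → ℝ)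
    (hηd : ∀ x, -d < η x)
    -- the open fluid domain Ω and its closure Ω̄
    (Ωo Ωc : Set (ℝ × ℝ))
    (hΩo : Ωo = {z : ℝ × ℝ | -d < z.2 ∧ z.2 < η z.1})
    (hΩc : Ωc = {z : ℝ × ℝ | -d ≤ z.2 ∧ z.2 ≤ η z.1})
    -- η ∈ C^{2,μ}
    (hη : ContDiff ℝ 2 η)
    (hη2 : ∃ K, ∀ x x' : ℝ, |deriv (deriv η) x - deriv (deriv η) x'| ≤ K * |x - x'| ^ μ)
    -- ψ ∈ C²(Ω̄) with μ-Hölder continuous second derivatives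
    (hψ : ContDiffOn ℝ 2 ψ Ωc)
    (hψ2 : ∀ a b : ℕ, a + b = 2 → ∃ K, ∀ z ∈ Ωc, ∀ z' ∈ Ωc,
      |mpw Ωc a b ψ z - mpw Ωc a b ψ z'| ≤ K * (edist2 z z') ^ μ)
    -- β ∈ C^{0,μ}([p₀,0])
    (hβ : ∃ K, ∀ p ∈ Set.Icc p₀ 0, ∀ p' ∈ Set.Icc p₀ 0, |β p - β p'| ≤ K * |p - p'| ^ μ)
    -- ρ ∈ C^{1,μ}([p₀,0]), ρ > 0
    (hρpos : ∀ p ∈ Set.Icc p₀ 0, 0 < ρ p)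
    (hρ : ∀ p ∈ Set.Icc p₀ 0, DifferentiableAt ℝ ρ p)
    (hρ' : ∃ K, ∀ p ∈ Set.Icc p₀ 0, ∀ p' ∈ Set.Icc p₀ 0,
      |deriv ρ p - deriv ρ p'| ≤ K * |p - p'| ^ μ)
    -- Yih's equation Δψ − g y ρ'(−ψ) = −β(−ψ) in Ω
    (hpde : ∀ z ∈ Ωo,
      mpw Ωc 2 0 ψ z + mpw Ωc 0 2 ψ z - g * z.2 * deriv ρ (-ψ z) = -β (-ψ z))
    -- Bernoulli condition with surface tension on the free surface
    (hsurf : ∀ x : ℝ,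
      (mpw Ωc 1 0 ψ (x, η x)) ^ 2 + (mpw Ωc 0 1 ψ (x, η x)) ^ 2
        + 2 * g * (η x + d) * ρ (-ψ (x, η x))
        - 2 * σ * deriv (deriv η) x / (1 + (deriv η x) ^ 2) ^ ((3 : ℝ) / 2) = Q)
    -- kinematic boundary conditions
    (htop : ∀ x : ℝ, ψ (x, η x) = 0)
    (hbot : ∀ x : ℝ, ψ (x, -d) = -p₀)
    -- no stagnation: ψ_y ≤ −δ on Ω̄
    (hstag : ∀ z ∈ Ωc, mpw Ωc 0 1 ψ z ≤ -δ) :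
    (∀ c ∈ Set.Icc 0 (-p₀), ∃ f : ℝ → ℝ, AnalyticOnNhd ℝ f Set.univ ∧
      {z ∈ Ωc | ψ z = c} = {z : ℝ × ℝ | ∃ x : ℝ, z = (x, f x)}) ∧
    AnalyticOnNhd ℝ η Set.univ := by
  subst hΩc
  subst hΩo
  have hU := uniqS hη hηd
  set S : Set (ℝ × ℝ) := {z : ℝ × ℝ | -d ≤ z.2 ∧ z.2 ≤ η z.1} with hS
  let D := fderivWithin ℝ ψ S
  let E := fderivWithin ℝ D S
  have cD : ContDiffOn ℝ 1 D S := hψ.fderivWithin hU (by norm_num)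
  have cE : ContinuousOn E S := cD.continuousOn_fderivWithin hU le_rfl
  have m10 : ∀ z ∈ S, mpw S 1 0 ψ z = D z (1, 0) := fun z hz => by
    have := iteratedFDerivWithin_one_apply (f := ψ) (hU z hz) (fun i => if (i : ℕ) < 1 then ((1 : ℝ), (0 : ℝ)) else ((0 : ℝ), (1 : ℝ)))
    simpa [mpw] using this
  have m01 : ∀ z ∈ S, mpw S 0 1 ψ z = D z (0, 1) := fun z hz => by
    have := iteratedFDerivWithin_one_apply (f := ψ) (hU z hz) (fun i => if (i : ℕ) < 0 then ((1 : ℝ), (0 : ℝ)) else ((0 : ℝ), (1 : ℝ)))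
    simpa [mpw] using this
  have m20 : ∀ z ∈ S, mpw S 2 0 ψ z = E z (1, 0) (1, 0) := fun z hz => by
    have := iteratedFDerivWithin_two_apply ψ hU hz (fun i => if (i : ℕ) < 2 then ((1 : ℝ), (0 : ℝ)) else ((0 : ℝ), (1 : ℝ)))
    simpa [mpw] using this
  have m11 : ∀ z ∈ S, mpw S 1 1 ψ z = E z (1, 0) (0, 1) := fun z hz => by
    have := iteratedFDerivWithin_two_apply ψ hU hz (fun i => if (i : ℕ) < 1 then ((1 : ℝ), (0 : ℝ)) else ((0 : ℝ), (1 : ℝ)))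
    simpa [mpw] using this
  have m02 : ∀ z ∈ S, mpw S 0 2 ψ z = E z (0, 1) (0, 1) := fun z hz => by
    have := iteratedFDerivWithin_two_apply ψ hU hz (fun i => if (i : ℕ) < 0 then ((1 : ℝ), (0 : ℝ)) else ((0 : ℝ), (1 : ℝ)))
    simpa [mpw] using this
  have hηc : Continuous η := hη.continuous
  have oS : ∀ z : ℝ × ℝ, -d < z.2 → z.2 < η z.1 → S ∈ nhds z := fun z h1 h2 => by
    have o : IsOpen {z : ℝ × ℝ | -d < z.2 ∧ z.2 < η z.1} :=
      (isOpen_lt continuous_const continuous_snd).inter (isOpen_lt continuous_snd (hηc.comp continuous_fst))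
    exact Filter.mem_of_superset (o.mem_nhds ⟨h1, h2⟩) fun w hw => ⟨hw.1.le, hw.2.le⟩
  have hD : ∀ z ∈ S, HasFDerivWithinAt ψ (D z) S z := fun z hz => (hψ.differentiableOn (by norm_num) z hz).hasFDerivWithinAt
  have hE : ∀ z ∈ S, HasFDerivWithinAt D (E z) S z := fun z hz => (cD.differentiableOn (by norm_num) z hz).hasFDerivWithinAt
  have sym : ∀ z : ℝ × ℝ, -d < z.2 → z.2 < η z.1 → E z (0, 1) (1, 0) = E z (1, 0) (0, 1) := fun z h1 h2 => by
    have hn := oS z h1 h2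
    have := (hψ z (mem_of_mem_nhds hn)).isSymmSndFDerivWithinAt (by simp) hU
      (subset_closure (mem_interior_iff_mem_nhds.2 hn)) (mem_of_mem_nhds hn)
    exact this _ _
  have cev : ∀ (h k : ℝ × ℝ), ContinuousOn (fun z => E z h k) S := fun h k => (cE.clm_apply continuousOn_const).clm_apply continuousOn_const
  have cdv : ∀ (h : ℝ × ℝ), ContinuousOn (fun z => D z h) S := fun h => cD.continuousOn.clm_apply continuousOn_const
  have hev : ∀ (h : ℝ × ℝ) (z : ℝ × ℝ), -d < z.2 → z.2 < η z.1 → HasFDerivAt (fun z => D z h) (lin2 (E z (1, 0) h) (E z (0, 1) h)) z := fun h z h1 h2 => by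
    have hn := oS z h1 h2
    have := ((hE z (mem_of_mem_nhds hn)).hasFDerivAt hn).clm_apply (hasFDerivAt_const h z)
    refine this.congr_fderiv ?_
    ext <;> simp [lin2]
  have hhol : ∀ (a b : ℕ), a + b = 2 → ∀ f : ℝ × ℝ → ℝ, (∀ z ∈ S, mpw S a b ψ z = f z) → ∃ K, 0 ≤ K ∧
      ∀ z z' : ℝ × ℝ, -d ≤ z.2 → z.2 ≤ η z.1 → -d ≤ z'.2 → z'.2 ≤ η z'.1 → |f z - f z'| ≤ K * (|z.1 - z'.1| + |z.2 - z'.2|) ^ μ := by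
    intro a b hab f hf
    obtain ⟨K, hK⟩ := hψ2 a b hab
    refine ⟨|K|, abs_nonneg K, fun z z' h1 h2 h3 h4 => ?_⟩
    rw [← hf z ⟨h1, h2⟩, ← hf z' ⟨h3, h4⟩]
    have e0 : 0 ≤ edist2 z z' := Real.sqrt_nonneg _
    calc _ ≤ K * edist2 z z' ^ μ := hK z ⟨h1, h2⟩ z' ⟨h3, h4⟩
      _ ≤ |K| * edist2 z z' ^ μ := by gcongr; exact le_abs_self K
      _ ≤ _ := by gcongr; exacts [hμ.1.le, edist2_le z z']
  obtain ⟨Kβ, hβ⟩ := hβ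
  obtain ⟨Kρ, hρ'⟩ := hρ'
  let P : PD μ p₀ d δ :=
    { η := η, ψ := ψ, u := fun z => D z (1, 0), v := fun z => D z (0, 1)
      wa := fun z => E z (1, 0) (1, 0), wb := fun z => E z (1, 0) (0, 1), wc := fun z => E z (0, 1) (0, 1)
      b := fun p => -β p, r := fun p => g * deriv ρ p
      hδ := hδ, hpa := hp₀, hη := hηc, hηd := hηd
      c := by
        rintro f (rfl | rfl | rfl | rfl | rfl | rfl)
        exacts [hψ.continuousOn, cdv _, cdv _, cev _ _, cev _ _, cev _ _]
      dψ := fun z h1 h2 => by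
        have hn := oS z h1 h2
        refine ((hD z (mem_of_mem_nhds hn)).hasFDerivAt hn).congr_fderiv ?_
        ext <;> simp [lin2]
      du := fun z h1 h2 => by
        have := hev (1, 0) z h1 h2
        rwa [sym z h1 h2] at this
      dv := fun z h1 h2 => hev (0, 1) z h1 h2
      hv := fun z h1 h2 => by
        have := hstag z ⟨h1, h2⟩
        rwa [m01 z ⟨h1, h2⟩] at this
      hol := by
        rintro f (rfl | rfl | rfl)
        exacts [hhol 2 0 rfl _ m20, hhol 1 1 rfl _ m11, hhol 0 2 rfl _ m02]
      pde := fun z h1 h2 => by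
        have := hpde z ⟨h1, h2⟩
        rw [m20 z ⟨h1.le, h2.le⟩, m02 z ⟨h1.le, h2.le⟩] at this
        linarith
      top := htop, bot := hbot
      cb := (hc hμ.1 hβ).neg
      cr := continuousOn_const.mul (hc hμ.1 hρ') }
  let H := P.toHD hμ (1 / (2 * σ)) ((2 * g * ρ 0 * d - Q) / (2 * σ)) (g * ρ 0 / σ)
  have h0 : (0:ℝ) ∈ Icc p₀ 0 := ⟨hp₀.le, le_rfl⟩
  have hdη : ∀ x, HasDerivAt η (deriv η x) x := fun x => (hη.differentiable (by norm_num) x).hasDerivAt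
  have hdη2 : ∀ x, HasDerivAt (deriv η) (deriv (deriv η) x) x := fun x =>
    (((contDiff_succ_iff_deriv (n := 1)).1 hη).2.2.differentiable (by norm_num) x).hasDerivAt
  have mT : ∀ x, (x, η x) ∈ S := fun x => ⟨(hηd x).le, le_rfl⟩
  have hvT : ∀ x, D (x, η x) (0, 1) < 0 := fun x => by
    have := hstag _ (mT x)
    rw [m01 _ (mT x)] at this
    linarith
  have huT : ∀ x, D (x, η x) (1, 0) = - (D (x, η x) (0, 1) * deriv η x) := fun x => by
    have h1 := (hD (x, η x) (mT x)).comp_hasDerivAt x ((hasDerivAt_id x).prodMk (hdη x)) (Filter.Eventually.of_forall mT)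
    have h2 : (ψ ∘ fun x => (id x, η x)) = fun _ => (0:ℝ) := funext htop
    rw [h2] at h1
    have h3 := h1.unique (hasDerivAt_const x 0)
    have h4 : ((1:ℝ), deriv η x) = (1, 0) + deriv η x • ((0:ℝ), (1:ℝ)) := by simp
    rw [h4, map_add, map_smul, smul_eq_mul] at h3
    linarith
  have hYp : ∀ x, P.Yp (x, 0) = -(D (x, η x) (0, 1))⁻¹ := fun x => by
    change -(D (x, P.Y (x, 0)) (0, 1))⁻¹ = _
    rw [P.Ytop]
  have hYx : ∀ x, P.Yx (x, 0) = deriv η x := fun x => by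
    change D (x, P.Y (x, 0)) (1, 0) * P.Yp (x, 0) = _
    rw [hYp, P.Ytop]
    change D (x, η x) (1, 0) * _ = _
    rw [huT]
    have := (hvT x).ne
    field_simp
  have hTop : H.Top := by
    constructor
    · intro x
      change HasDerivAt (fun x => P.Y (x, 0)) (P.Yx (x, 0)) x
      simp only [P.Ytop, hYx]
      exact hdη x
    · intro x
      change HasDerivAt (fun x => P.Yx (x, 0) / √(1 + P.Yx (x, 0) ^ 2)) (1 / (2 * σ) * ((1 + P.Yx (x, 0) ^ 2) / P.Yp (x, 0) ^ 2)
        + (2 * g * ρ 0 * d - Q) / (2 * σ) + g * ρ 0 / σ * P.Y (x, 0)) x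
      simp only [P.Ytop, hYx, hYp]
      refine (dquot (hdη2 x)).congr_deriv ?_
      have h1 := hsurf x
      rw [m10 _ (mT x), m01 _ (mT x), htop, neg_zero, huT, mul_div_assoc] at h1
      set k := deriv (deriv η) x / (1 + deriv η x ^ 2) ^ ((3:ℝ) / 2)
      have := (hvT x).ne
      change k = _ + g * ρ 0 / σ * η x
      rw [← h1]
      field_simp
      ring
  have aη : AnalyticOnNhd ℝ η univ := fun x _ => by
    have := H.core hμ hp₀ x 0 1 0 (Or.inr ⟨rfl, rfl, rfl, hTop⟩)
    exact this.congr (Filter.Eventually.of_forall fun x => P.Ytop x)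
  refine ⟨fun c hc => ?_, aη⟩
  have hcI : -c ∈ Icc p₀ 0 := ⟨by linarith [hc.2], by linarith [hc.1]⟩
  refine ⟨fun x => P.Y (x, -c), fun x _ => ?_, ?_⟩
  · rcases eq_or_lt_of_le hcI.1 with h | h
    · refine (analyticAt_const (v := -d)).congr (Filter.Eventually.of_forall fun x => ?_)
      refine P.uniq le_rfl (hηd x).le (P.Y1 x hcI) (P.Y2 x hcI) ?_
      rw [P.Y3 x hcI, P.bot, h]
    · rcases eq_or_lt_of_le hcI.2 with h' | h'
      · simp only [h', P.Ytop]
        exact aη x trivial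
      · exact H.core hμ hp₀ x (-c) 0 (-1/2) (Or.inl ⟨rfl, rfl, h, h'⟩)
  · ext ⟨x, y⟩
    constructor
    · rintro ⟨hz, e⟩
      refine ⟨x, ?_⟩
      have : y = P.Y (x, -c) := P.uniq hz.1 hz.2 (P.Y1 x hcI) (P.Y2 x hcI) (e.trans (by rw [P.Y3 x hcI, neg_neg]))
      rw [this]
    · rintro ⟨x', e⟩
      rw [e]
      exact ⟨⟨P.Y1 x' hcI, P.Y2 x' hcI⟩, (P.Y3 x' hcI).trans (neg_neg c)⟩
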